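/- Pointwise dual ergodicity. Let $(X,\mu_X)$ be a $\sigma$-finite measure space and $f:X\to X$ a conservative, ergodic, measure-preserving map. Let $Y\subseteq X$ be measurable with $\mu_X(Y)=1$, let $\varphi(y)=\inf\{n\ge 1: f^n y\in Y\}$ be the first return time (finite for almost every $y\in Y$), $F=f^{\varphi}:Y\to Y$ the first return map, and $\mu=\mu_X|_Y$. Assume that $\mu(\varphi>n)=\ell(n)n^{-\beta}$ for all $n\ge1$, where $\beta\in(0,1]$ and $\ell:(0,\infty)\to(0,\infty)$ is slowly varying, i.e. measurable, bounded above and below by positive constants on each compact subset of $(0,\infty)$, and with $\ell(\lambda x)/\ell(x)\to1$ as $x\to\infty$ for every $\lambda>0$; if $\beta=1$ assume also that $\sum_{j\ge1}\ell(j)/j=\infty$. Let $R:L^1(Y)\to L^1(Y)$ be the transfer operator of $F$, i.e. $\int_Y (Rv)\,w\,d\mu=\int_Y v\,(w\circ F)\,d\mu$ for all $v\in L^1(Y)$, $w\in L^\infty(Y)$, and put $R_nv=R(1_{\{\varphi=n\}}v)$ for $n\ge1$. Let $\mathcal B\subseteq L^\infty(Y)$ be a complex Banach space of functions (modulo null sets)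 that contains the constants and satisfies $|v|_\infty\le\|v\|_{\mathcal B}$ for $v\in\mathcal B$, such that: (H1) each $R_n$, $n\ge1$, maps $\mathcal B$ boundedly into $\mathcal B$, and there is $C>0$ with $\|R_n\|_{\mathcal B}\le C\mu(\varphi=n)$ for all $n\ge1$; (H2)(i) $1$ is a simple isolated eigenvalue of $R:\mathcal B\to\mathcal B$, that is, $1$ is an eigenvalue, it is an isolated point of the spectrum, and it has algebraic multiplicity one: its spectral projection $\frac{1}{2\pi i}\oint_{|z-1|=r}(z-R)^{-1}\,dz$ ($r>0$ small) has rank one. Let $L:L^1(X)\to L^1(X)$ be the transfer operator of $f$, i.e. $\int_X (Lv)\,w\,d\mu_X=\int_X v\,(w\circ f)\,d\mu_X$ for all $v\in L^1(X)$, $w\in L^\infty(X)$. Put $m(n)=\ell(n)$ and $d_\beta=\pi^{-1}\sin(\beta\pi)$ if $\beta\in(0,1)$, and $m(n)=\sum_{j=1}^n\ell(j)/j$ and $d_1=1$ if $\beta=1$. Then for every $v\in L^1(X,\mu_X)$, $$\lim_{n\to\infty} m(n)\,n^{-\beta}\sum_{j=1}^{n}L^jv=\beta^{-1}d_\beta\int_X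 v\,d\mu_X\qquad \mu_X\text{-almost everywhere on }X.$$ -/

import Mathlib

open MeasureTheory Filter Topology
open scoped ENNReal

/-- `ℓ : (0,∞) → (0,∞)` is slowly varying (the values of `ℓ` outside `(0,∞)` are irrelevant). -/
structure SlowlyVarying (ℓ : ℝ → ℝ) : Prop where
  measurable : Measurable (fun x : Set.Ioi (0 : ℝ) => ℓ x)
  bounds : ∀ K : Set ℝ, IsCompact K → K ⊆ Set.Ioi 0 →
    ∃ c C : ℝ, 0 < c ∧ ∀ x ∈ K, c ≤ ℓ x ∧ ℓ x ≤ C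
  tendsto : ∀ a : ℝ, 0 < a → Tendsto (fun x => ℓ (a * x) / ℓ x) atTop (𝓝 1)

section Transfer

/-- Auxiliary form of `exists_transferOperator`, with the `σ`-algebra of `T` as a variable. -/
theorem exists_transferOperator_aux {X : Type*} {m : MeasurableSpace X} {mX : MeasurableSpace X}
    {μ : Measure X} {T : X → X} [SigmaFinite μ] (hT : MeasurePreserving T μ μ)
    (hm_def : m = MeasurableSpace.comap T mX) :
    ∃ L : Lp ℂ 1 μ →L[ℂ] Lp ℂ 1 μ, ∀ (v : Lp ℂ 1 μ) (w : X → ℂ), MemLp w ∞ μ →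
      ∫ x, L v x * w x ∂μ = ∫ x, v x * w (T x) ∂μ := by
  have hm : m ≤ mX := hm_def ▸ hT.measurable.comap_le
  have hTm : Measurable[m, mX] T := hm_def ▸ comap_measurable T
  have hsf : SigmaFinite (μ.trim hm) := by
    refine ⟨⟨⟨fun n => T ⁻¹' spanningSets μ n, fun _ => trivial, fun n => ?_, ?_⟩⟩⟩
    · rw [trim_measurableSet_eq hm (hTm (measurableSet_spanningSets μ n)),
        hT.measure_preimage (measurableSet_spanningSets μ n).nullMeasurableSet]
      exact measure_spanningSets_lt_top μ n
    · rw [← Set.preimage_iUnion, iUnion_spanningSets, Set.preimage_univ]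
  set U := Lp.compMeasurePreservingₗᵢ ℂ T hT (E := ℂ) (p := 1) with hU
  -- the conditional expectation given the `σ`-algebra of `T` is of the form `u ∘ T`
  have key : ∀ v : Lp ℂ 1 μ, ∃ u : Lp ℂ 1 μ, (U u : X → ℂ) =ᵐ[μ] μ[v | m] := by
    intro v
    have hsm : StronglyMeasurable[MeasurableSpace.comap T mX] (μ[v | m]) :=
      hm_def ▸ stronglyMeasurable_condExp (μ := μ) (m := m) (f := v)
    obtain ⟨g, hg, hgT⟩ := hsm.exists_eq_measurable_comp
    have hgs : AEStronglyMeasurable g μ := hg.aestronglyMeasurable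
    have hmem : MemLp g 1 μ := by
      refine ⟨hgs, ?_⟩
      rw [← eLpNorm_comp_measurePreserving hgs hT, ← hgT]
      exact (memLp_one_iff_integrable.2 integrable_condExp).2
    refine ⟨hmem.toLp g, ?_⟩
    have h1 : (U (hmem.toLp g) : X → ℂ) =ᵐ[μ] (hmem.toLp g) ∘ T :=
      Lp.coeFn_compMeasurePreserving _ hT
    have h2 : (hmem.toLp g) ∘ T =ᵐ[μ] g ∘ T :=
      hT.quasiMeasurePreserving.ae_eq_comp hmem.coeFn_toLp
    rw [hgT]
    exact h1.trans h2
  choose A hA using key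
  have hinj : Function.Injective U := U.injective
  have hint : ∀ v : Lp ℂ 1 μ, Integrable v μ := fun v => L1.integrable_coeFn v
  let A' : Lp ℂ 1 μ →ₗ[ℂ] Lp ℂ 1 μ :=
    { toFun := A
      map_add' := fun v v' => by
        apply hinj
        rw [map_add]
        apply Lp.ext
        filter_upwards [hA (v + v'), hA v, hA v', Lp.coeFn_add (U (A v)) (U (A v')),
          condExp_congr_ae (m := m) (Lp.coeFn_add v v'), condExp_add (hint v) (hint v') m]
          with x h1 h2 h3 h4 h5 h6
        rw [h1, h4, h5, h6, Pi.add_apply, Pi.add_apply, h2, h3]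
      map_smul' := fun c v => by
        apply hinj
        rw [map_smul]
        apply Lp.ext
        filter_upwards [hA (c • v), hA v, Lp.coeFn_smul c (U (A v)),
          condExp_congr_ae (m := m) (Lp.coeFn_smul c v), condExp_smul (μ := μ) c v m]
          with x h1 h2 h4 h5 h6
        simp only [RingHom.id_apply]
        rw [h1, h4, h5, h6, Pi.smul_apply, Pi.smul_apply, h2] }
  refine ⟨A'.mkContinuous 1 fun v => ?_, fun v w hw => ?_⟩
  · rw [one_mul]
    change ‖A v‖ ≤ ‖v‖
    rw [← U.norm_map (A v), Lp.norm_def, Lp.norm_def, eLpNorm_congr_ae (hA v)]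
    exact ENNReal.toReal_mono (Lp.eLpNorm_ne_top v) (eLpNorm_condExp_le_eLpNorm _ le_rfl)
  · change ∫ x, A v x * w x ∂μ = _
    have hint1 : Integrable (fun x => A v x * w x) μ := (hint (A v)).mul_of_top_left hw
    have hwT : MemLp (w ∘ T) ∞ μ := hw.comp_measurePreserving hT
    have hint2 : Integrable (fun x => v x * w (T x)) μ := (hint v).mul_of_top_left hwT
    have e1 : ∫ x, A v x * w x ∂μ = ∫ x, A v (T x) * w (T x) ∂μ := by
      have h := integral_map hT.measurable.aemeasurable (f := fun x => A v x * w x)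
        (by rw [hT.map_eq]; exact hint1.aestronglyMeasurable)
      rwa [hT.map_eq] at h
    have hwm : AEStronglyMeasurable[m] (w ∘ T) μ := by
      refine ⟨hw.1.mk w ∘ T, hw.1.stronglyMeasurable_mk.comp_measurable hTm, ?_⟩
      exact hT.quasiMeasurePreserving.ae_eq_comp hw.1.ae_eq_mk
    have e2 := condExp_bilin_of_aestronglyMeasurable_right (ContinuousLinearMap.mul ℝ ℂ) (m := m)
      hwm hint2 (hint v)
    have e3 : (U (A v) : X → ℂ) =ᵐ[μ] (A v) ∘ T := Lp.coeFn_compMeasurePreserving _ hT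
    rw [e1, ← integral_condExp hm (f := fun x => v x * w (T x))]
    refine integral_congr_ae ?_
    filter_upwards [e2, e3, hA v] with x h2 h3 h4
    simp only [ContinuousLinearMap.mul_apply', Function.comp_apply] at h2 h3
    rw [h2, ← h3, h4]

/-- The transfer operator of a measure-preserving map of a `σ`-finite space exists. -/
theorem exists_transferOperator {X : Type*} [MeasurableSpace X] {μ : Measure X} {T : X → X}
    [SigmaFinite μ] (hT : MeasurePreserving T μ μ) :
    ∃ L : Lp ℂ 1 μ →L[ℂ] Lp ℂ 1 μ, ∀ (v : Lp ℂ 1 μ) (w : X → ℂ), MemLp w ∞ μ →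
      ∫ x, L v x * w x ∂μ = ∫ x, v x * w (T x) ∂μ :=
  exists_transferOperator_aux hT rfl

/-- The transfer operator `L : L¹(μ) → L¹(μ)` of a measure-preserving map `T`: the operator with
`∫ (L v) w dμ = ∫ v (w ∘ T) dμ` for all `v ∈ L¹` and `w ∈ L^∞`. -/
noncomputable def transferOperator {X : Type*} [MeasurableSpace X] {μ : Measure X} {T : X → X}
    [SigmaFinite μ] (hT : MeasurePreserving T μ μ) : Lp ℂ 1 μ →L[ℂ] Lp ℂ 1 μ :=
  (exists_transferOperator hT).choose

theorem integral_transferOperator_mul {X : Type*} [MeasurableSpace X] {μ : Measure X} {T : X → X}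
    [SigmaFinite μ] (hT : MeasurePreserving T μ μ) (v : Lp ℂ 1 μ) (w : X → ℂ)
    (hw : MemLp w ∞ μ) :
    ∫ x, transferOperator hT v x * w x ∂μ = ∫ x, v x * w (T x) ∂μ :=
  (exists_transferOperator hT).choose_spec v w hw

/-- The duality formula determines the value of the transfer operator. -/
theorem eq_transferOperator {X : Type*} [MeasurableSpace X] {μ : Measure X} {T : X → X}
    [SigmaFinite μ] (hT : MeasurePreserving T μ μ) (v u : Lp ℂ 1 μ)
    (hu : ∀ w : X → ℂ, MemLp w ∞ μ → ∫ x, u x * w x ∂μ = ∫ x, v x * w (T x) ∂μ) :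
    u = transferOperator hT v := by
  apply Lp.ext
  refine Integrable.ae_eq_of_forall_setIntegral_eq _ _ (L1.integrable_coeFn u)
    (L1.integrable_coeFn _) fun s hs _ => ?_
  have hw : MemLp (s.indicator fun _ => (1 : ℂ)) ∞ μ := (memLp_top_const 1).indicator hs
  have h := (hu _ hw).trans (integral_transferOperator_mul hT v _ hw).symm
  have e : ∀ z : X → ℂ, ∫ x, z x * s.indicator (fun _ => (1 : ℂ)) x ∂μ = ∫ x in s, z x ∂μ := by
    intro z
    rw [← integral_indicator hs]
    congr 1
    ext x
    by_cases hx : x ∈ s <;> simp [hx]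
  rwa [e, e] at h

end Transfer

section FirstReturn

variable {X : Type*}

/-- The first return time `φ(x) = inf {n ≥ 1 : fⁿ x ∈ Y}` (with the value `0` at the points that
never return, a null subset of `Y` when `f` is conservative). -/
noncomputable def firstReturnTime (f : X → X) (Y : Set X) (x : X) : ℕ :=
  sInf {n : ℕ | 1 ≤ n ∧ f^[n] x ∈ Y}

/-- The first return map `F = f^φ`. -/
noncomputable def firstReturnMap (f : X → X) (Y : Set X) (x : X) : X :=
  f^[firstReturnTime f Y x] x

theorem firstReturnTime_eq_iff (f : X → X) (Y : Set X) (x : X) {n : ℕ} (hn : 1 ≤ n) :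
    firstReturnTime f Y x = n ↔
      f^[n] x ∈ Y ∧ ∀ k, 1 ≤ k → k < n → f^[k] x ∉ Y := by
  unfold firstReturnTime
  constructor
  · rintro h
    have hne : {n : ℕ | 1 ≤ n ∧ f^[n] x ∈ Y}.Nonempty := Nat.nonempty_of_pos_sInf (by omega)
    have hmem := Nat.sInf_mem hne
    rw [h] at hmem
    refine ⟨hmem.2, fun k hk hkn hkY => ?_⟩
    have hle : sInf {n : ℕ | 1 ≤ n ∧ f^[n] x ∈ Y} ≤ k := Nat.sInf_le (And.intro hk hkY)
    omega
  · rintro ⟨h1, h2⟩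
    have hmem : n ∈ {n : ℕ | 1 ≤ n ∧ f^[n] x ∈ Y} := ⟨hn, h1⟩
    refine le_antisymm (Nat.sInf_le hmem) (le_csInf ⟨n, hmem⟩ fun k hk => ?_)
    by_contra hlt
    exact h2 k hk.1 (by omega) hk.2

variable [MeasurableSpace X] {μ : Measure X} {f : X → X} {Y : Set X}

theorem measurable_firstReturnTime (hf : Measurable f) (hY : MeasurableSet Y) :
    Measurable (firstReturnTime f Y) := by
  have hpos : ∀ n : ℕ, 1 ≤ n → MeasurableSet (firstReturnTime f Y ⁻¹' {n}) := by
    intro n hn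
    have : firstReturnTime f Y ⁻¹' {n} =
        f^[n] ⁻¹' Y ∩ ⋂ k : ℕ, ⋂ _ : 1 ≤ k, ⋂ _ : k < n, (f^[k] ⁻¹' Y)ᶜ := by
      ext x
      simp [firstReturnTime_eq_iff f Y x hn]
    rw [this]
    exact ((hf.iterate n) hY).inter (.iInter fun k => .iInter fun _ => .iInter fun _ =>
      ((hf.iterate k) hY).compl)
  refine measurable_to_countable' fun n => ?_
  rcases Nat.eq_zero_or_pos n with rfl | hn
  · have : firstReturnTime f Y ⁻¹' {0} = (⋃ n : ℕ, ⋃ _ : 1 ≤ n, firstReturnTime f Y ⁻¹' {n})ᶜ := by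
      ext x
      simp only [Set.mem_preimage, Set.mem_singleton_iff, Set.mem_compl_iff, Set.mem_iUnion]
      constructor
      · rintro h ⟨n, hn, h'⟩
        omega
      · intro h
        by_contra h0
        exact h ⟨_, Nat.one_le_iff_ne_zero.2 h0, rfl⟩
    rw [this]
    exact (MeasurableSet.iUnion fun n => .iUnion fun hn => hpos n hn).compl
  · exact hpos n hn

theorem measurable_firstReturnMap (hf : Measurable f) (hY : MeasurableSet Y) :
    Measurable (firstReturnMap f Y) := by
  intro A hA
  have : firstReturnMap f Y ⁻¹' A =
      ⋃ n : ℕ, firstReturnTime f Y ⁻¹' {n} ∩ f^[n] ⁻¹' A := by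
    ext x
    simp [firstReturnMap]
  rw [this]
  exact .iUnion fun n => (measurable_firstReturnTime hf hY (measurableSet_singleton n)).inter
    ((hf.iterate n) hA)

/-- The first return map of a conservative measure-preserving map preserves the restriction of the
measure to `Y`. -/
theorem measurePreserving_firstReturnMap (hf : MeasurePreserving f μ μ) (hc : Conservative f μ)
    (hY : MeasurableSet Y) (hfin : μ Y ≠ ∞) :
    MeasurePreserving (firstReturnMap f Y) (μ.restrict Y) (μ.restrict Y) := by
  have hFm := measurable_firstReturnMap hf.measurable hY
  have hφm := measurable_firstReturnTime hf.measurable hY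
  refine ⟨hFm, ?_⟩
  have : IsFiniteMeasure (μ.restrict Y) := ⟨by simpa using hfin.lt_top⟩
  have hret : ∀ᵐ y ∂μ.restrict Y, 1 ≤ firstReturnTime f Y y := by
    rw [ae_restrict_iff' hY]
    filter_upwards [hc.ae_mem_imp_frequently_image_mem hY.nullMeasurableSet] with y hy hyY
    obtain ⟨n, hn, hnY⟩ := (frequently_atTop.1 (hy hyY)) 1
    have hne : {n : ℕ | 1 ≤ n ∧ f^[n] y ∈ Y}.Nonempty := ⟨n, hn, hnY⟩
    exact (Nat.sInf_mem hne).1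
  -- points whose orbit reaches `A` at time `n`, after avoiding `Y` at times `0, …, n - 1`
  let E : Set X → ℕ → Set X := fun A n => {x | f^[n] x ∈ A ∧ ∀ k < n, f^[k] x ∉ Y}
  let D : Set X → ℕ → Set X := fun A n =>
    Y ∩ (firstReturnTime f Y ⁻¹' {n + 1} ∩ f^[n + 1] ⁻¹' A)
  have hEm : ∀ A, MeasurableSet A → ∀ n, MeasurableSet (E A n) := by
    intro A hA n
    have : E A n = f^[n] ⁻¹' A ∩ ⋂ k : ℕ, ⋂ _ : k < n, (f^[k] ⁻¹' Y)ᶜ := by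
      ext x
      simp [E]
    rw [this]
    exact ((hf.measurable.iterate n) hA).inter (.iInter fun k => .iInter fun _ =>
      ((hf.measurable.iterate k) hY).compl)
  have hDm : ∀ A, MeasurableSet A → ∀ n, MeasurableSet (D A n) := fun A hA n =>
    hY.inter ((hφm (measurableSet_singleton _)).inter ((hf.measurable.iterate _) hA))
  have hstep : ∀ A, MeasurableSet A → A ⊆ Y → ∀ n, μ (E A n) = μ (D A n) + μ (E A (n + 1)) := by
    intro A hA hAY n
    rw [← hf.measure_preimage (hEm A hA n).nullMeasurableSet,
      ← measure_inter_add_sdiff (f ⁻¹' E A n) hY]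
    congr 2
    · ext x
      simp only [E, D, Set.mem_inter_iff, Set.mem_preimage, Set.mem_ofPred_eq,
        Set.mem_singleton_iff, firstReturnTime_eq_iff f Y x (Nat.le_add_left 1 n),
        ← Function.iterate_succ_apply]
      constructor
      · rintro ⟨⟨h1, h2⟩, h3⟩
        refine ⟨h3, ⟨hAY h1, fun k hk hkn => ?_⟩, h1⟩
        obtain ⟨j, rfl⟩ : ∃ j, k = j + 1 := ⟨k - 1, by omega⟩
        exact h2 j (by omega)
      · rintro ⟨h3, ⟨_, h2⟩, h1⟩
        exact ⟨⟨h1, fun k hk => h2 (k + 1) (by omega) (by omega)⟩, h3⟩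
    · ext x
      simp only [E, Set.mem_sdiff, Set.mem_preimage, Set.mem_ofPred_eq,
        ← Function.iterate_succ_apply]
      constructor
      · rintro ⟨⟨h1, h2⟩, h3⟩
        refine ⟨h1, fun k hk => ?_⟩
        rcases k with _ | j
        · exact h3
        · exact h2 j (by omega)
      · rintro ⟨h1, h2⟩
        exact ⟨⟨h1, fun k hk => h2 (k + 1) (by omega)⟩, h2 0 (by omega)⟩
  have hsum : ∀ A, MeasurableSet A → A ⊆ Y → ∀ n,
      μ A = ∑ k ∈ Finset.range n, μ (D A k) + μ (E A n) := by
    intro A hA hAY n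
    induction n with
    | zero => simp [E]
    | succ n ih => rw [Finset.sum_range_succ, add_assoc, ← hstep A hA hAY n, ← ih]
  have hle : ∀ A, MeasurableSet A → A ⊆ Y →
      (μ.restrict Y).map (firstReturnMap f Y) A ≤ μ A := by
    intro A hA hAY
    rw [Measure.map_apply hFm hA]
    have h1 : (μ.restrict Y) (firstReturnMap f Y ⁻¹' A) ≤ μ (⋃ n, D A n) := by
      rw [Measure.restrict_apply (hFm hA)]
      have hret' := (ae_restrict_iff' hY).1 hret
      refine measure_mono_ae ?_
      filter_upwards [hret'] with x hx hxA
      have hx1 := hx hxA.2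
      refine Set.mem_iUnion.2 ⟨firstReturnTime f Y x - 1, hxA.2, ?_, ?_⟩
      · simp only [Set.mem_preimage, Set.mem_singleton_iff]
        omega
      · have := hxA.1
        simp only [Set.mem_preimage] at this ⊢
        rwa [Nat.sub_add_cancel hx1]
    refine h1.trans ((measure_iUnion_le _).trans ?_)
    refine ENNReal.tsum_le_of_sum_range_le fun n => ?_
    rw [hsum A hA hAY n]
    exact le_self_add
  have hmap_le : (μ.restrict Y).map (firstReturnMap f Y) ≤ μ.restrict Y := by
    refine Measure.le_iff.2 fun A hA => ?_
    have hYc : (μ.restrict Y).map (firstReturnMap f Y) Yᶜ = 0 := by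
      rw [Measure.map_apply hFm hY.compl]
      change ∀ᵐ y ∂μ.restrict Y, firstReturnMap f Y y ∈ Y
      filter_upwards [hret] with y hy
      exact ((firstReturnTime_eq_iff f Y y hy).1 rfl).1
    rw [← measure_inter_add_sdiff A hY, Measure.restrict_apply hA]
    have hnull : (μ.restrict Y).map (firstReturnMap f Y) (A \ Y) = 0 :=
      measure_mono_null (fun x hx => hx.2) hYc
    rw [hnull, add_zero]
    exact hle _ (hA.inter hY) Set.inter_subset_right
  refine Measure.eq_of_le_of_measure_univ_eq hmap_le ?_
  rw [Measure.map_apply hFm MeasurableSet.univ, Set.preimage_univ]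

/-- The transfer operator `R` of the first return map `F`, on `L¹(Y)`, where the measure on `Y` is
the restriction of `μ`. -/
noncomputable def returnTransfer (hf : MeasurePreserving f μ μ) (hc : Conservative f μ)
    (hY : MeasurableSet Y) (hY1 : μ Y = 1) :
    Lp ℂ 1 (μ.restrict Y) →L[ℂ] Lp ℂ 1 (μ.restrict Y) :=
  haveI : IsFiniteMeasure (μ.restrict Y) := ⟨by simp [hY1]⟩
  transferOperator (measurePreserving_firstReturnMap hf hc hY (by simp [hY1]))

/-- The operators `R_n v = R (1_{φ = n} v)` on `L¹(Y)`. -/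
noncomputable def returnTransferAt (hf : MeasurePreserving f μ μ) (hc : Conservative f μ)
    (hY : MeasurableSet Y) (hY1 : μ Y = 1) (n : ℕ) (v : Lp ℂ 1 (μ.restrict Y)) :
    Lp ℂ 1 (μ.restrict Y) :=
  returnTransfer hf hc hY hY1
    (((Lp.memLp v).indicator
      (measurable_firstReturnTime hf.measurable hY (measurableSet_singleton n))).toLp
        ((firstReturnTime f Y ⁻¹' {n}).indicator v))

end FirstReturn

section Spectral

variable {B : Type*} [NormedAddCommGroup B] [NormedSpace ℂ B]

/-- The Riesz spectral projection `(2πi)⁻¹ ∮_{|z - z₀| = r} (z - A)⁻¹ dz`. -/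
noncomputable def spectralProjection (A : B →L[ℂ] B) (z₀ : ℂ) (r : ℝ) : B →L[ℂ] B :=
  (2 * Real.pi * Complex.I : ℂ)⁻¹ • ∮ z in C(z₀, r), resolvent A z

/-- `z₀` is an eigenvalue of `A`, isolated in the spectrum of `A`, and simple: it has algebraic
multiplicity one, that is, the corresponding spectral projection has rank one. -/
def IsSimpleIsolatedEigenvalue (A : B →L[ℂ] B) (z₀ : ℂ) : Prop :=
  Module.End.HasEigenvalue (A : B →ₗ[ℂ] B) z₀ ∧
    ∃ r : ℝ, 0 < r ∧ spectrum ℂ A ∩ Metric.closedBall z₀ r = {z₀} ∧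
      Module.finrank ℂ (LinearMap.range (spectralProjection A z₀ r : B →ₗ[ℂ] B)) = 1

end Spectral

section Hypotheses

variable {X : Type*} [MeasurableSpace X] {μ : Measure X} {f : X → X} {Y : Set X}
  {B : Type*} [NormedAddCommGroup B] [NormedSpace ℂ B]

/-- The injection `ι` makes `B` a space of (classes of) functions contained in `L^∞(Y)`, with
`|v|_∞ ≤ ‖v‖`, that contains the constant functions. The finite measure `ν` is the one on `Y`, and
`ι` takes values in `L¹(ν) ⊇ L^∞(ν)`. -/
structure IsFunctionSpace (ν : Measure X) (ι : B →ₗ[ℂ] Lp ℂ 1 ν) : Prop where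
  injective : Function.Injective ι
  eLpNorm_top_le : ∀ v : B, eLpNorm (ι v) ∞ ν ≤ ENNReal.ofReal ‖v‖
  const_mem : ∀ c : ℂ, ∃ v : B, ι v =ᵐ[ν] fun _ => c

/-- Hypothesis (H1): each `R_n`, `n ≥ 1`, restricts to a bounded operator of `B`, with
`‖R_n‖ ≤ C μ(φ = n)`. -/
def HypothesisH1 (hf : MeasurePreserving f μ μ) (hc : Conservative f μ)
    (hY : MeasurableSet Y) (hY1 : μ Y = 1) (ι : B →ₗ[ℂ] Lp ℂ 1 (μ.restrict Y)) : Prop :=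
  ∃ C : ℝ, 0 < C ∧ ∀ n : ℕ, 1 ≤ n → ∃ A : B →L[ℂ] B,
    (∀ v : B, ι (A v) = returnTransferAt hf hc hY hY1 n (ι v)) ∧
    ‖A‖ ≤ C * (μ.restrict Y).real {y | firstReturnTime f Y y = n}

/-- Hypothesis (H2)(i): `1` is a simple isolated eigenvalue of `R` acting on `B`. -/
def HypothesisH2i (hf : MeasurePreserving f μ μ) (hc : Conservative f μ)
    (hY : MeasurableSet Y) (hY1 : μ Y = 1) (ι : B →ₗ[ℂ] Lp ℂ 1 (μ.restrict Y)) : Prop :=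
  ∃ A : B →L[ℂ] B, (∀ v : B, ι (A v) = returnTransfer hf hc hY hY1 (ι v)) ∧
    IsSimpleIsolatedEigenvalue A 1

end Hypotheses

/-- `m(n) = ℓ(n)` for `β ∈ (0,1)` and `m(n) = ∑_{j=1}^n ℓ(j)/j` for `β = 1`. -/
noncomputable def normalizer (ℓ : ℝ → ℝ) (β : ℝ) (n : ℕ) : ℝ :=
  open Classical in if β = 1 then ∑ j ∈ Finset.Icc 1 n, ℓ j / j else ℓ n

/-- `d_β = π⁻¹ sin(βπ)` for `β ∈ (0,1)` and `d_1 = 1`. -/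
noncomputable def dConst (β : ℝ) : ℝ :=
  open Classical in if β = 1 then 1 else Real.pi⁻¹ * Real.sin (β * Real.pi)

section RegularVariation

variable {q : ℕ → ℝ} {β : ℝ}

theorem tendsto_ratio_mul_of_tendsto_ratio (hpos : ∀ n, 0 < q n)
    (hrv : ∀ k : ℕ, 1 ≤ k → Tendsto (fun n => q (k * n) / q n) atTop (𝓝 ((k : ℝ) ^ (-β))))
    {j k : ℕ} (hj : 1 ≤ j) (hk : 1 ≤ k) :
    Tendsto (fun n => q (j * n) / q (k * n)) atTop (𝓝 (((j : ℝ) / k) ^ (-β))) := by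
  have hk0 : (0 : ℝ) < (k : ℝ) ^ (-β) := Real.rpow_pos_of_pos (by exact_mod_cast hk) _
  have h := (hrv j hj).div (hrv k hk) hk0.ne'
  rw [Real.div_rpow (by positivity) (by positivity)]
  refine h.congr fun n => ?_
  have := (hpos n).ne'
  have := (hpos (k * n)).ne'
  simp only [Pi.div_apply]
  field_simp

theorem tendsto_natCeil_mul_succ_div (a : ℝ) (ha : 0 < a) :
    Tendsto (fun k : ℕ => ((⌈a * (k + 1)⌉₊ : ℕ) : ℝ) / k) atTop (𝓝 a) := by
  have h1 : Tendsto (fun k : ℕ => ((⌈a * ((k + 1 : ℕ) : ℝ)⌉₊ : ℕ) : ℝ) / ((k + 1 : ℕ) : ℝ)) atTop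
      (𝓝 a) := ((tendsto_nat_ceil_mul_div_atTop ha.le).comp tendsto_natCast_atTop_atTop).comp
        (tendsto_add_atTop_nat 1)
  have h2 : Tendsto (fun k : ℕ => ((k + 1 : ℕ) : ℝ) / k) atTop (𝓝 1) := by
    have := tendsto_one_div_atTop_nhds_zero_nat (𝕜 := ℝ)
    have := (tendsto_const_nhds (x := (1 : ℝ))).add this
    rw [add_zero] at this
    refine this.congr' ?_
    filter_upwards [eventually_gt_atTop 0] with k hk
    have : (k : ℝ) ≠ 0 := by positivity
    push_cast
    field_simp
  have := h1.mul h2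
  rw [mul_one] at this
  refine this.congr' ?_
  filter_upwards [eventually_gt_atTop 0] with k hk
  have : (k : ℝ) ≠ 0 := by positivity
  push_cast
  field_simp

theorem tendsto_natFloor_mul_div_succ (a : ℝ) (ha : 0 < a) :
    Tendsto (fun k : ℕ => ((⌊a * k⌋₊ : ℕ) : ℝ) / (k + 1 : ℕ)) atTop (𝓝 a) := by
  have h1 : Tendsto (fun k : ℕ => ((⌊a * (k : ℝ)⌋₊ : ℕ) : ℝ) / (k : ℝ)) atTop
      (𝓝 a) := (tendsto_nat_floor_mul_div_atTop ha.le).comp tendsto_natCast_atTop_atTop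
  have h2 : Tendsto (fun k : ℕ => (k : ℝ) / ((k : ℝ) + 1)) atTop (𝓝 1) :=
    tendsto_natCast_div_add_atTop 1
  have := h1.mul h2
  rw [mul_one] at this
  refine this.congr' ?_
  filter_upwards [eventually_gt_atTop 0] with k hk
  have : (k : ℝ) ≠ 0 := by positivity
  push_cast
  field_simp

/-- A monotone sequence which varies regularly along integer multiples varies regularly. -/
theorem tendsto_ratio_floor (hq : Antitone q) (hpos : ∀ n, 0 < q n)
    (hrv : ∀ k : ℕ, 1 ≤ k → Tendsto (fun n => q (k * n) / q n) atTop (𝓝 ((k : ℝ) ^ (-β))))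
    {a : ℝ} (ha : 0 < a) :
    Tendsto (fun N : ℕ => q ⌊a * N⌋₊ / q N) atTop (𝓝 (a ^ (-β))) := by
  have hcont : ContinuousAt (fun x : ℝ => x ^ (-β)) a :=
    Real.continuousAt_rpow_const _ _ (Or.inl ha.ne')
  refine tendsto_order.2 ⟨fun b hb => ?_, fun b hb => ?_⟩
  · have h1 := (hcont.tendsto.comp (tendsto_natCeil_mul_succ_div a ha)).eventually
      (lt_mem_nhds hb)
    obtain ⟨k, hk, hk1⟩ := (h1.and (eventually_ge_atTop 1)).exists
    simp only [Function.comp_apply] at hk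
    have hj1 : 1 ≤ ⌈a * (k + 1)⌉₊ := Nat.one_le_iff_ne_zero.2 (by
      have : 0 < a * (k + 1) := by positivity
      exact (Nat.ceil_pos.2 this).ne')
    have h2 := (tendsto_ratio_mul_of_tendsto_ratio hpos hrv hj1 hk1).eventually (lt_mem_nhds hk)
    have hdiv : Tendsto (fun N : ℕ => N / k) atTop atTop := Nat.tendsto_div_const_atTop (by omega)
    filter_upwards [hdiv.eventually h2, hdiv.eventually (eventually_ge_atTop k)] with N hN hNk
    refine hN.trans_le ?_
    have e1 : q (⌈a * (k + 1)⌉₊ * (N / k)) ≤ q ⌊a * N⌋₊ := by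
      refine hq (Nat.floor_le_of_le ?_)
      have hN1 : N ≤ (k + 1) * (N / k) := by
        have := Nat.div_add_mod N k
        have := Nat.mod_lt N (show k > 0 by omega)
        nlinarith
      have hN2 : (N : ℝ) ≤ (k + 1) * ((N / k : ℕ) : ℝ) := by exact_mod_cast hN1
      calc a * N ≤ a * ((k + 1) * ((N / k : ℕ) : ℝ)) := by gcongr
        _ = a * (k + 1) * ((N / k : ℕ) : ℝ) := by ring
        _ ≤ (⌈a * (k + 1)⌉₊ : ℝ) * ((N / k : ℕ) : ℝ) := by gcongr; exact Nat.le_ceil _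
        _ = _ := by push_cast; rfl
    have e2 : q N ≤ q (k * (N / k)) := hq (Nat.mul_div_le N k)
    exact div_le_div₀ (hpos _).le e1 (hpos _) e2
  · have h1 := (hcont.tendsto.comp (tendsto_natFloor_mul_div_succ a ha)).eventually
      (gt_mem_nhds hb)
    have h1' : ∀ᶠ k : ℕ in atTop, 1 ≤ ⌊a * k⌋₊ := by
      have : Tendsto (fun k : ℕ => a * (k : ℝ)) atTop atTop :=
        tendsto_natCast_atTop_atTop.const_mul_atTop ha
      exact (tendsto_nat_floor_atTop.comp this).eventually (eventually_ge_atTop 1)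
    obtain ⟨k, hk, hj1, hk1⟩ := (h1.and (h1'.and (eventually_ge_atTop 1))).exists
    simp only [Function.comp_apply] at hk
    have h2 := (tendsto_ratio_mul_of_tendsto_ratio hpos hrv hj1
      (show 1 ≤ k + 1 by omega)).eventually (gt_mem_nhds hk)
    have hdiv : Tendsto (fun N : ℕ => N / k) atTop atTop := Nat.tendsto_div_const_atTop (by omega)
    filter_upwards [hdiv.eventually h2, hdiv.eventually (eventually_ge_atTop k)] with N hN hNk
    refine lt_of_le_of_lt ?_ hN
    have e1 : q ⌊a * N⌋₊ ≤ q (⌊a * k⌋₊ * (N / k)) := by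
      refine hq (Nat.le_floor ?_)
      have hN1 : k * (N / k) ≤ N := Nat.mul_div_le N k
      have hN2 : (k : ℝ) * ((N / k : ℕ) : ℝ) ≤ N := by exact_mod_cast hN1
      calc ((⌊a * k⌋₊ * (N / k) : ℕ) : ℝ) = (⌊a * k⌋₊ : ℝ) * ((N / k : ℕ) : ℝ) := by push_cast; rfl
        _ ≤ (a * k) * ((N / k : ℕ) : ℝ) := by
            gcongr; exact Nat.floor_le (by positivity)
        _ = a * (k * ((N / k : ℕ) : ℝ)) := by ring
        _ ≤ a * N := by gcongr
    have e2 : q ((k + 1) * (N / k)) ≤ q N := by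
      refine hq ?_
      have := Nat.div_add_mod N k
      have := Nat.mod_lt N (show k > 0 by omega)
      nlinarith
    exact div_le_div₀ (hpos _).le e1 (hpos _) e2

theorem sum_range_mul_le_of_antitone (hq : Antitone q) (m N : ℕ) :
    ∑ k ∈ Finset.range (m * N), q k ≤ m * ∑ k ∈ Finset.range N, q k := by
  induction m with
  | zero => simp
  | succ m ih =>
    rw [Nat.succ_mul, Finset.sum_range_add]
    have : ∑ x ∈ Finset.range N, q (m * N + x) ≤ ∑ k ∈ Finset.range N, q k :=
      Finset.sum_le_sum fun x _ => hq (by omega)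
    push_cast
    linarith

theorem mul_le_sum_range_of_antitone (hq : Antitone q) (N : ℕ) :
    N * q N ≤ ∑ k ∈ Finset.range N, q k := by
  have : ∑ _k ∈ Finset.range N, q N ≤ ∑ k ∈ Finset.range N, q k :=
    Finset.sum_le_sum fun x hx => hq (Finset.mem_range.1 hx).le
  simpa using this

theorem sub_le_of_antitone (hq : Antitone q) {M N : ℕ} (h : M ≤ N) :
    ∑ k ∈ Finset.range N, q k - ∑ k ∈ Finset.range M, q k ≤ ((N : ℝ) - M) * q M := by
  obtain ⟨d, rfl⟩ := Nat.exists_eq_add_of_le h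
  rw [Finset.sum_range_add, add_sub_cancel_left]
  have : ∑ x ∈ Finset.range d, q (M + x) ≤ ∑ _x ∈ Finset.range d, q M :=
    Finset.sum_le_sum fun x _ => hq (by omega)
  simpa using this

theorem le_sub_of_antitone (hq : Antitone q) {M N : ℕ} (h : M ≤ N) :
    ((N : ℝ) - M) * q N ≤ ∑ k ∈ Finset.range N, q k - ∑ k ∈ Finset.range M, q k := by
  obtain ⟨d, rfl⟩ := Nat.exists_eq_add_of_le h
  rw [Finset.sum_range_add, add_sub_cancel_left]
  have : ∑ _x ∈ Finset.range d, q (M + d) ≤ ∑ x ∈ Finset.range d, q (M + x) :=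
    Finset.sum_le_sum fun x hx => hq (by have := Finset.mem_range.1 hx; omega)
  simpa using this

theorem sum_range_pos_of_pos (hpos : ∀ n, 0 < q n) {N : ℕ} (hN : 0 < N) :
    0 < ∑ k ∈ Finset.range N, q k :=
  Finset.sum_pos (fun k _ => hpos k) (Finset.nonempty_range_iff.2 hN.ne')

/-- A Potter type bound. -/
theorem exists_potter_bound (hq : Antitone q) (hpos : ∀ n, 0 < q n)
    (hrv : ∀ k : ℕ, 1 ≤ k → Tendsto (fun n => q (k * n) / q n) atTop (𝓝 ((k : ℝ) ^ (-β))))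
    {γ : ℝ} (hγ0 : 0 < γ) (hγ : β < γ) :
    ∃ C : ℝ, 0 < C ∧ ∀ n N : ℕ, 1 ≤ n → n ≤ N → q n * (n : ℝ) ^ γ ≤ C * (q N * (N : ℝ) ^ γ) := by
  have h1 := tendsto_ratio_floor hq hpos hrv (a := 1 / 2) (by norm_num)
  have h2 : ((1 : ℝ) / 2) ^ (-β) < 2 ^ γ := by
    rw [one_div, Real.inv_rpow (by norm_num), ← Real.rpow_neg (by norm_num), neg_neg]
    exact Real.rpow_lt_rpow_of_exponent_lt (by norm_num) hγ
  obtain ⟨n₀, hn₀⟩ := eventually_atTop.1 (h1.eventually (gt_mem_nhds h2))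
  have hfl : ∀ N : ℕ, ⌊(1 : ℝ) / 2 * N⌋₊ = N / 2 := by
    intro N
    rw [show (1 : ℝ) / 2 * N = (N : ℝ) / ((2 : ℕ) : ℝ) by push_cast; ring]
    exact Nat.floor_div_eq_div N 2
  have hhalf : ∀ N, n₀ ≤ N → q (N / 2) ≤ 2 ^ γ * q N := by
    intro N hN
    have := hn₀ N hN
    rw [hfl, div_lt_iff₀ (hpos N)] at this
    exact this.le
  set C₀ : ℝ := q 0 * ((n₀ : ℝ) + 2) ^ γ / q (n₀ + 2) with hC₀
  have hC₀pos : 0 < C₀ := div_pos (mul_pos (hpos 0) (Real.rpow_pos_of_pos (by positivity) _)) (hpos _)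
  refine ⟨max C₀ (2 ^ γ), lt_max_of_lt_left hC₀pos, fun n N hn => ?_⟩
  induction N using Nat.strong_induction_on with
  | _ N ih =>
  intro hnN
  have hNpos : (0 : ℝ) < (N : ℝ) ^ γ := Real.rpow_pos_of_pos (by exact_mod_cast (by omega)) _
  have hX : 0 < q N * (N : ℝ) ^ γ := mul_pos (hpos N) hNpos
  by_cases hN : N < n₀ + 2
  · calc q n * (n : ℝ) ^ γ ≤ q 0 * ((n₀ : ℝ) + 2) ^ γ := by
          gcongr
          · exact (hpos 0).le
          · exact hq (Nat.zero_le n)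
          · exact_mod_cast (by omega : n ≤ n₀ + 2)
      _ = C₀ * q (n₀ + 2) := by rw [hC₀]; field_simp [(hpos (n₀ + 2)).ne']
      _ ≤ C₀ * (q N * (N : ℝ) ^ γ) := by
          gcongr
          calc q (n₀ + 2) ≤ q N := hq hN.le
            _ = q N * 1 := (mul_one _).symm
            _ ≤ q N * (N : ℝ) ^ γ := by
              have := (hpos N).le
              gcongr
              exact Real.one_le_rpow (by exact_mod_cast (by omega)) hγ0.le
      _ ≤ _ := by gcongr; exact le_max_left _ _
  · by_cases hM : n ≤ N / 2
    · refine (ih (N / 2) (by omega) hM).trans ?_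
      have hC : 0 < max C₀ (2 ^ γ) := lt_max_of_lt_left hC₀pos
      refine mul_le_mul_of_nonneg_left ?_ hC.le
      calc q (N / 2) * ((N / 2 : ℕ) : ℝ) ^ γ ≤ (2 ^ γ * q N) * ((N : ℝ) / 2) ^ γ := by
            gcongr
            · exact mul_nonneg (by positivity) (hpos N).le
            · exact hhalf N (by omega)
            · exact_mod_cast Nat.cast_div_le (α := ℝ) (m := N) (n := 2)
        _ = q N * (N : ℝ) ^ γ := by
            rw [Real.div_rpow (by positivity) (by norm_num)]
            field_simp
    · calc q n * (n : ℝ) ^ γ ≤ (2 ^ γ * q N) * (N : ℝ) ^ γ := by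
            gcongr
            · exact mul_nonneg (by positivity) (hpos N).le
            · exact (hq (by omega)).trans (hhalf N (by omega))
        _ = 2 ^ γ * (q N * (N : ℝ) ^ γ) := by ring
        _ ≤ _ := by gcongr; exact le_max_right _ _

theorem measurable_comp_floor (q : ℕ → ℝ) (a : ℝ) : Measurable fun t : ℝ => q ⌊a * t⌋₊ :=
  (measurable_from_top (f := q)).comp (Nat.measurable_floor.comp (measurable_const_mul a))

theorem integral_comp_floor (q : ℕ → ℝ) (N : ℕ) :
    ∫ x in (0 : ℝ)..N, q ⌊x⌋₊ = ∑ k ∈ Finset.range N, q k := by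
  have hk : ∀ k : ℕ, Set.EqOn (fun x : ℝ => q ⌊x⌋₊) (fun _ => q k) (Set.Ioo (k : ℝ) (k + 1 : ℕ)) := by
    intro k x hx
    have : ⌊x⌋₊ = k := (Nat.floor_eq_iff (by have := hx.1; have : (0 : ℝ) ≤ k := by positivity
                                             linarith)).2 ⟨hx.1.le, by exact_mod_cast hx.2⟩
    simp [this]
  have hint : ∀ k : ℕ, IntervalIntegrable (fun x : ℝ => q ⌊x⌋₊) volume (k : ℝ) (k + 1 : ℕ) := by
    intro k
    rw [intervalIntegrable_iff_integrableOn_Ioo_of_le (by push_cast; linarith)]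
    exact (integrableOn_congr_fun (hk k) measurableSet_Ioo).2 (integrableOn_const (by simp))
  have := intervalIntegral.sum_integral_adjacent_intervals (n := N) (a := fun k : ℕ => (k : ℝ))
    (f := fun x : ℝ => q ⌊x⌋₊) (μ := volume) (fun k _ => hint k)
  simp only [Nat.cast_zero] at this
  rw [← this]
  refine Finset.sum_congr rfl fun k _ => ?_
  rw [intervalIntegral.integral_of_le (by push_cast; linarith), integral_Ioc_eq_integral_Ioo,
    setIntegral_congr_fun measurableSet_Ioo (hk k)]
  simp

theorem integral_comp_floor_mul (q : ℕ → ℝ) {N : ℕ} (hN : 0 < N) :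
    ∫ t in (0 : ℝ)..1, q ⌊(N : ℝ) * t⌋₊ = (∑ k ∈ Finset.range N, q k) / N := by
  have hN' : (N : ℝ) ≠ 0 := by positivity
  have := intervalIntegral.integral_comp_mul_left (a := 0) (b := 1) (fun x : ℝ => q ⌊x⌋₊) hN'
  rw [this, mul_zero, mul_one, integral_comp_floor, smul_eq_mul]
  field_simp

theorem tendsto_sum_div_mul_of_lt_one (hq : Antitone q) (hpos : ∀ n, 0 < q n)
    (hrv : ∀ k : ℕ, 1 ≤ k → Tendsto (fun n => q (k * n) / q n) atTop (𝓝 ((k : ℝ) ^ (-β))))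
    (hβ0 : 0 < β) (hβ : β < 1) :
    Tendsto (fun N : ℕ => (∑ k ∈ Finset.range N, q k) / (N * q N)) atTop (𝓝 (1 - β)⁻¹) := by
  obtain ⟨γ, hγ, hγ1⟩ := exists_between hβ
  have hγ0 : 0 < γ := hβ0.trans hγ
  obtain ⟨C, hC, hpot⟩ := exists_potter_bound hq hpos hrv hγ0 hγ
  have hlim : ∫ t in (0 : ℝ)..1, t ^ (-β) = (1 - β)⁻¹ := by
    rw [integral_rpow (Or.inl (by linarith)), Real.one_rpow, Real.zero_rpow (by linarith)]
    rw [sub_zero, one_div, neg_add_eq_sub]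
  have hev : (fun N : ℕ => ∫ t in (0 : ℝ)..1, q ⌊(N : ℝ) * t⌋₊ / q N) =ᶠ[atTop]
      fun N : ℕ => (∑ k ∈ Finset.range N, q k) / (N * q N) := by
    filter_upwards [eventually_gt_atTop 0] with N hN
    rw [intervalIntegral.integral_div, integral_comp_floor_mul q hN, div_div]
  rw [← hlim]
  refine Tendsto.congr' hev ?_
  set C' : ℝ := C * 2 ^ γ + q 0 / q 1 * C with hC'
  have hq01 : 0 < q 0 / q 1 := div_pos (hpos 0) (hpos 1)
  refine intervalIntegral.tendsto_integral_filter_of_dominated_convergence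
    (fun t => C' * t ^ (-γ)) ?_ ?_ ?_ ?_
  · exact .of_forall fun N => ((measurable_comp_floor q N).div_const _).aestronglyMeasurable
  · filter_upwards [eventually_gt_atTop 0] with N hN
    refine .of_forall fun t ht => ?_
    rw [Set.uIoc_of_le zero_le_one] at ht
    have hNr : (0 : ℝ) < N := by exact_mod_cast hN
    have hpN := hpos N
    rw [Real.norm_of_nonneg (div_nonneg (hpos _).le hpN.le), div_le_iff₀ hpN]
    have hNγ : (0 : ℝ) < (N : ℝ) ^ γ := Real.rpow_pos_of_pos hNr _
    have htγ : (0 : ℝ) < t ^ (-γ) := Real.rpow_pos_of_pos ht.1 _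
    by_cases h1 : 1 ≤ ⌊(N : ℝ) * t⌋₊
    · have hle : ⌊(N : ℝ) * t⌋₊ ≤ N := by
        refine Nat.floor_le_of_le ?_
        nlinarith [ht.2]
      have hb := hpot _ N h1 hle
      have hfl : (N : ℝ) * t / 2 ≤ (⌊(N : ℝ) * t⌋₊ : ℝ) := by
        have := Nat.lt_floor_add_one ((N : ℝ) * t)
        have h1' : (1 : ℝ) ≤ (⌊(N : ℝ) * t⌋₊ : ℝ) := by exact_mod_cast h1
        linarith
      have hNt : 0 < (N : ℝ) * t / 2 := by have := ht.1; positivity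
      have hb2 : q ⌊(N : ℝ) * t⌋₊ * ((N : ℝ) * t / 2) ^ γ ≤ C * (q N * (N : ℝ) ^ γ) :=
        le_trans (mul_le_mul_of_nonneg_left (Real.rpow_le_rpow hNt.le hfl hγ0.le) (hpos _).le) hb
      have e : ((N : ℝ) * t / 2) ^ γ = (N : ℝ) ^ γ * (t ^ (-γ))⁻¹ * (2 ^ γ)⁻¹ := by
        rw [Real.div_rpow (by have := ht.1; positivity) (by norm_num),
          Real.mul_rpow hNr.le ht.1.le, Real.rpow_neg ht.1.le, inv_inv]
        rfl
      rw [e] at hb2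
      have h2γ : (0 : ℝ) < 2 ^ γ := by positivity
      have hb3 : q ⌊(N : ℝ) * t⌋₊ ≤ C * 2 ^ γ * t ^ (-γ) * q N := by
        have : q ⌊(N : ℝ) * t⌋₊ * ((N : ℝ) ^ γ * (t ^ (-γ))⁻¹ * (2 ^ γ)⁻¹) ≤
          (C * 2 ^ γ * t ^ (-γ) * q N) * ((N : ℝ) ^ γ * (t ^ (-γ))⁻¹ * (2 ^ γ)⁻¹) := by
          refine hb2.trans (le_of_eq ?_)
          field_simp
        exact le_of_mul_le_mul_right this (by positivity)
      refine hb3.trans ?_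
      rw [hC']
      gcongr
      exact le_add_of_nonneg_right (by positivity)
    · have h0 : ⌊(N : ℝ) * t⌋₊ = 0 := by omega
      have hlt : (N : ℝ) * t < 1 := by simpa using (Nat.floor_eq_zero.1 h0)
      have hb := hpot 1 N le_rfl hN
      simp only [Nat.cast_one, Real.one_rpow, mul_one] at hb
      have hN' : (N : ℝ) ^ γ ≤ t ^ (-γ) := by
        rw [Real.rpow_neg ht.1.le, ← Real.inv_rpow ht.1.le]
        refine Real.rpow_le_rpow hNr.le ?_ hγ0.le
        rw [le_inv_comm₀ hNr ht.1, ← one_div, le_div_iff₀ hNr]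
        linarith
      calc q ⌊(N : ℝ) * t⌋₊ = q 0 / q 1 * q 1 := by rw [h0]; field_simp [(hpos 1).ne']
        _ ≤ q 0 / q 1 * (C * (q N * t ^ (-γ))) := by
          refine mul_le_mul_of_nonneg_left (hb.trans ?_) hq01.le
          gcongr
        _ = (q 0 / q 1 * C) * t ^ (-γ) * q N := by ring
        _ ≤ _ := by
          rw [hC']
          gcongr
          exact le_add_of_nonneg_left (by positivity)
  · exact (intervalIntegral.intervalIntegrable_rpow' (by linarith)).const_mul _
  · refine .of_forall fun t ht => ?_
    rw [Set.uIoc_of_le zero_le_one] at ht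
    simpa only [mul_comm t] using tendsto_ratio_floor hq hpos hrv ht.1

theorem tendsto_sum_div_mul_of_eq_one (hq : Antitone q) (hpos : ∀ n, 0 < q n)
    (hrv : ∀ k : ℕ, 1 ≤ k → Tendsto (fun n => q (k * n) / q n) atTop (𝓝 ((k : ℝ) ^ (-1 : ℝ)))) :
    Tendsto (fun N : ℕ => (∑ k ∈ Finset.range N, q k) / (N * q N)) atTop atTop := by
  let M : ℕ → ℕ → ℕ := fun i N => ⌊((1 : ℝ) / 2) ^ i * N⌋₊
  have hMlim : ∀ i, Tendsto (fun N : ℕ => (M i N : ℝ) / N) atTop (𝓝 ((1 / 2) ^ i)) := fun i =>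
    (tendsto_nat_floor_mul_div_atTop (by positivity)).comp tendsto_natCast_atTop_atTop
  have hqlim : ∀ i, Tendsto (fun N : ℕ => q (M i N) / q N) atTop (𝓝 (2 ^ i)) := by
    intro i
    have := tendsto_ratio_floor hq hpos hrv (a := (1 / 2) ^ i) (by positivity)
    have e : (((1 : ℝ) / 2) ^ i) ^ (-1 : ℝ) = 2 ^ i := by
      rw [Real.rpow_neg_one, ← inv_pow]
      norm_num
    rwa [e] at this
  have hterm : ∀ i, Tendsto (fun N : ℕ => ((M i N : ℝ) / N - (M (i + 1) N : ℝ) / N) *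
      (q (M i N) / q N)) atTop (𝓝 (1 / 2)) := by
    intro i
    have := ((hMlim i).sub (hMlim (i + 1))).mul (hqlim i)
    convert this using 2
    rw [pow_succ, sub_mul, mul_right_comm, ← mul_pow]
    norm_num
  have hmono : ∀ i N, M (i + 1) N ≤ M i N := by
    intro i N
    refine Nat.floor_le_floor ?_
    gcongr ?_ * _
    exact pow_le_pow_of_le_one (by norm_num) (by norm_num) (Nat.le_succ i)
  refine tendsto_atTop.2 fun b => ?_
  obtain ⟨K, hK⟩ := exists_nat_gt (2 * b)
  have hsum := tendsto_finsetSum (Finset.range K) fun i _ => hterm i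
  simp only [Finset.sum_const, Finset.card_range, nsmul_eq_mul] at hsum
  have hb : b < K * (1 / 2 : ℝ) := by linarith
  filter_upwards [hsum.eventually (lt_mem_nhds hb), eventually_gt_atTop 0] with N hN hN0
  refine hN.le.trans ?_
  have hNr : (0 : ℝ) < N := by exact_mod_cast hN0
  have hpN := hpos N
  rw [le_div_iff₀ (by positivity), Finset.sum_mul]
  have h0 : M 0 N = N := by simp [M]
  calc ∑ i ∈ Finset.range K, ((M i N : ℝ) / N - (M (i + 1) N : ℝ) / N) * (q (M i N) / q N) *
        (N * q N)
      = ∑ i ∈ Finset.range K, ((M i N : ℝ) - M (i + 1) N) * q (M i N) := by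
        refine Finset.sum_congr rfl fun i _ => ?_
        field_simp
    _ ≤ ∑ i ∈ Finset.range K, (∑ k ∈ Finset.range (M i N), q k -
          ∑ k ∈ Finset.range (M (i + 1) N), q k) :=
        Finset.sum_le_sum fun i _ => le_sub_of_antitone hq (hmono i N)
    _ = ∑ k ∈ Finset.range (M 0 N), q k - ∑ k ∈ Finset.range (M K N), q k :=
        Finset.sum_range_sub' (fun i => ∑ k ∈ Finset.range (M i N), q k) K
    _ ≤ ∑ k ∈ Finset.range N, q k := by
        rw [h0, sub_le_self_iff]
        exact Finset.sum_nonneg fun k _ => (hpos k).le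

/-- Karamata's theorem for the sums of a regularly varying monotone sequence. -/
theorem tendsto_mul_div_sum (hq : Antitone q) (hpos : ∀ n, 0 < q n)
    (hrv : ∀ k : ℕ, 1 ≤ k → Tendsto (fun n => q (k * n) / q n) atTop (𝓝 ((k : ℝ) ^ (-β))))
    (hβ0 : 0 < β) (hβ : β ≤ 1) :
    Tendsto (fun N : ℕ => (N * q N) / (∑ k ∈ Finset.range N, q k)) atTop (𝓝 (1 - β)) := by
  rcases hβ.lt_or_eq with h | rfl
  · have := (tendsto_sum_div_mul_of_lt_one hq hpos hrv hβ0 h).inv₀ (by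
      have : (1 - β) ≠ 0 := by linarith
      positivity)
    simpa only [inv_inv, inv_div] using this
  · have := (tendsto_sum_div_mul_of_eq_one hq hpos hrv).inv_tendsto_atTop
    simpa only [sub_self, Pi.inv_def, inv_div] using this

theorem tendsto_floor_mul_atTop {a : ℝ} (ha : 0 < a) :
    Tendsto (fun N : ℕ => ⌊a * (N : ℝ)⌋₊) atTop atTop :=
  tendsto_nat_floor_atTop.comp (tendsto_natCast_atTop_atTop.const_mul_atTop ha)

theorem tendsto_sum_ratio_floor (hq : Antitone q) (hpos : ∀ n, 0 < q n)
    (hrv : ∀ k : ℕ, 1 ≤ k → Tendsto (fun n => q (k * n) / q n) atTop (𝓝 ((k : ℝ) ^ (-β))))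
    (hβ0 : 0 < β) (hβ : β ≤ 1) {a : ℝ} (ha : 0 < a) :
    Tendsto (fun N : ℕ => (∑ k ∈ Finset.range ⌊a * N⌋₊, q k) / ∑ k ∈ Finset.range N, q k) atTop
      (𝓝 (a ^ (1 - β))) := by
  have hQ := tendsto_mul_div_sum hq hpos hrv hβ0 hβ
  have hfl := tendsto_floor_mul_atTop ha
  have hr := tendsto_ratio_floor hq hpos hrv ha
  have hd : Tendsto (fun N : ℕ => ((⌊a * N⌋₊ : ℕ) : ℝ) / N) atTop (𝓝 a) :=
    (tendsto_nat_floor_mul_div_atTop ha.le).comp tendsto_natCast_atTop_atTop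
  rcases hβ.lt_or_eq with h | rfl
  · have hne : (1 - β) ≠ 0 := by linarith
    have h1 := (hQ.div (hQ.comp hfl) hne).mul (hd.mul hr)
    have e : (1 - β) / (1 - β) * (a * a ^ (-β)) = a ^ (1 - β) := by
      rw [div_self hne, one_mul, sub_eq_add_neg, Real.rpow_add ha, Real.rpow_one]
    rw [e] at h1
    refine h1.congr' ?_
    filter_upwards [eventually_gt_atTop 0, hfl.eventually (eventually_gt_atTop 0)] with N hN hN2
    have h2 := (sum_range_pos_of_pos hpos hN).ne'
    have h3 := (sum_range_pos_of_pos hpos hN2).ne'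
    have h4 : (N : ℝ) ≠ 0 := by positivity
    have h5 : ((⌊a * N⌋₊ : ℕ) : ℝ) ≠ 0 := by positivity
    have h6 := (hpos N).ne'
    have h7 := (hpos ⌊a * N⌋₊).ne'
    simp only [Pi.div_apply, Function.comp_apply]
    generalize ⌊a * (N : ℝ)⌋₊ = M at *
    field_simp
  · rw [sub_self, Real.rpow_zero]
    rw [sub_self] at hQ
    rcases le_total 1 a with h1 | h1
    · have hup : Tendsto (fun N : ℕ => 1 + (((⌊a * N⌋₊ : ℕ) : ℝ) / N - 1) *
          ((N * q N) / (∑ k ∈ Finset.range N, q k))) atTop (𝓝 1) := by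
        have := ((hd.sub_const 1).mul hQ).const_add 1
        simpa using this
      refine tendsto_of_tendsto_of_tendsto_of_le_of_le' tendsto_const_nhds hup ?_ ?_
      · filter_upwards [eventually_gt_atTop 0] with N hN
        rw [one_le_div (sum_range_pos_of_pos hpos hN)]
        refine Finset.sum_le_sum_of_subset_of_nonneg (Finset.range_mono ?_) fun k _ _ => (hpos k).le
        refine Nat.le_floor ?_
        have : (0 : ℝ) ≤ N := by positivity
        nlinarith
      · filter_upwards [eventually_gt_atTop 0] with N hN
        have hp := sum_range_pos_of_pos hpos hN
        have hle : N ≤ ⌊a * N⌋₊ := by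
          refine Nat.le_floor ?_
          have : (0 : ℝ) ≤ N := by positivity
          nlinarith
        have := sub_le_of_antitone hq hle
        rw [div_le_iff₀ hp]
        have h4 : (N : ℝ) ≠ 0 := by positivity
        calc _ ≤ ∑ k ∈ Finset.range N, q k + (((⌊a * N⌋₊ : ℕ) : ℝ) - N) * q N := by linarith
          _ = _ := by field_simp
    · have hlow : Tendsto (fun N : ℕ => (1 + ((((⌊a * N⌋₊ : ℕ) : ℝ) / N)⁻¹ - 1) *
          ((⌊a * N⌋₊ * q ⌊a * N⌋₊) / (∑ k ∈ Finset.range ⌊a * N⌋₊, q k)))⁻¹) atTop (𝓝 1) := by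
        have := ((((hd.inv₀ ha.ne').sub_const 1).mul (hQ.comp hfl)).const_add 1).inv₀ (by simp)
        simpa using this
      refine tendsto_of_tendsto_of_tendsto_of_le_of_le' hlow tendsto_const_nhds ?_ ?_
      · filter_upwards [eventually_gt_atTop 0, hfl.eventually (eventually_gt_atTop 0)] with N hN hN2
        have hp := sum_range_pos_of_pos hpos hN
        have hp2 := sum_range_pos_of_pos hpos hN2
        have hle : ⌊a * N⌋₊ ≤ N := by
          refine Nat.floor_le_of_le ?_
          have : (0 : ℝ) ≤ N := by positivity
          nlinarith
        have := sub_le_of_antitone hq hle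
        rw [← inv_div (∑ k ∈ Finset.range N, q k)]
        refine inv_anti₀ (div_pos hp hp2) ?_
        rw [div_le_iff₀ hp2]
        have h4 : (N : ℝ) ≠ 0 := by positivity
        have h5 : ((⌊a * N⌋₊ : ℕ) : ℝ) ≠ 0 := by positivity
        calc _ ≤ ∑ k ∈ Finset.range ⌊a * N⌋₊, q k + ((N : ℝ) - ⌊a * N⌋₊) * q ⌊a * N⌋₊ := by
              linarith
          _ = _ := by field_simp
      · filter_upwards [eventually_gt_atTop 0] with N hN
        rw [div_le_one (sum_range_pos_of_pos hpos hN)]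
        refine Finset.sum_le_sum_of_subset_of_nonneg (Finset.range_mono ?_) fun k _ _ => (hpos k).le
        refine Nat.floor_le_of_le ?_
        have : (0 : ℝ) ≤ N := by positivity
        nlinarith

theorem tendsto_sum_range_succ_ratio (hq : Antitone q) (hpos : ∀ n, 0 < q n) :
    Tendsto (fun N : ℕ => (∑ k ∈ Finset.range (N + 1), q k) / ∑ k ∈ Finset.range N, q k) atTop
      (𝓝 1) := by
  have hup : Tendsto (fun N : ℕ => 1 + 1 / (N : ℝ)) atTop (𝓝 1) := by
    simpa using (tendsto_one_div_atTop_nhds_zero_nat (𝕜 := ℝ)).const_add 1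
  refine tendsto_of_tendsto_of_tendsto_of_le_of_le' tendsto_const_nhds hup ?_ ?_
  · filter_upwards [eventually_gt_atTop 0] with N hN
    rw [one_le_div (sum_range_pos_of_pos hpos hN), Finset.sum_range_succ]
    linarith [hpos N]
  · filter_upwards [eventually_gt_atTop 0] with N hN
    have hp := sum_range_pos_of_pos hpos hN
    have := mul_le_sum_range_of_antitone hq N
    have hNr : (0 : ℝ) < N := by exact_mod_cast hN
    rw [div_le_iff₀ hp, Finset.sum_range_succ, add_mul, one_mul, add_le_add_iff_left,
      one_div_mul_eq_div, le_div_iff₀ hNr]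
    linarith

theorem summable_mul_exp_neg (hq : Antitone q) (hpos : ∀ n, 0 < q n) {s : ℝ} (hs : 0 < s) :
    Summable fun n : ℕ => q n * Real.exp (-(s * n)) := by
  have : Summable fun n : ℕ => q 0 * Real.exp (-s) ^ n :=
    (summable_geometric_of_lt_one (Real.exp_pos _).le (by simpa using hs)).mul_left _
  refine Summable.of_nonneg_of_le (fun n => mul_nonneg (hpos n).le (Real.exp_pos _).le)
    (fun n => ?_) this
  rw [← Real.exp_nat_mul, show (n : ℝ) * -s = -(s * n) by ring]
  gcongr
  exact hq (Nat.zero_le n)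

theorem tsum_mul_exp_neg_eq_integral (hq : Antitone q) (hpos : ∀ n, 0 < q n) {s : ℝ} (hs : 0 < s) :
    ∑' n : ℕ, q n * Real.exp (-(s * n)) =
      ∫ t in Set.Ioi (0 : ℝ), (∑ k ∈ Finset.range (⌊s⁻¹ * t⌋₊ + 1), q k) * Real.exp (-t) := by
  let F : ℕ → ℝ → ℝ := fun n => (Set.Ioi (s * n)).indicator fun t => q n * Real.exp (-t)
  have hsub : ∀ n : ℕ, Set.Ioi (s * n) ⊆ Set.Ioi (0 : ℝ) := fun n =>
    Set.Ioi_subset_Ioi (by positivity)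
  have hFint : ∀ n, Integrable (F n) (volume.restrict (Set.Ioi 0)) := fun n =>
    ((integrable_indicator_iff measurableSet_Ioi).2
      ((integrableOn_exp_neg_Ioi (s * n)).const_mul (q n))).mono_measure Measure.restrict_le_self
  have hFnn : ∀ n t, 0 ≤ F n t := fun n t =>
    Set.indicator_nonneg (fun t _ => mul_nonneg (hpos n).le (Real.exp_pos _).le) t
  have hFI : ∀ n, ∫ t in Set.Ioi (0 : ℝ), F n t = q n * Real.exp (-(s * n)) := by
    intro n
    rw [setIntegral_indicator measurableSet_Ioi, Set.inter_eq_self_of_subset_right (hsub n),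
      integral_const_mul, integral_exp_neg_Ioi]
  have hsum : Summable fun n => ∫ t in Set.Ioi (0 : ℝ), ‖F n t‖ := by
    simp_rw [Real.norm_of_nonneg (hFnn _ _), hFI]
    exact summable_mul_exp_neg hq hpos hs
  have := (hasSum_integral_of_summable_integral_norm hFint hsum).tsum_eq
  simp_rw [hFI] at this
  rw [this]
  refine integral_congr_ae ?_
  have hnull : ∀ᵐ t ∂(volume.restrict (Set.Ioi (0 : ℝ))), ∀ n : ℕ, t ≠ s * n := by
    refine ae_all_iff.2 fun n => ae_restrict_of_ae ?_
    exact Measure.ae_ne volume _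
  filter_upwards [hnull, ae_restrict_mem measurableSet_Ioi] with t ht ht0
  have hmem : ∀ n : ℕ, t ∈ Set.Ioi (s * n) ↔ n < ⌊s⁻¹ * t⌋₊ + 1 := by
    intro n
    rw [Nat.lt_succ_iff, Nat.le_floor_iff (by have : 0 < t := ht0; positivity),
      inv_mul_eq_div, le_div_iff₀ hs, Set.mem_Ioi, mul_comm (n : ℝ)]
    exact ⟨le_of_lt, fun h => lt_of_le_of_ne h (ht n).symm⟩
  rw [tsum_eq_sum (s := Finset.range (⌊s⁻¹ * t⌋₊ + 1)), Finset.sum_mul]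
  · refine Finset.sum_congr rfl fun n hn => ?_
    exact Set.indicator_of_mem ((hmem n).2 (Finset.mem_range.1 hn)) _
  · intro n hn
    exact Set.indicator_of_notMem (fun h => hn (Finset.mem_range.2 ((hmem n).1 h))) _

/-- The Abelian theorem for a regularly varying monotone sequence. -/
theorem tendsto_tsum_mul_exp_neg_div_sum (hq : Antitone q) (hpos : ∀ n, 0 < q n)
    (hrv : ∀ k : ℕ, 1 ≤ k → Tendsto (fun n => q (k * n) / q n) atTop (𝓝 ((k : ℝ) ^ (-β))))
    (hβ0 : 0 < β) (hβ : β ≤ 1) {k : ℕ} (hk : 1 ≤ k) :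
    Tendsto (fun N : ℕ => (∑' n : ℕ, q n * Real.exp (-((k : ℝ) / N * n))) /
      ∑ k ∈ Finset.range N, q k) atTop (𝓝 ((k : ℝ) ^ (β - 1) * Real.Gamma (2 - β))) := by
  have hk0 : (0 : ℝ) < k := by exact_mod_cast hk
  have hlim : ∫ t in Set.Ioi (0 : ℝ), ((k : ℝ)⁻¹ * t) ^ (1 - β) * Real.exp (-t) =
      (k : ℝ) ^ (β - 1) * Real.Gamma (2 - β) := by
    rw [Real.Gamma_eq_integral (by linarith), ← integral_const_mul]
    refine setIntegral_congr_fun measurableSet_Ioi fun t ht => ?_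
    have ht0 : (0 : ℝ) < t := ht
    rw [Real.mul_rpow (by positivity) ht0.le, Real.inv_rpow hk0.le, ← Real.rpow_neg hk0.le,
      show 2 - β - 1 = 1 - β by ring, neg_sub]
    ring
  rw [← hlim]
  have hev : (fun N : ℕ => ∫ t in Set.Ioi (0 : ℝ),
      (∑ j ∈ Finset.range (⌊(k : ℝ)⁻¹ * t * N⌋₊ + 1), q j) / (∑ j ∈ Finset.range N, q j) *
        Real.exp (-t)) =ᶠ[atTop] fun N : ℕ => (∑' n : ℕ, q n * Real.exp (-((k : ℝ) / N * n))) /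
      ∑ k ∈ Finset.range N, q k := by
    filter_upwards [eventually_gt_atTop 0] with N hN
    have hNr : (0 : ℝ) < N := by exact_mod_cast hN
    rw [tsum_mul_exp_neg_eq_integral hq hpos (by positivity), ← integral_div]
    refine setIntegral_congr_fun measurableSet_Ioi fun t _ => ?_
    rw [show (k : ℝ)⁻¹ * t * N = ((k : ℝ) / N)⁻¹ * t by rw [inv_div]; field_simp]
    ring
  refine Tendsto.congr' hev ?_
  refine tendsto_integral_filter_of_dominated_convergence (fun t => (t + 2) * Real.exp (-t))
    ?_ ?_ ?_ ?_
  · refine .of_forall fun N => Measurable.aestronglyMeasurable ?_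
    refine Measurable.mul (Measurable.div_const ?_ _) (by fun_prop)
    refine (measurable_from_top (f := fun m : ℕ => ∑ j ∈ Finset.range (m + 1), q j)).comp
      (Nat.measurable_floor.comp (by fun_prop))
  · filter_upwards [eventually_gt_atTop 0] with N hN
    filter_upwards [ae_restrict_mem measurableSet_Ioi] with t ht
    have ht0 : (0 : ℝ) < t := ht
    have hp := sum_range_pos_of_pos hpos hN
    have hp2 := sum_range_pos_of_pos hpos (Nat.succ_pos ⌊(k : ℝ)⁻¹ * t * N⌋₊)
    rw [Real.norm_of_nonneg (mul_nonneg (div_nonneg hp2.le hp.le) (Real.exp_pos _).le)]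
    gcongr
    rw [div_le_iff₀ hp]
    have hle : ⌊(k : ℝ)⁻¹ * t * N⌋₊ + 1 ≤ (⌊t⌋₊ + 2) * N := by
      have h1 : ⌊(k : ℝ)⁻¹ * t * N⌋₊ ≤ (⌊t⌋₊ + 1) * N := by
        refine Nat.floor_le_of_le ?_
        push_cast
        gcongr
        calc (k : ℝ)⁻¹ * t ≤ 1 * t := by
              gcongr
              exact inv_le_one_of_one_le₀ (by exact_mod_cast hk)
          _ ≤ _ := by rw [one_mul]; exact (Nat.lt_floor_add_one t).le
      nlinarith
    calc ∑ j ∈ Finset.range (⌊(k : ℝ)⁻¹ * t * N⌋₊ + 1), q j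
        ≤ ∑ j ∈ Finset.range ((⌊t⌋₊ + 2) * N), q j :=
          Finset.sum_le_sum_of_subset_of_nonneg (Finset.range_mono hle) fun k _ _ => (hpos k).le
      _ ≤ ((⌊t⌋₊ + 2 : ℕ) : ℝ) * ∑ j ∈ Finset.range N, q j := sum_range_mul_le_of_antitone hq _ _
      _ ≤ _ := by
        gcongr
        push_cast
        gcongr
        exact Nat.floor_le ht0.le
  · have h1 := Real.GammaIntegral_convergent (s := 2) (by norm_num)
    have h2 := (Real.GammaIntegral_convergent (s := 1) (by norm_num)).const_mul 2
    refine (h1.add h2).congr_fun (fun t ht => ?_) measurableSet_Ioi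
    simp only [Pi.add_apply]
    norm_num
    ring
  · filter_upwards [ae_restrict_mem measurableSet_Ioi] with t ht
    have ht0 : (0 : ℝ) < t := ht
    have ha : 0 < (k : ℝ)⁻¹ * t := by positivity
    have h1 := tendsto_sum_ratio_floor hq hpos hrv hβ0 hβ ha
    have h2 := (tendsto_sum_range_succ_ratio hq hpos).comp (tendsto_floor_mul_atTop ha)
    have h3 := h2.mul h1
    rw [one_mul] at h3
    refine Tendsto.mul_const _ (h3.congr' ?_)
    filter_upwards [(tendsto_floor_mul_atTop ha).eventually (eventually_gt_atTop 0)] with N hN2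
    have := (sum_range_pos_of_pos hpos hN2).ne'
    simp only [Function.comp_apply]
    generalize ⌊(k : ℝ)⁻¹ * t * (N : ℝ)⌋₊ = M at *
    field_simp

end RegularVariation

section Tauberian

/-- The weight `t ↦ e^{-t} t^{β-1}` of the limit measure in Karamata's theorem. -/
noncomputable def gammaWeight (β t : ℝ) : ℝ := Real.exp (-t) * t ^ (β - 1)

theorem integrableOn_gammaWeight {β : ℝ} (hβ : 0 < β) :
    IntegrableOn (gammaWeight β) (Set.Ioi 0) := Real.GammaIntegral_convergent hβ

theorem gammaWeight_nonneg (β : ℝ) {t : ℝ} (ht : 0 < t) : 0 ≤ gammaWeight β t :=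
  mul_nonneg (Real.exp_pos _).le (Real.rpow_nonneg ht.le _)

theorem integrableOn_mul_gammaWeight {β : ℝ} (hβ : 0 < β) {h : ℝ → ℝ} (hh : Continuous h) :
    IntegrableOn (fun t => h (Real.exp (-t)) * gammaWeight β t) (Set.Ioi 0) := by
  obtain ⟨M, hM⟩ := (isCompact_Icc (a := (0 : ℝ)) (b := 1)).exists_bound_of_continuousOn
    hh.continuousOn
  refine Integrable.bdd_mul (c := M) (integrableOn_gammaWeight hβ) ?_ ?_
  · exact (hh.comp (by fun_prop : Continuous fun t : ℝ => Real.exp (-t))).aestronglyMeasurable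
  · filter_upwards [ae_restrict_mem measurableSet_Ioi] with t ht
    have ht0 : (0 : ℝ) < t := ht
    exact hM _ ⟨(Real.exp_pos _).le, by simpa using ht0.le⟩

variable {u : ℕ → ℝ} {c : ℕ → ℝ} {β : ℝ}

theorem exp_neg_div_mem_Icc (N n : ℕ) : Real.exp (-((n : ℝ) / N)) ∈ Set.Icc (0 : ℝ) 1 :=
  ⟨(Real.exp_pos _).le, by simpa using (by positivity : (0 : ℝ) ≤ (n : ℝ) / N)⟩

theorem summable_mul_comp_exp (hu : ∀ n, 0 ≤ u n)
    (hsum : ∀ s : ℝ, 0 < s → Summable fun n : ℕ => u n * Real.exp (-(s * n)))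
    {h : ℝ → ℝ} (hh : Continuous h) {N : ℕ} (hN : 0 < N) :
    Summable fun n : ℕ => u n * Real.exp (-((n : ℝ) / N)) * h (Real.exp (-((n : ℝ) / N))) := by
  obtain ⟨M, hM⟩ := (isCompact_Icc (a := (0 : ℝ)) (b := 1)).exists_bound_of_continuousOn
    hh.continuousOn
  have h1 := (hsum (1 / N) (by positivity)).mul_right M
  refine Summable.of_norm_bounded h1 fun n => ?_
  rw [norm_mul, Real.norm_of_nonneg (mul_nonneg (hu n) (Real.exp_pos _).le), one_div_mul_eq_div]
  exact mul_le_mul_of_nonneg_left (hM _ (exp_neg_div_mem_Icc N n))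
    (mul_nonneg (hu n) (Real.exp_pos _).le)

theorem tendsto_karamata_polynomial (hu : ∀ n, 0 ≤ u n)
    (hsum : ∀ s : ℝ, 0 < s → Summable fun n : ℕ => u n * Real.exp (-(s * n))) (hβ : 0 < β)
    (h : ∀ k : ℕ, 1 ≤ k → Tendsto
      (fun N : ℕ => c N * ∑' n : ℕ, u n * Real.exp (-((k : ℝ) / N * n))) atTop
      (𝓝 ((k : ℝ) ^ (-β)))) (p : Polynomial ℝ) :
    Tendsto (fun N : ℕ => c N * ∑' n : ℕ,
      u n * Real.exp (-((n : ℝ) / N)) * p.eval (Real.exp (-((n : ℝ) / N)))) atTop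
      (𝓝 ((Real.Gamma β)⁻¹ *
        ∫ t in Set.Ioi (0 : ℝ), p.eval (Real.exp (-t)) * gammaWeight β t)) := by
  induction p using Polynomial.induction_on' with
  | add p r hp hr =>
    have hlim : (Real.Gamma β)⁻¹ * (∫ t in Set.Ioi (0 : ℝ),
        (p + r).eval (Real.exp (-t)) * gammaWeight β t) =
        (Real.Gamma β)⁻¹ * (∫ t in Set.Ioi (0 : ℝ), p.eval (Real.exp (-t)) * gammaWeight β t) +
        (Real.Gamma β)⁻¹ * (∫ t in Set.Ioi (0 : ℝ), r.eval (Real.exp (-t)) * gammaWeight β t) := by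
      rw [← mul_add, ← integral_add (integrableOn_mul_gammaWeight hβ p.continuous)
        (integrableOn_mul_gammaWeight hβ r.continuous)]
      simp only [Polynomial.eval_add, add_mul]
    rw [hlim]
    refine (hp.add hr).congr' ?_
    filter_upwards [eventually_gt_atTop 0] with N hN
    rw [← mul_add, ← (summable_mul_comp_exp hu hsum p.continuous hN).tsum_add
      (summable_mul_comp_exp hu hsum r.continuous hN)]
    simp only [Polynomial.eval_add, mul_add]
  | monomial k a =>
    have hlim : (Real.Gamma β)⁻¹ * (∫ t in Set.Ioi (0 : ℝ),
        (Polynomial.monomial k a).eval (Real.exp (-t)) * gammaWeight β t) =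
        a * ((k + 1 : ℕ) : ℝ) ^ (-β) := by
      have h1 := Real.integral_rpow_mul_exp_neg_mul_Ioi hβ
        (show (0 : ℝ) < ((k + 1 : ℕ) : ℝ) by positivity)
      have h2 : ∫ t in Set.Ioi (0 : ℝ), (Polynomial.monomial k a).eval (Real.exp (-t)) *
          gammaWeight β t = a * ∫ t in Set.Ioi (0 : ℝ),
            t ^ (β - 1) * Real.exp (-(((k + 1 : ℕ) : ℝ) * t)) := by
        rw [← integral_const_mul]
        refine setIntegral_congr_fun measurableSet_Ioi fun t _ => ?_
        simp only [Polynomial.eval_monomial, gammaWeight, ← Real.exp_nat_mul]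
        rw [show -(((k + 1 : ℕ) : ℝ) * t) = (k : ℝ) * -t + -t by push_cast; ring, Real.exp_add]
        ring
      rw [h2, h1, one_div, Real.inv_rpow (by positivity), ← Real.rpow_neg (by positivity)]
      have := (Real.Gamma_pos_of_pos hβ).ne'
      field_simp
    rw [hlim]
    refine ((h (k + 1) (by omega)).const_mul a).congr fun N => ?_
    rw [← mul_assoc, mul_comm a, mul_assoc, ← tsum_mul_left]
    congr 1
    refine tsum_congr fun n => ?_
    simp only [Polynomial.eval_monomial, ← Real.exp_nat_mul]
    rw [show -(((k + 1 : ℕ) : ℝ) / N * n) = -((n : ℝ) / N) + (k : ℝ) * -((n : ℝ) / N) by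
      push_cast; ring, Real.exp_add]
    ring

theorem integral_gammaWeight {β : ℝ} (hβ : 0 < β) :
    (Real.Gamma β)⁻¹ * ∫ t in Set.Ioi (0 : ℝ), gammaWeight β t = 1 := by
  have := Real.Gamma_eq_integral hβ
  unfold gammaWeight
  rw [← this, inv_mul_cancel₀ (Real.Gamma_pos_of_pos hβ).ne']

theorem tendsto_karamata_continuous (hu : ∀ n, 0 ≤ u n)
    (hsum : ∀ s : ℝ, 0 < s → Summable fun n : ℕ => u n * Real.exp (-(s * n)))
    (hc : ∀ N, 0 ≤ c N) (hβ : 0 < β)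
    (h : ∀ k : ℕ, 1 ≤ k → Tendsto
      (fun N : ℕ => c N * ∑' n : ℕ, u n * Real.exp (-((k : ℝ) / N * n))) atTop
      (𝓝 ((k : ℝ) ^ (-β)))) {g : ℝ → ℝ} (hg : Continuous g) :
    Tendsto (fun N : ℕ => c N * ∑' n : ℕ,
      u n * Real.exp (-((n : ℝ) / N)) * g (Real.exp (-((n : ℝ) / N)))) atTop
      (𝓝 ((Real.Gamma β)⁻¹ * ∫ t in Set.Ioi (0 : ℝ), g (Real.exp (-t)) * gammaWeight β t)) := by
  have hΓ := Real.Gamma_pos_of_pos hβ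
  have h1 : Tendsto (fun N : ℕ => c N * ∑' n : ℕ, u n * Real.exp (-((n : ℝ) / N))) atTop
      (𝓝 1) := by
    have := h 1 le_rfl
    simpa only [Nat.cast_one, Real.one_rpow, one_div_mul_eq_div] using this
  rw [Metric.tendsto_atTop']
  intro ε hε
  obtain ⟨p, hp⟩ := exists_polynomial_near_of_continuousOn 0 1 g hg.continuousOn (ε / 4)
    (by positivity)
  have hpc := tendsto_karamata_polynomial hu hsum hβ h p
  have hev1 := h1.eventually (gt_mem_nhds (show (1 : ℝ) < 2 by norm_num))
  have hev2 := (Metric.tendsto_nhds.1 hpc) (ε / 4) (by positivity)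
  obtain ⟨N₀, hN₀⟩ := eventually_atTop.1 ((hev1.and hev2).and (eventually_gt_atTop 0))
  refine ⟨N₀, fun N hN => ?_⟩
  obtain ⟨⟨hA, hB⟩, hN0⟩ := hN₀ N hN.le
  rw [Real.dist_eq] at hB ⊢
  have hD1 : |c N * ∑' n : ℕ, u n * Real.exp (-((n : ℝ) / N)) * g (Real.exp (-((n : ℝ) / N))) -
      c N * ∑' n : ℕ, u n * Real.exp (-((n : ℝ) / N)) * p.eval (Real.exp (-((n : ℝ) / N)))| ≤
      ε / 4 * (c N * ∑' n : ℕ, u n * Real.exp (-((n : ℝ) / N))) := by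
    have hs : Summable fun n : ℕ => u n * Real.exp (-((n : ℝ) / N)) := by
      simpa only [one_div_mul_eq_div] using hsum (1 / N) (by positivity)
    rw [← mul_sub, ← (summable_mul_comp_exp hu hsum hg hN0).tsum_sub
      (summable_mul_comp_exp hu hsum p.continuous hN0), abs_mul, abs_of_nonneg (hc N),
      mul_left_comm]
    refine mul_le_mul_of_nonneg_left ?_ (hc N)
    rw [← tsum_mul_left, ← Real.norm_eq_abs]
    refine tsum_of_norm_bounded (hs.mul_left (ε / 4)).hasSum fun n => ?_
    rw [← mul_sub, norm_mul, Real.norm_of_nonneg (mul_nonneg (hu n) (Real.exp_pos _).le),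
      mul_comm (ε / 4)]
    refine mul_le_mul_of_nonneg_left ?_ (mul_nonneg (hu n) (Real.exp_pos _).le)
    rw [Real.norm_eq_abs, abs_sub_comm]
    exact (hp _ (exp_neg_div_mem_Icc N n)).le
  have hD2 : |(Real.Gamma β)⁻¹ * (∫ t in Set.Ioi (0 : ℝ), p.eval (Real.exp (-t)) * gammaWeight β t)
      - (Real.Gamma β)⁻¹ * ∫ t in Set.Ioi (0 : ℝ), g (Real.exp (-t)) * gammaWeight β t| ≤
      ε / 4 := by
    rw [← mul_sub, ← integral_sub (integrableOn_mul_gammaWeight hβ p.continuous)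
      (integrableOn_mul_gammaWeight hβ hg), abs_mul, abs_of_nonneg (inv_nonneg.2 hΓ.le)]
    have : ‖∫ t in Set.Ioi (0 : ℝ), (p.eval (Real.exp (-t)) * gammaWeight β t -
        g (Real.exp (-t)) * gammaWeight β t)‖ ≤ ∫ t in Set.Ioi (0 : ℝ), ε / 4 * gammaWeight β t := by
      refine norm_integral_le_of_norm_le ((integrableOn_gammaWeight hβ).const_mul _) ?_
      filter_upwards [ae_restrict_mem measurableSet_Ioi] with t ht
      have ht0 : (0 : ℝ) < t := ht
      rw [← sub_mul, norm_mul, Real.norm_of_nonneg (gammaWeight_nonneg β ht0)]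
      refine mul_le_mul_of_nonneg_right ?_ (gammaWeight_nonneg β ht0)
      exact (hp _ ⟨(Real.exp_pos _).le, by simpa using ht0.le⟩).le
    rw [integral_const_mul, Real.norm_eq_abs] at this
    calc _ ≤ (Real.Gamma β)⁻¹ * (ε / 4 * ∫ t in Set.Ioi (0 : ℝ), gammaWeight β t) :=
          mul_le_mul_of_nonneg_left this (inv_nonneg.2 hΓ.le)
      _ = ε / 4 * ((Real.Gamma β)⁻¹ * ∫ t in Set.Ioi (0 : ℝ), gammaWeight β t) := by ring
      _ = ε / 4 := by rw [integral_gammaWeight hβ, mul_one]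
  have hD1' := hD1.trans (mul_le_mul_of_nonneg_left hA.le (by positivity : (0 : ℝ) ≤ ε / 4))
  rw [abs_le] at hD1' hD2
  rw [abs_lt] at hB ⊢
  constructor <;> linarith [hD1'.1, hD1'.2, hD2.1, hD2.2, hB.1, hB.2]

/-- A continuous approximation of `x ↦ x⁻¹ 1_{x > e⁻¹}` (from below if `e = 0`, from above if
`e = 1`). -/
noncomputable def cutoff (e : ℝ) (m : ℕ) (x : ℝ) : ℝ :=
  max 0 (min 1 (m * (x - Real.exp (-1)) + e)) / max x (Real.exp (-1) / 2)

theorem cutoff_den_pos (x : ℝ) : 0 < max x (Real.exp (-1) / 2) :=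
  lt_max_of_lt_right (by positivity)

theorem continuous_cutoff (e : ℝ) (m : ℕ) : Continuous (cutoff e m) :=
  Continuous.div (by fun_prop) (by fun_prop) fun x => (cutoff_den_pos x).ne'

theorem cutoff_nonneg (e : ℝ) (m : ℕ) (x : ℝ) : 0 ≤ cutoff e m x :=
  div_nonneg (le_max_left _ _) (cutoff_den_pos x).le

theorem norm_cutoff_le (e : ℝ) (m : ℕ) (x : ℝ) : ‖cutoff e m x‖ ≤ (Real.exp (-1) / 2)⁻¹ := by
  rw [Real.norm_of_nonneg (cutoff_nonneg e m x), ← one_div]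
  exact div_le_div₀ zero_le_one (max_le zero_le_one (min_le_left _ _)) (by positivity)
    (le_max_right _ _)

theorem tendsto_cutoff_of_lt (e : ℝ) {x : ℝ} (hx : Real.exp (-1) < x) :
    Tendsto (fun m => cutoff e m x) atTop (𝓝 x⁻¹) := by
  have h1 : Tendsto (fun m : ℕ => (m : ℝ) * (x - Real.exp (-1)) + e) atTop atTop :=
    tendsto_atTop_add_const_right _ _
      (tendsto_natCast_atTop_atTop.atTop_mul_const (sub_pos.2 hx))
  refine tendsto_const_nhds.congr' ?_
  filter_upwards [h1.eventually (eventually_ge_atTop 1)] with m hm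
  unfold cutoff
  have := Real.exp_pos (-1)
  rw [min_eq_left hm, max_eq_right zero_le_one, max_eq_left (by linarith), one_div]

theorem tendsto_cutoff_of_gt (e : ℝ) {x : ℝ} (hx : x < Real.exp (-1)) :
    Tendsto (fun m => cutoff e m x) atTop (𝓝 0) := by
  have h1 : Tendsto (fun m : ℕ => (m : ℝ) * (x - Real.exp (-1)) + e) atTop atBot :=
    tendsto_atBot_add_const_right _ _
      (tendsto_natCast_atTop_atTop.atTop_mul_const_of_neg (sub_neg.2 hx))
  refine tendsto_const_nhds.congr' ?_
  filter_upwards [h1.eventually (eventually_le_atBot 0)] with m hm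
  unfold cutoff
  rw [max_eq_left ((min_le_right _ _).trans hm), zero_div]

theorem tendsto_integral_cutoff (e : ℝ) (hβ : 0 < β) :
    Tendsto (fun m => (Real.Gamma β)⁻¹ *
      ∫ t in Set.Ioi (0 : ℝ), cutoff e m (Real.exp (-t)) * gammaWeight β t) atTop
      (𝓝 (Real.Gamma (1 + β))⁻¹) := by
  have hlim : (Real.Gamma β)⁻¹ * (∫ t in Set.Ioi (0 : ℝ),
      (Set.Ioo (0 : ℝ) 1).indicator (fun t => t ^ (β - 1)) t) = (Real.Gamma (1 + β))⁻¹ := by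
    rw [setIntegral_indicator measurableSet_Ioo, Set.inter_eq_self_of_subset_right
      Set.Ioo_subset_Ioi_self, ← integral_Ioc_eq_integral_Ioo,
      ← intervalIntegral.integral_of_le zero_le_one, integral_rpow (Or.inl (by linarith)),
      Real.one_rpow, Real.zero_rpow (by linarith), add_comm 1, Real.Gamma_add_one hβ.ne', mul_inv,
      sub_zero, sub_add_cancel, one_div, mul_comm]
  rw [← hlim]
  refine Tendsto.const_mul _ ?_
  refine tendsto_integral_of_dominated_convergence
    (fun t => (Real.exp (-1) / 2)⁻¹ * gammaWeight β t) ?_ ?_ ?_ ?_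
  · exact fun m => (integrableOn_mul_gammaWeight hβ (continuous_cutoff e m)).aestronglyMeasurable
  · exact (integrableOn_gammaWeight hβ).const_mul _
  · intro m
    filter_upwards [ae_restrict_mem measurableSet_Ioi] with t ht
    have ht0 : (0 : ℝ) < t := ht
    rw [norm_mul, Real.norm_of_nonneg (gammaWeight_nonneg β ht0)]
    exact mul_le_mul_of_nonneg_right (norm_cutoff_le e m _) (gammaWeight_nonneg β ht0)
  · filter_upwards [ae_restrict_mem measurableSet_Ioi,
      ae_restrict_of_ae (Measure.ae_ne volume (1 : ℝ))] with t ht ht1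
    have ht0 : (0 : ℝ) < t := ht
    rcases lt_or_gt_of_ne ht1 with h | h
    · rw [Set.indicator_of_mem (show t ∈ Set.Ioo (0 : ℝ) 1 from ⟨ht0, h⟩)]
      have := (tendsto_cutoff_of_lt e (Real.exp_lt_exp.2 (neg_lt_neg h))).mul_const
        (gammaWeight β t)
      rwa [gammaWeight, inv_mul_cancel_left₀ (Real.exp_pos _).ne'] at this
    · rw [Set.indicator_of_notMem (show t ∉ Set.Ioo (0 : ℝ) 1 from fun h' => lt_asymm h h'.2)]
      have := (tendsto_cutoff_of_gt e (Real.exp_lt_exp.2 (neg_lt_neg h))).mul_const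
        (gammaWeight β t)
      rwa [zero_mul] at this

/-- Karamata's Tauberian theorem. -/
theorem tendsto_karamata (hu : ∀ n, 0 ≤ u n)
    (hsum : ∀ s : ℝ, 0 < s → Summable fun n : ℕ => u n * Real.exp (-(s * n)))
    (hc : ∀ N, 0 ≤ c N) (hβ : 0 < β)
    (h : ∀ k : ℕ, 1 ≤ k → Tendsto
      (fun N : ℕ => c N * ∑' n : ℕ, u n * Real.exp (-((k : ℝ) / N * n))) atTop
      (𝓝 ((k : ℝ) ^ (-β)))) :
    Tendsto (fun N : ℕ => c N * ∑ n ∈ Finset.range N, u n) atTop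
      (𝓝 (Real.Gamma (1 + β))⁻¹) := by
  have hx : ∀ {N : ℕ}, 0 < N → ∀ n : ℕ, n < N ↔ Real.exp (-1) < Real.exp (-((n : ℝ) / N)) := by
    intro N hN n
    rw [Real.exp_lt_exp, neg_lt_neg_iff, div_lt_one (by exact_mod_cast hN), Nat.cast_lt]
  refine tendsto_order.2 ⟨fun b hb => ?_, fun b hb => ?_⟩
  · obtain ⟨m, hm⟩ := ((tendsto_integral_cutoff 0 hβ).eventually (lt_mem_nhds hb)).exists
    have := (tendsto_karamata_continuous hu hsum hc hβ h (continuous_cutoff 0 m)).eventually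
      (lt_mem_nhds hm)
    filter_upwards [this, eventually_gt_atTop 0] with N hN hN0
    refine hN.trans_le (mul_le_mul_of_nonneg_left ?_ (hc N))
    rw [tsum_eq_sum (s := Finset.range N)]
    · refine Finset.sum_le_sum fun n hn => ?_
      have hlt := (hx hN0 n).1 (Finset.mem_range.1 hn)
      rw [mul_assoc]
      refine mul_le_of_le_one_right (hu n) ?_
      unfold cutoff
      have := Real.exp_pos (-1)
      rw [max_eq_left (by linarith : Real.exp (-1) / 2 ≤ _),
        mul_div_cancel₀ _ (Real.exp_pos _).ne']
      exact max_le zero_le_one (min_le_left _ _)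
    · intro n hn
      have hle := not_lt.1 (mt (hx hN0 n).2 (fun h => hn (Finset.mem_range.2 h)))
      have : (m : ℝ) * (Real.exp (-((n : ℝ) / N)) - Real.exp (-1)) + 0 ≤ 0 := by
        rw [add_zero]
        exact mul_nonpos_of_nonneg_of_nonpos (by positivity) (sub_nonpos.2 hle)
      rw [cutoff, max_eq_left ((min_le_right _ _).trans this), zero_div, mul_zero]
  · obtain ⟨m, hm⟩ := ((tendsto_integral_cutoff 1 hβ).eventually (gt_mem_nhds hb)).exists
    have := (tendsto_karamata_continuous hu hsum hc hβ h (continuous_cutoff 1 m)).eventually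
      (gt_mem_nhds hm)
    filter_upwards [this, eventually_gt_atTop 0] with N hN hN0
    refine lt_of_le_of_lt (mul_le_mul_of_nonneg_left ?_ (hc N)) hN
    refine le_trans (Finset.sum_le_sum fun n hn => ?_)
      ((summable_mul_comp_exp hu hsum (continuous_cutoff 1 m) hN0).sum_le_tsum (Finset.range N)
        fun n _ => mul_nonneg (mul_nonneg (hu n) (Real.exp_pos _).le) (cutoff_nonneg _ _ _))
    have hlt := (hx hN0 n).1 (Finset.mem_range.1 hn)
    rw [mul_assoc]
    refine le_mul_of_one_le_right (hu n) ?_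
    unfold cutoff
    have := Real.exp_pos (-1)
    rw [max_eq_left (by linarith : Real.exp (-1) / 2 ≤ _), mul_div_cancel₀ _ (Real.exp_pos _).ne']
    refine le_max_of_le_right (le_min le_rfl ?_)
    rw [le_add_iff_nonneg_left]
    exact mul_nonneg (by positivity) (sub_nonneg.2 hlt.le)

end Tauberian

section RealTransfer

variable {X : Type*} [MeasurableSpace X] {μ : Measure X} {f : X → X}

theorem integrable_lp (v : Lp ℝ 1 μ) : Integrable v μ := L1.integrable_coeFn v

/-- The inclusion of real `L¹` in complex `L¹`. -/
noncomputable abbrev ofRealLp (μ : Measure X) : Lp ℝ 1 μ →L[ℝ] Lp ℂ 1 μ :=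
  Complex.ofRealCLM.compLpL 1 μ

theorem coeFn_ofRealLp (v : Lp ℝ 1 μ) : ofRealLp μ v =ᵐ[μ] fun x => ((v x : ℝ) : ℂ) :=
  Complex.ofRealCLM.coeFn_compLpL v

theorem memLp_top_indicator_one {A : Set X} (hA : MeasurableSet A) :
    MemLp (A.indicator fun _ => (1 : ℝ)) ∞ μ := (memLp_top_const 1).indicator hA

theorem integral_mul_indicator_one {A : Set X} (hA : MeasurableSet A) (v : X → ℝ) :
    ∫ x, v x * A.indicator (fun _ => (1 : ℝ)) x ∂μ = ∫ x in A, v x ∂μ := by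
  rw [← integral_indicator hA]
  congr 1
  ext x
  by_cases hx : x ∈ A <;> simp [hx]

theorem ofRealLp_re_add_im (w : Lp ℂ 1 μ) :
    w = ofRealLp μ (Complex.reCLM.compLpL 1 μ w) +
      Complex.I • ofRealLp μ (Complex.imCLM.compLpL 1 μ w) := by
  apply Lp.ext
  filter_upwards [Lp.coeFn_add (ofRealLp μ (Complex.reCLM.compLpL 1 μ w))
      (Complex.I • ofRealLp μ (Complex.imCLM.compLpL 1 μ w)),
    Lp.coeFn_smul Complex.I (ofRealLp μ (Complex.imCLM.compLpL 1 μ w)),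
    coeFn_ofRealLp (Complex.reCLM.compLpL 1 μ w), coeFn_ofRealLp (Complex.imCLM.compLpL 1 μ w),
    Complex.reCLM.coeFn_compLpL (p := 1) w, Complex.imCLM.coeFn_compLpL (p := 1) w]
    with x h1 h2 h3 h4 h5 h6
  rw [h1, Pi.add_apply, h2, Pi.smul_apply, h3, h4, h5, h6, smul_eq_mul, mul_comm]
  exact (Complex.re_add_im _).symm

variable [SigmaFinite μ]

/-- The action of the transfer operator on real-valued functions. -/
noncomputable def realTransfer (hf : MeasurePreserving f μ μ) : Lp ℝ 1 μ →L[ℝ] Lp ℝ 1 μ :=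
  (Complex.reCLM.compLpL 1 μ) ∘L ((transferOperator hf).restrictScalars ℝ) ∘L ofRealLp μ

theorem coeFn_realTransfer (hf : MeasurePreserving f μ μ) (v : Lp ℝ 1 μ) :
    realTransfer hf v =ᵐ[μ] fun x => (transferOperator hf (ofRealLp μ v) x).re :=
  Complex.reCLM.coeFn_compLpL _

theorem integral_transferOperator_ofReal_mul (hf : MeasurePreserving f μ μ) (v : Lp ℝ 1 μ)
    {w : X → ℝ} (hw : MemLp w ∞ μ) :
    ∫ x, transferOperator hf (ofRealLp μ v) x * ((w x : ℝ) : ℂ) ∂μ =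
      ((∫ x, v x * w (f x) ∂μ : ℝ) : ℂ) := by
  have h := integral_transferOperator_mul hf (ofRealLp μ v) (fun x => ((w x : ℝ) : ℂ)) hw.ofReal
  rw [h, ← integral_complex_ofReal]
  refine integral_congr_ae ?_
  filter_upwards [coeFn_ofRealLp v] with x hx
  rw [hx]
  push_cast
  rfl

theorem integrable_transferOperator_mul (hf : MeasurePreserving f μ μ) (v : Lp ℂ 1 μ)
    {w : X → ℝ} (hw : MemLp w ∞ μ) :
    Integrable (fun x => transferOperator hf v x * ((w x : ℝ) : ℂ)) μ :=
  (L1.integrable_coeFn _).mul_of_top_left hw.ofReal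

/-- Duality for the real transfer operator. -/
theorem integral_realTransfer_mul (hf : MeasurePreserving f μ μ) (v : Lp ℝ 1 μ) {w : X → ℝ}
    (hw : MemLp w ∞ μ) :
    ∫ x, realTransfer hf v x * w x ∂μ = ∫ x, v x * w (f x) ∂μ := by
  have h := congrArg Complex.re (integral_transferOperator_ofReal_mul hf v hw)
  rw [Complex.ofReal_re, ← RCLike.re_eq_complex_re,
    ← integral_re (integrable_transferOperator_mul hf _ hw)] at h
  rw [← h]
  refine integral_congr_ae ?_
  filter_upwards [coeFn_realTransfer hf v] with x hx
  rw [hx]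
  simp

theorem setIntegral_realTransfer (hf : MeasurePreserving f μ μ) (v : Lp ℝ 1 μ) {A : Set X}
    (hA : MeasurableSet A) : ∫ x in A, realTransfer hf v x ∂μ = ∫ x in f ⁻¹' A, v x ∂μ := by
  have h := integral_realTransfer_mul hf v (memLp_top_indicator_one hA)
  rw [integral_mul_indicator_one hA] at h
  rw [h, ← integral_mul_indicator_one (hf.measurable hA)]
  rfl

theorem integral_realTransfer (hf : MeasurePreserving f μ μ) (v : Lp ℝ 1 μ) :
    ∫ x, realTransfer hf v x ∂μ = ∫ x, v x ∂μ := by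
  simpa using setIntegral_realTransfer hf v MeasurableSet.univ

theorem transferOperator_ofRealLp (hf : MeasurePreserving f μ μ) (v : Lp ℝ 1 μ) :
    transferOperator hf (ofRealLp μ v) = ofRealLp μ (realTransfer hf v) := by
  have him : ∀ᵐ x ∂μ, (transferOperator hf (ofRealLp μ v) x).im = 0 := by
    have hint : Integrable (fun x => (transferOperator hf (ofRealLp μ v) x).im) μ :=
      (L1.integrable_coeFn (transferOperator hf (ofRealLp μ v))).im
    refine Integrable.ae_eq_zero_of_forall_setIntegral_eq_zero hint fun A hA _ => ?_
    have hw := memLp_top_indicator_one (μ := μ) hA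
    have h := congrArg Complex.im (integral_transferOperator_ofReal_mul hf v hw)
    rw [Complex.ofReal_im, ← RCLike.im_eq_complex_im,
      ← integral_im (integrable_transferOperator_mul hf _ hw)] at h
    rw [← integral_mul_indicator_one hA, ← h]
    congr 1
    ext x
    simp
  apply Lp.ext
  filter_upwards [him, coeFn_ofRealLp (realTransfer hf v), coeFn_realTransfer hf v]
    with x h1 h2 h3
  rw [h2, h3]
  exact Complex.ext rfl (by simpa using h1)

theorem transferOperator_pow (hf : MeasurePreserving f μ μ) (w : Lp ℂ 1 μ) (n : ℕ) :
    (transferOperator hf ^ n) w =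
      ofRealLp μ ((realTransfer hf ^ n) (Complex.reCLM.compLpL 1 μ w)) +
      Complex.I • ofRealLp μ ((realTransfer hf ^ n) (Complex.imCLM.compLpL 1 μ w)) := by
  induction n with
  | zero => simpa using ofRealLp_re_add_im w
  | succ n ih =>
    rw [pow_succ', pow_succ', mul_apply_eq_comp, ih, map_add, map_smul,
      transferOperator_ofRealLp, transferOperator_ofRealLp]
    rfl

theorem realTransfer_nonneg (hf : MeasurePreserving f μ μ) {v : Lp ℝ 1 μ} (hv : 0 ≤ v) :
    0 ≤ realTransfer hf v := by
  rw [← Lp.coeFn_nonneg] at hv ⊢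
  refine ae_nonneg_of_forall_setIntegral_nonneg (integrable_lp _) fun A hA _ => ?_
  rw [setIntegral_realTransfer hf v hA]
  exact integral_nonneg_of_ae (ae_restrict_of_ae hv)

theorem realTransfer_mono (hf : MeasurePreserving f μ μ) {v w : Lp ℝ 1 μ} (h : v ≤ w) :
    realTransfer hf v ≤ realTransfer hf w := by
  rw [← sub_nonneg, ← map_sub]
  exact realTransfer_nonneg hf (sub_nonneg.2 h)

theorem realTransfer_pow_nonneg (hf : MeasurePreserving f μ μ) {v : Lp ℝ 1 μ} (hv : 0 ≤ v)
    (n : ℕ) : 0 ≤ (realTransfer hf ^ n) v := by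
  induction n with
  | zero => simpa
  | succ n ih =>
    rw [pow_succ']
    exact realTransfer_nonneg hf ih

theorem realTransfer_le_const (hf : MeasurePreserving f μ μ) {v : Lp ℝ 1 μ} {K : ℝ}
    (hv : ∀ᵐ x ∂μ, v x ≤ K) : ∀ᵐ x ∂μ, realTransfer hf v x ≤ K := by
  have : 0 ≤ᵐ[μ] fun x => K - realTransfer hf v x := by
    have hint : ∀ (w : Lp ℝ 1 μ) (A : Set X), μ A < ∞ → IntegrableOn (fun x => K - w x) A μ :=
      fun w A hA => (integrableOn_const hA.ne).sub (integrable_lp w).integrableOn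
    have integrable_const' : ∀ A : Set X, μ A < ∞ → Integrable (fun _ => K) (μ.restrict A) :=
      fun A hA => integrableOn_const hA.ne
    refine ae_nonneg_of_forall_setIntegral_nonneg_of_sigmaFinite (fun A _ hA => hint _ A hA)
      fun A hA hAf => ?_
    have hpre := hf.measure_preimage hA.nullMeasurableSet
    have h1 : ∫ x in A, (K - realTransfer hf v x) ∂μ = ∫ x in f ⁻¹' A, (K - v x) ∂μ := by
      rw [integral_sub (integrable_const' A hAf) (integrable_lp _).restrict,
        integral_sub (integrable_const' _ (hpre.trans_lt hAf)) (integrable_lp _).restrict,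
        setIntegral_realTransfer hf v hA]
      simp [Measure.real, hpre]
    rw [h1]
    refine integral_nonneg_of_ae (ae_restrict_of_ae ?_)
    filter_upwards [hv] with x hx
    exact sub_nonneg.2 hx
  filter_upwards [this] with x hx
  exact sub_nonneg.1 hx

theorem realTransfer_pow_le_const (hf : MeasurePreserving f μ μ) {v : Lp ℝ 1 μ} {K : ℝ}
    (hv : ∀ᵐ x ∂μ, v x ≤ K) (n : ℕ) : ∀ᵐ x ∂μ, (realTransfer hf ^ n) v x ≤ K := by
  induction n with
  | zero => simpa
  | succ n ih =>
    rw [pow_succ']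
    exact realTransfer_le_const hf ih

theorem setIntegral_realTransfer_pow (hf : MeasurePreserving f μ μ) (v : Lp ℝ 1 μ) (n : ℕ)
    {A : Set X} (hA : MeasurableSet A) :
    ∫ x in A, (realTransfer hf ^ n) v x ∂μ = ∫ x in f^[n] ⁻¹' A, v x ∂μ := by
  induction n generalizing A with
  | zero => simp
  | succ n ih =>
    rw [pow_succ', mul_apply_eq_comp, setIntegral_realTransfer hf _ hA,
      ih (hf.measurable hA), Function.iterate_succ', Set.preimage_comp]

theorem setLIntegral_realTransfer_pow (hf : MeasurePreserving f μ μ) {v : Lp ℝ 1 μ} (hv : 0 ≤ v)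
    (n : ℕ) {A : Set X} (hA : MeasurableSet A) :
    ∫⁻ x in A, ENNReal.ofReal ((realTransfer hf ^ n) v x) ∂μ =
      ∫⁻ x in f^[n] ⁻¹' A, ENNReal.ofReal (v x) ∂μ := by
  have h1 := ((Lp.coeFn_nonneg _).2 (realTransfer_pow_nonneg hf hv n))
  have h2 := (Lp.coeFn_nonneg _).2 hv
  rw [← ofReal_integral_eq_lintegral_ofReal (integrable_lp _).integrableOn (ae_restrict_of_ae h1),
    ← ofReal_integral_eq_lintegral_ofReal (integrable_lp _).integrableOn (ae_restrict_of_ae h2),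
    setIntegral_realTransfer_pow hf v n hA]

/-- The sums `v + T v + ⋯ + T^{n-1} v`. -/
noncomputable def transferSum (hf : MeasurePreserving f μ μ) (n : ℕ) (v : Lp ℝ 1 μ) : Lp ℝ 1 μ :=
  ∑ j ∈ Finset.range n, (realTransfer hf ^ j) v

theorem transferSum_zero (hf : MeasurePreserving f μ μ) (v : Lp ℝ 1 μ) :
    transferSum hf 0 v = 0 := by simp [transferSum]

theorem transferSum_succ (hf : MeasurePreserving f μ μ) (n : ℕ) (v : Lp ℝ 1 μ) :
    transferSum hf (n + 1) v = transferSum hf n v + (realTransfer hf ^ n) v :=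
  Finset.sum_range_succ _ _

theorem transferSum_succ' (hf : MeasurePreserving f μ μ) (n : ℕ) (v : Lp ℝ 1 μ) :
    transferSum hf (n + 1) v = v + realTransfer hf (transferSum hf n v) := by
  rw [transferSum, Finset.sum_range_succ', transferSum, map_sum, add_comm]
  simp only [pow_succ', pow_zero, mul_apply_eq_comp, one_apply_eq_self]

theorem transferSum_add (hf : MeasurePreserving f μ μ) (n : ℕ) (v w : Lp ℝ 1 μ) :
    transferSum hf n (v + w) = transferSum hf n v + transferSum hf n w := by
  simp [transferSum, Finset.sum_add_distrib]

theorem transferSum_smul (hf : MeasurePreserving f μ μ) (n : ℕ) (c : ℝ) (v : Lp ℝ 1 μ) :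
    transferSum hf n (c • v) = c • transferSum hf n v := by
  simp [transferSum, Finset.smul_sum]

theorem transferSum_sub (hf : MeasurePreserving f μ μ) (n : ℕ) (v w : Lp ℝ 1 μ) :
    transferSum hf n (v - w) = transferSum hf n v - transferSum hf n w := by
  simp [transferSum]

theorem transferSum_nonneg (hf : MeasurePreserving f μ μ) (n : ℕ) {v : Lp ℝ 1 μ} (hv : 0 ≤ v) :
    0 ≤ transferSum hf n v := Finset.sum_nonneg fun j _ => realTransfer_pow_nonneg hf hv j

theorem transferSum_mono (hf : MeasurePreserving f μ μ) (n : ℕ) {v w : Lp ℝ 1 μ} (h : v ≤ w) :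
    transferSum hf n v ≤ transferSum hf n w := by
  rw [← sub_nonneg, ← transferSum_sub]
  exact transferSum_nonneg hf n (sub_nonneg.2 h)

theorem abs_transferSum_le (hf : MeasurePreserving f μ μ) (n : ℕ) (v : Lp ℝ 1 μ) :
    |transferSum hf n v| ≤ transferSum hf n |v| := by
  refine abs_le'.2 ⟨transferSum_mono hf n (le_abs_self v), ?_⟩
  have := transferSum_mono hf n (neg_le_abs v)
  rwa [← zero_sub, transferSum_sub, show transferSum hf n (0 : Lp ℝ 1 μ) = 0 by simp [transferSum],
    zero_sub] at this

theorem coeFn_transferSum (hf : MeasurePreserving f μ μ) (v : Lp ℝ 1 μ) :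
    ∀ᵐ x ∂μ, ∀ n, transferSum hf n v x = ∑ j ∈ Finset.range n, (realTransfer hf ^ j) v x := by
  refine ae_all_iff.2 fun n => ?_
  induction n with
  | zero =>
    filter_upwards [Lp.coeFn_zero ℝ 1 μ] with x hx
    rw [transferSum_zero, hx]
    simp
  | succ n ih =>
    filter_upwards [ih, Lp.coeFn_add (transferSum hf n v) ((realTransfer hf ^ n) v)] with x h1 h2
    rw [transferSum_succ, h2, Pi.add_apply, h1, Finset.sum_range_succ]

end RealTransfer

section Dual

variable {X : Type*} [MeasurableSpace X]

theorem continuous_integral_mul_of_memLp_top {μ : Measure X} {w : X → ℝ} (hw : MemLp w ∞ μ) :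
    Continuous fun v : Lp ℝ 1 μ => ∫ x, v x * w x ∂μ := by
  have h := (((ContinuousLinearMap.mul ℝ ℝ).lpPairing μ 1 ∞).flip (hw.toLp w)).continuous
  convert! h using 2 with v
  rw [ContinuousLinearMap.flip_apply, ContinuousLinearMap.lpPairing_eq_integral]
  refine integral_congr_ae ?_
  filter_upwards [hw.coeFn_toLp] with x hx
  simp [hx]

theorem ae_abs_le_of_forall_abs_setIntegral_le {p : Measure X} [IsFiniteMeasure p] {w : X → ℝ}
    (hw : Integrable w p) {K : ℝ}
    (h : ∀ A, MeasurableSet A → |∫ x in A, w x ∂p| ≤ K * p.real A) :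
    ∀ᵐ x ∂p, |w x| ≤ K := by
  have h1 : w ≤ᵐ[p] fun _ => K :=
    ae_le_of_forall_setIntegral_le hw (integrable_const K) fun A hA _ => by
      rw [setIntegral_const, smul_eq_mul, mul_comm]
      exact (abs_le.1 (h A hA)).2
  have h2 : (fun _ => -K) ≤ᵐ[p] w :=
    ae_le_of_forall_setIntegral_le (integrable_const _) hw fun A hA _ => by
      rw [setIntegral_const, smul_eq_mul, mul_comm]
      linarith [(abs_le.1 (h A hA)).1]
  filter_upwards [h1, h2] with x a b
  exact abs_le.2 ⟨b, a⟩

theorem indicatorConstLp_eq_smul_one {p : Measure X} {A : Set X} (hA : MeasurableSet A)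
    (hpA : p A ≠ ∞) (c : ℝ) :
    indicatorConstLp 1 hA hpA c = c • indicatorConstLp 1 hA hpA (1 : ℝ) := by
  apply Lp.ext
  filter_upwards [Lp.coeFn_smul c (indicatorConstLp 1 hA hpA (1 : ℝ)),
    indicatorConstLp_coeFn (p := 1) (hs := hA) (hμs := hpA) (c := (1 : ℝ)),
    indicatorConstLp_coeFn (p := 1) (hs := hA) (hμs := hpA) (c := c)] with x h1 h2 h3
  rw [h1, Pi.smul_apply, h2, h3]
  by_cases hx : x ∈ A <;> simp [hx]

/-- On a finite measure space, continuous functionals on `L¹` are represented by bounded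
functions. -/
theorem exists_repr_strongDual_of_isFiniteMeasure {p : Measure X} [IsFiniteMeasure p]
    (Λ : Lp ℝ 1 p →L[ℝ] ℝ) :
    ∃ w : X → ℝ, StronglyMeasurable w ∧ (∀ x, |w x| ≤ ‖Λ‖) ∧ ∀ v, Λ v = ∫ x, v x * w x ∂p := by
  have hone : MemLp (fun _ : X => (1 : ℝ)) 2 p := memLp_const 1
  set J : Lp ℝ 2 p →L[ℝ] Lp ℝ 1 p := ((ContinuousLinearMap.mul ℝ ℝ).holderL p 2 2 1).flip
    (hone.toLp _) with hJ
  have hJcoe : ∀ v : Lp ℝ 2 p, J v =ᵐ[p] v := by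
    intro v
    filter_upwards [(ContinuousLinearMap.mul ℝ ℝ).coeFn_holder (r := 1) v (hone.toLp _),
      hone.coeFn_toLp] with x h1 h2
    have h1' : J v x = ContinuousLinearMap.mul ℝ ℝ (v x) (hone.toLp _ x) := h1
    rw [h1', h2]
    simp
  set w₀ : Lp ℝ 2 p := (InnerProductSpace.toDual ℝ (Lp ℝ 2 p)).symm (Λ ∘L J) with hw₀
  have hind : ∀ A (hA : MeasurableSet A),
      Λ (indicatorConstLp 1 hA (measure_ne_top p A) (1 : ℝ)) = ∫ x in A, w₀ x ∂p := by
    intro A hA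
    rw [← L2.inner_indicatorConstLp_one (𝕜 := ℝ) hA (measure_ne_top p A), real_inner_comm, hw₀,
      InnerProductSpace.toDual_symm_apply, ContinuousLinearMap.comp_apply]
    congr 1
    apply Lp.ext
    filter_upwards [hJcoe (indicatorConstLp 2 hA (measure_ne_top p A) (1 : ℝ)),
      indicatorConstLp_coeFn (p := 1) (hs := hA) (hμs := measure_ne_top p A) (c := (1 : ℝ)),
      indicatorConstLp_coeFn (p := 2) (hs := hA) (hμs := measure_ne_top p A) (c := (1 : ℝ))]
      with x h1 h2 h3
    rw [h1, h2, h3]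
  have hint : Integrable w₀ p := (Lp.memLp w₀).integrable (by norm_num)
  have hbd : ∀ᵐ x ∂p, |w₀ x| ≤ ‖Λ‖ := by
    refine ae_abs_le_of_forall_abs_setIntegral_le hint fun A hA => ?_
    rw [← hind A hA, ← Real.norm_eq_abs]
    refine (Λ.le_opNorm _).trans (mul_le_mul_of_nonneg_left ?_ (norm_nonneg _))
    rw [norm_indicatorConstLp one_ne_zero ENNReal.one_ne_top]
    simp
  let w : X → ℝ := fun x => max (-‖Λ‖) (min ‖Λ‖ (w₀ x))
  have hwm : StronglyMeasurable w :=
    stronglyMeasurable_const.sup (stronglyMeasurable_const.inf (Lp.stronglyMeasurable w₀))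
  have hwb : ∀ x, |w x| ≤ ‖Λ‖ := fun x => abs_le.2
    ⟨le_max_left _ _, max_le (by linarith [norm_nonneg Λ]) (min_le_left _ _)⟩
  have hww : w =ᵐ[p] w₀ := by
    filter_upwards [hbd] with x hx
    rw [abs_le] at hx
    simp only [w]
    rw [min_eq_right hx.2, max_eq_right hx.1]
  have hwtop : MemLp w ∞ p := memLp_top_of_bound hwm.aestronglyMeasurable ‖Λ‖ (.of_forall hwb)
  refine ⟨w, hwm, hwb, fun v => ?_⟩
  induction v using Lp.induction ENNReal.one_ne_top with
  | indicatorConst c hs hμs =>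
    rename_i s
    have e : ((Lp.simpleFunc.indicatorConst 1 hs hμs.ne c : Lp.simpleFunc ℝ 1 p) : Lp ℝ 1 p) =
        c • indicatorConstLp 1 hs hμs.ne (1 : ℝ) := by
      exact indicatorConstLp_eq_smul_one hs hμs.ne c
    rw [e, map_smul, hind s hs, smul_eq_mul, ← integral_indicator hs, ← integral_const_mul]
    refine integral_congr_ae ?_
    filter_upwards [Lp.coeFn_smul c (indicatorConstLp 1 hs hμs.ne (1 : ℝ)),
      indicatorConstLp_coeFn (p := 1) (hs := hs) (hμs := hμs.ne) (c := (1 : ℝ)), hww]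
      with x h1 h2 h3
    rw [h1, Pi.smul_apply, h2, h3]
    by_cases hx : x ∈ s <;> simp [hx]
  | add hf hg _ h1 h2 =>
    have hi : ∀ v : Lp ℝ 1 p, Integrable (fun x => v x * w x) p := fun v =>
      (integrable_lp v).mul_of_top_left hwtop
    rw [map_add, h1, h2, ← integral_add (hi _) (hi _)]
    refine integral_congr_ae ?_
    filter_upwards [Lp.coeFn_add (hf.toLp _) (hg.toLp _)] with x h
    rw [h, Pi.add_apply, add_mul]
  | isClosed => exact isClosed_eq Λ.continuous (continuous_integral_mul_of_memLp_top hwtop)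

/-- Continuous functionals on `L¹` of a `σ`-finite measure are represented by bounded functions. -/
theorem exists_repr_strongDual {μ : Measure X} [SigmaFinite μ] (Λ : Lp ℝ 1 μ →L[ℝ] ℝ) :
    ∃ w : X → ℝ, StronglyMeasurable w ∧ MemLp w ∞ μ ∧ ∀ v, Λ v = ∫ x, v x * w x ∂μ := by
  obtain ⟨g, hg0, hgm, hg1⟩ := exists_pos_lintegral_lt_of_sigmaFinite μ one_ne_zero
  have hfin : IsFiniteMeasure (μ.withDensity fun x => g x) :=
    ⟨by rw [withDensity_apply _ .univ, Measure.restrict_univ]; exact hg1.trans ENNReal.one_lt_top⟩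
  obtain ⟨w, hwm, hwb, hw⟩ := exists_repr_strongDual_of_isFiniteMeasure
    (Λ ∘L (withDensitySMulLI μ (E := ℝ) hgm).toContinuousLinearMap)
  refine ⟨w, hwm, memLp_top_of_bound hwm.aestronglyMeasurable _ (.of_forall hwb), fun v => ?_⟩
  have hgv : ∀ x, g x • ((g x : ℝ)⁻¹ * v x) = v x := fun x => by
    have : (g x : ℝ) ≠ 0 := by exact_mod_cast (hg0 x).ne'
    rw [NNReal.smul_def, smul_eq_mul, mul_inv_cancel_left₀ this]
  have hint : Integrable (fun x => (g x : ℝ)⁻¹ * v x) (μ.withDensity fun x => g x) := by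
    rw [integrable_withDensity_iff_integrable_smul hgm]
    simp_rw [hgv]
    exact integrable_lp v
  have hmem := memLp_one_iff_integrable.2 hint
  have e : withDensitySMulLI μ (E := ℝ) hgm (hmem.toLp _) = v := by
    rw [withDensitySMulLI_apply]
    apply Lp.ext
    have h1 := (ae_withDensity_iff hgm.coe_nnreal_ennreal).1 hmem.coeFn_toLp
    refine (MemLp.coeFn_toLp _).trans ?_
    filter_upwards [h1] with x hx
    rw [hx (by simpa using (hg0 x).ne'), hgv]
  have := hw (hmem.toLp _)
  rw [ContinuousLinearMap.comp_apply, LinearIsometry.coe_toContinuousLinearMap, e] at this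
  rw [this]
  have h2 : ∫ x, (hmem.toLp _ : X → ℝ) x * w x ∂(μ.withDensity fun x => g x) =
      ∫ x, ((g x : ℝ)⁻¹ * v x) * w x ∂(μ.withDensity fun x => g x) := by
    refine integral_congr_ae ?_
    filter_upwards [hmem.coeFn_toLp] with x hx
    rw [hx]
  rw [h2, integral_withDensity_eq_integral_smul hgm]
  congr 1
  ext x
  rw [← smul_mul_assoc, hgv]

end Dual

section Recurrence

variable {X : Type*} [MeasurableSpace X] {μ : Measure X} {f : X → X}

/-- Almost every orbit of a conservative ergodic map visits every set of positive measure infinitely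
often. -/
theorem ae_frequently_iterate_mem (hcons : Conservative f μ) (herg : Ergodic f μ) {A : Set X}
    (hA : MeasurableSet A) (hA0 : μ A ≠ 0) : ∀ᵐ x ∂μ, ∃ᶠ n in atTop, f^[n] x ∈ A := by
  set S : Set X := {x | ∃ᶠ n in atTop, f^[n] x ∈ A} with hS
  have hSm : MeasurableSet S := by
    have : S = limsup (fun n => f^[n] ⁻¹' A) atTop := by
      ext x
      simp [hS, mem_limsup_iff_frequently_mem]
    rw [this]
    exact .measurableSet_limsup fun n => (herg.measurable.iterate n) hA
  have hinv : f ⁻¹' S = S := by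
    ext x
    simp only [hS, Set.mem_preimage, Set.mem_ofPred_eq, ← Function.iterate_succ_apply]
    conv_rhs => rw [← map_add_atTop_eq_nat 1, frequently_map]
  rcases herg.ae_mem_or_ae_notMem hSm hinv with h | h
  · exact h
  · refine absurd ?_ hA0
    refine measure_mono_null (fun x hx => ?_)
      (measure_union_null h (hcons.ae_mem_imp_frequently_image_mem hA.nullMeasurableSet))
    by_cases hxS : x ∈ S
    · exact Or.inl (by simpa using hxS)
    · exact Or.inr fun h' => hxS (h' hx)

theorem tsum_measure_preimage_iterate_eq_top (hcons : Conservative f μ) (herg : Ergodic f μ)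
    {ν : Measure X} (hν : ν ≪ μ) (hν0 : ν ≠ 0) {A : Set X} (hA : MeasurableSet A)
    (hA0 : μ A ≠ 0) : ∑' n, ν (f^[n] ⁻¹' A) = ∞ := by
  have hm : ∀ n, MeasurableSet (f^[n] ⁻¹' A) := fun n => (herg.measurable.iterate n) hA
  have h1 : ∑' n, ν (f^[n] ⁻¹' A) =
      ∫⁻ x, ∑' n, (f^[n] ⁻¹' A).indicator (fun _ => (1 : ℝ≥0∞)) x ∂ν := by
    rw [lintegral_tsum fun n => (measurable_const.indicator (hm n)).aemeasurable]
    congr 1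
    ext n
    exact (lintegral_indicator_one (hm n)).symm
  have h2 : ∀ᵐ x ∂ν, ∑' n, (f^[n] ⁻¹' A).indicator (fun _ => (1 : ℝ≥0∞)) x = ∞ := by
    refine hν.ae_le ?_
    filter_upwards [ae_frequently_iterate_mem hcons herg hA hA0] with x hx
    by_contra hne
    have h3 := (ENNReal.tendsto_atTop_zero_of_tsum_ne_top hne).eventually
      (gt_mem_nhds zero_lt_one)
    obtain ⟨n, hn, hn'⟩ := (hx.and_eventually h3).exists
    rw [Set.indicator_of_mem (show x ∈ f^[n] ⁻¹' A from hn)] at hn'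
    exact lt_irrefl _ hn'
  rw [h1, lintegral_congr_ae h2, lintegral_const, ENNReal.top_mul]
  simpa using hν0

theorem exists_measurableSet_subset_finite_pos [SigmaFinite μ] {S : Set X} (hS : MeasurableSet S)
    (hS0 : μ S ≠ 0) : ∃ A ⊆ S, MeasurableSet A ∧ μ A ≠ 0 ∧ μ A < ∞ := by
  obtain ⟨A, hA, hAS, h0, h1⟩ := Measure.exists_subset_measure_lt_top hS (pos_iff_ne_zero.2 hS0)
  exact ⟨A, hAS, hA, h0.ne', h1⟩

/-- The sums `u + T u + ⋯` diverge for a nontrivial nonnegative `u`. -/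
theorem ae_tendsto_transferSum_atTop [SigmaFinite μ] (hf : MeasurePreserving f μ μ)
    (hcons : Conservative f μ) (herg : Ergodic f μ) {u : Lp ℝ 1 μ} (hu : 0 ≤ u) (hu0 : u ≠ 0) :
    ∀ᵐ x ∂μ, Tendsto (fun n => transferSum hf n u x) atTop atTop := by
  set h : X → ℝ≥0∞ := fun x => ∑' n, ENNReal.ofReal ((realTransfer hf ^ n) u x) with hh
  have hterm : ∀ n, Measurable fun x => ENNReal.ofReal ((realTransfer hf ^ n) u x) := fun n =>
    (Lp.stronglyMeasurable _).measurable.ennreal_ofReal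
  have hhm : Measurable h := Measurable.tsum hterm
  have hν0 : μ.withDensity (fun x => ENNReal.ofReal (u x)) ≠ 0 := by
    intro h0
    rw [withDensity_eq_zero_iff (Lp.stronglyMeasurable u).measurable.ennreal_ofReal.aemeasurable]
      at h0
    refine hu0 (le_antisymm ?_ hu)
    rw [← Lp.coeFn_le]
    filter_upwards [h0, Lp.coeFn_zero ℝ 1 μ] with x hx hx0
    rw [hx0]
    simpa using hx
  have hinf : ∀ᵐ x ∂μ, h x = ∞ := by
    have hM : ∀ M : ℕ, μ {x | h x ≤ M} = 0 := by
      intro M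
      by_contra hne
      obtain ⟨A, hAS, hA, hA0, hAf⟩ := exists_measurableSet_subset_finite_pos
        (measurableSet_le hhm measurable_const) hne
      have h1 : ∫⁻ x in A, h x ∂μ = ∞ := by
        rw [lintegral_tsum fun n => (hterm n).aemeasurable]
        simp_rw [setLIntegral_realTransfer_pow hf hu _ hA]
        rw [← tsum_measure_preimage_iterate_eq_top hcons herg
          (withDensity_absolutelyContinuous μ fun x => ENNReal.ofReal (u x)) hν0 hA hA0]
        congr 1
        ext n
        rw [withDensity_apply _ ((herg.measurable.iterate n) hA)]
      have h2 : ∫⁻ x in A, h x ∂μ ≤ ∫⁻ _ in A, (M : ℝ≥0∞) ∂μ :=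
        setLIntegral_mono measurable_const fun x hx => hAS hx
      rw [h1, setLIntegral_const, top_le_iff] at h2
      exact (ENNReal.mul_lt_top (ENNReal.natCast_lt_top M) hAf).ne h2
    have : ∀ᵐ x ∂μ, ∀ M : ℕ, ¬ h x ≤ M := by
      refine ae_all_iff.2 fun M => ?_
      rw [ae_iff]
      simpa using hM M
    filter_upwards [this] with x hx
    by_contra hne
    obtain ⟨M, hM⟩ := ENNReal.exists_nat_gt hne
    exact hx M hM.le
  have hnn : ∀ᵐ x ∂μ, ∀ n, 0 ≤ (realTransfer hf ^ n) u x := ae_all_iff.2 fun n =>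
    (Lp.coeFn_nonneg _).2 (realTransfer_pow_nonneg hf hu n)
  filter_upwards [hinf, hnn, coeFn_transferSum hf u] with x hx hxn hxS
  simp_rw [hxS]
  rw [← not_summable_iff_tendsto_nat_atTop_of_nonneg hxn]
  intro hs
  have := hs.tsum_ofReal_ne_top
  exact this hx

end Recurrence

section Hopf

variable {X : Type*} [MeasurableSpace X] {μ : Measure X} {f : X → X} [SigmaFinite μ]

/-- A dominant of the maximal function of the sums of `v`. -/
noncomputable def hopfMax (hf : MeasurePreserving f μ μ) (v : Lp ℝ 1 μ) : ℕ → Lp ℝ 1 μ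
  | 0 => 0
  | n + 1 => 0 ⊔ (v + realTransfer hf (hopfMax hf v n))

theorem hopfMax_nonneg (hf : MeasurePreserving f μ μ) (v : Lp ℝ 1 μ) (n : ℕ) :
    0 ≤ hopfMax hf v n := by
  cases n with
  | zero => exact le_rfl
  | succ n => exact le_sup_left

theorem hopfMax_le_succ (hf : MeasurePreserving f μ μ) (v : Lp ℝ 1 μ) (n : ℕ) :
    hopfMax hf v n ≤ hopfMax hf v (n + 1) := by
  induction n with
  | zero => exact hopfMax_nonneg hf v 1
  | succ n ih =>
    exact sup_le_sup_left (add_le_add_right (realTransfer_mono hf ih) v) 0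

theorem transferSum_le_hopfMax (hf : MeasurePreserving f μ μ) (v : Lp ℝ 1 μ) (n : ℕ) :
    transferSum hf n v ≤ hopfMax hf v n := by
  induction n with
  | zero => rw [transferSum_zero]; exact le_rfl
  | succ n ih =>
    rw [transferSum_succ']
    exact le_sup_of_le_right (add_le_add_right (realTransfer_mono hf ih) v)

/-- Hopf's maximal ergodic lemma. -/
theorem setIntegral_hopfMax_pos_nonneg (hf : MeasurePreserving f μ μ) (v : Lp ℝ 1 μ) (n : ℕ) :
    0 ≤ ∫ x in {x | 0 < hopfMax hf v n x}, v x ∂μ := by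
  set M := hopfMax hf v n with hM
  set A : Set X := {x | 0 < M x} with hAdef
  have hA : MeasurableSet A := measurableSet_lt measurable_const (Lp.stronglyMeasurable M).measurable
  have hM0 : ∀ᵐ x ∂μ, 0 ≤ M x := (Lp.coeFn_nonneg _).2 (hopfMax_nonneg hf v n)
  have hTM0 : ∀ᵐ x ∂μ, 0 ≤ realTransfer hf M x :=
    (Lp.coeFn_nonneg _).2 (realTransfer_nonneg hf (hopfMax_nonneg hf v n))
  have hle : ∀ᵐ x ∂μ, x ∈ A → M x ≤ v x + realTransfer hf M x := by
    cases n with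
    | zero =>
      filter_upwards [Lp.coeFn_zero ℝ 1 μ] with x hx hxA
      have : M x = 0 := hx
      simp [hAdef, this] at hxA
    | succ n =>
      filter_upwards [Lp.coeFn_sup 0 (v + realTransfer hf (hopfMax hf v n)), Lp.coeFn_zero ℝ 1 μ,
        Lp.coeFn_add v (realTransfer hf (hopfMax hf v n)),
        (Lp.coeFn_le _ _).2 (realTransfer_mono hf (hopfMax_le_succ hf v n))] with x h1 h2 h3 h4 hxA
      have h5 : M x = max 0 (v x + realTransfer hf (hopfMax hf v n) x) := by
        rw [hM, hopfMax, h1, Pi.sup_apply, h2, h3]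
        rfl
      have hpos : 0 < M x := hxA
      rw [h5] at hpos ⊢
      rw [max_eq_right (by_contra fun h => by
        rw [max_eq_left (not_le.1 h).le] at hpos
        exact lt_irrefl _ hpos)]
      exact add_le_add_right h4 _
  have e1 : ∫ x in A, M x ∂μ = ∫ x, M x ∂μ := by
    refine setIntegral_eq_integral_of_ae_compl_eq_zero ?_
    filter_upwards [hM0] with x hx hxA
    exact le_antisymm (not_lt.1 hxA) hx
  have e2 : ∫ x in A, realTransfer hf M x ∂μ ≤ ∫ x, M x ∂μ := by
    rw [← integral_realTransfer hf M]
    exact setIntegral_le_integral (integrable_lp _) hTM0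
  have e3 : ∫ x in A, (M x - realTransfer hf M x) ∂μ ≤ ∫ x in A, v x ∂μ := by
    refine setIntegral_mono_ae_restrict ((integrable_lp _).sub (integrable_lp _)).integrableOn
      (integrable_lp v).integrableOn ?_
    rw [EventuallyLE, ae_restrict_iff' hA]
    filter_upwards [hle] with x hx hxA
    linarith [hx hxA]
  rw [integral_sub (integrable_lp _).restrict (integrable_lp _).restrict] at e3
  linarith

theorem weak_type_range (hf : MeasurePreserving f μ μ) {v u : Lp ℝ 1 μ} (hv : 0 ≤ v)
    (hu : 0 ≤ u) {t : ℝ} (ht : 0 ≤ t) (n : ℕ) :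
    t * ∫ x in {x | ∃ k ≤ n, t * transferSum hf k u x < transferSum hf k v x}, u x ∂μ ≤
      ∫ x, v x ∂μ := by
  set A : Set X := {x | 0 < hopfMax hf (v - t • u) n x} with hAdef
  have hA : MeasurableSet A := measurableSet_lt measurable_const (Lp.stronglyMeasurable _).measurable
  have hu0 : ∀ᵐ x ∂μ, 0 ≤ u x := (Lp.coeFn_nonneg _).2 hu
  have hv0 : ∀ᵐ x ∂μ, 0 ≤ v x := (Lp.coeFn_nonneg _).2 hv
  have hmono : ∀ k ≤ n, transferSum hf k (v - t • u) ≤ hopfMax hf (v - t • u) n := fun k hk =>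
    (transferSum_le_hopfMax hf _ k).trans (monotone_nat_of_le_succ (hopfMax_le_succ hf _) hk)
  have hsub : {x | ∃ k ≤ n, t * transferSum hf k u x < transferSum hf k v x} ≤ᵐ[μ] A := by
    have h1 : ∀ᵐ x ∂μ, ∀ k, k ≤ n → transferSum hf k v x - t * transferSum hf k u x ≤
        hopfMax hf (v - t • u) n x := by
      refine ae_all_iff.2 fun k => ?_
      by_cases hk : k ≤ n
      · filter_upwards [(Lp.coeFn_le _ _).2 (hmono k hk),
          Lp.coeFn_sub (transferSum hf k v) (t • transferSum hf k u),
          Lp.coeFn_smul t (transferSum hf k u)] with x h1 h2 h3 _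
        rw [transferSum_sub, transferSum_smul, h2, Pi.sub_apply, h3] at h1
        exact h1
      · exact .of_forall fun x h => absurd h hk
    filter_upwards [h1] with x hx
    rintro ⟨k, hk, hlt⟩
    exact lt_of_lt_of_le (sub_pos.2 hlt) (hx k hk)
  have h2 := setIntegral_hopfMax_pos_nonneg hf (v - t • u) n
  have h3 : ∫ x in A, (v - t • u : Lp ℝ 1 μ) x ∂μ = ∫ x in A, v x ∂μ - t * ∫ x in A, u x ∂μ := by
    rw [← integral_const_mul, ← integral_sub (integrable_lp _).restrict
      ((integrable_lp _).restrict.const_mul t)]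
    refine integral_congr_ae (ae_restrict_of_ae ?_)
    filter_upwards [Lp.coeFn_sub v (t • u), Lp.coeFn_smul t u] with x h1 h2
    rw [h1, Pi.sub_apply, h2]
    rfl
  rw [h3] at h2
  calc _ ≤ t * ∫ x in A, u x ∂μ := by
        refine mul_le_mul_of_nonneg_left ?_ ht
        exact setIntegral_mono_set (integrable_lp u).integrableOn (ae_restrict_of_ae hu0) hsub
    _ ≤ ∫ x in A, v x ∂μ := by linarith
    _ ≤ _ := setIntegral_le_integral (integrable_lp v) hv0

/-- The weak type maximal inequality for the ratios of the sums. -/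
theorem weak_type_ratio (hf : MeasurePreserving f μ μ) {v u : Lp ℝ 1 μ} (hv : 0 ≤ v)
    (hu : 0 ≤ u) {t : ℝ} (ht : 0 < t) :
    μ.withDensity (fun x => ENNReal.ofReal (u x))
      {x | ∃ k, t * transferSum hf k u x < transferSum hf k v x} ≤ ENNReal.ofReal (‖v‖ / t) := by
  have hu0 : ∀ᵐ x ∂μ, 0 ≤ u x := (Lp.coeFn_nonneg _).2 hu
  have hv0 : ∀ᵐ x ∂μ, 0 ≤ v x := (Lp.coeFn_nonneg _).2 hv
  have hnorm : ∫ x, v x ∂μ = ‖v‖ := by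
    rw [L1.norm_eq_integral_norm]
    refine integral_congr_ae ?_
    filter_upwards [hv0] with x hx
    rw [Real.norm_of_nonneg hx]
  have hE : {x | ∃ k, t * transferSum hf k u x < transferSum hf k v x} =
      ⋃ n, {x | ∃ k ≤ n, t * transferSum hf k u x < transferSum hf k v x} := by
    ext x
    simp only [Set.mem_ofPred_eq, Set.mem_iUnion]
    exact ⟨fun ⟨k, hk⟩ => ⟨k, k, le_rfl, hk⟩, fun ⟨_, k, _, hk⟩ => ⟨k, hk⟩⟩
  have hmon : Monotone fun n : ℕ =>
      {x | ∃ k ≤ n, t * transferSum hf k u x < transferSum hf k v x} :=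
    fun a b hab x ⟨k, hk, h⟩ => ⟨k, hk.trans hab, h⟩
  rw [hE, hmon.measure_iUnion]
  refine iSup_le fun n => ?_
  have hm : MeasurableSet {x | ∃ k ≤ n, t * transferSum hf k u x < transferSum hf k v x} := by
    have : {x | ∃ k ≤ n, t * transferSum hf k u x < transferSum hf k v x} =
        ⋃ k, ⋃ _ : k ≤ n, {x | t * transferSum hf k u x < transferSum hf k v x} := by
      ext x
      simp
    rw [this]
    exact .iUnion fun k => .iUnion fun _ => measurableSet_lt
      ((Lp.stronglyMeasurable _).measurable.const_mul t) (Lp.stronglyMeasurable _).measurable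
  rw [withDensity_apply _ hm, ← ofReal_integral_eq_lintegral_ofReal (integrable_lp u).integrableOn
    (ae_restrict_of_ae hu0)]
  refine ENNReal.ofReal_le_ofReal ?_
  rw [le_div_iff₀ ht, ← hnorm, mul_comm]
  exact weak_type_range hf hv hu ht.le n

end Hopf

section Hurewicz

variable {X : Type*} [MeasurableSpace X] {μ : Measure X} {f : X → X}

theorem integral_lp_add (v w : Lp ℝ 1 μ) :
    ∫ x, (v + w) x ∂μ = ∫ x, v x ∂μ + ∫ x, w x ∂μ := by
  rw [← integral_add (integrable_lp v) (integrable_lp w)]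
  exact integral_congr_ae (Lp.coeFn_add v w)

theorem integral_lp_sub (v w : Lp ℝ 1 μ) :
    ∫ x, (v - w) x ∂μ = ∫ x, v x ∂μ - ∫ x, w x ∂μ := by
  rw [← integral_sub (integrable_lp v) (integrable_lp w)]
  exact integral_congr_ae (Lp.coeFn_sub v w)

theorem integral_lp_smul (c : ℝ) (v : Lp ℝ 1 μ) : ∫ x, (c • v) x ∂μ = c * ∫ x, v x ∂μ := by
  rw [← integral_const_mul]
  exact integral_congr_ae (Lp.coeFn_smul c v)

theorem abs_integral_lp_le (v : Lp ℝ 1 μ) : |∫ x, v x ∂μ| ≤ ‖v‖ := by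
  rw [L1.norm_eq_integral_norm, ← Real.norm_eq_abs]
  exact norm_integral_le_integral_norm v

/-- A strictly positive function to which the sums are compared. -/
structure IsReference (u : Lp ℝ 1 μ) : Prop where
  pos : ∀ᵐ x ∂μ, 0 < u x
  integral_pos : 0 < ∫ x, u x ∂μ

theorem IsReference.nonneg {u : Lp ℝ 1 μ} (hu : IsReference u) : 0 ≤ u := by
  rw [← Lp.coeFn_nonneg]
  filter_upwards [hu.pos] with x hx
  exact hx.le

theorem IsReference.ne_zero {u : Lp ℝ 1 μ} (hu : IsReference u) : u ≠ 0 := by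
  rintro rfl
  have := hu.integral_pos
  rw [integral_congr_ae (Lp.coeFn_zero ℝ 1 μ)] at this
  simp at this

variable [SigmaFinite μ]

/-- The functions `v` for which the ratios `S_n v / S_n u` converge to `∫ v / ∫ u`. -/
def RatioConverges (hf : MeasurePreserving f μ μ) (u v : Lp ℝ 1 μ) : Prop :=
  ∀ᵐ x ∂μ, Tendsto (fun n => transferSum hf n v x / transferSum hf n u x) atTop
    (𝓝 ((∫ x, v x ∂μ) / ∫ x, u x ∂μ))

theorem RatioConverges.add {hf : MeasurePreserving f μ μ} {u v w : Lp ℝ 1 μ}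
    (hv : RatioConverges hf u v) (hw : RatioConverges hf u w) : RatioConverges hf u (v + w) := by
  have h : ∀ᵐ x ∂μ, ∀ n, transferSum hf n (v + w) x = transferSum hf n v x + transferSum hf n w x :=
    ae_all_iff.2 fun n => by
      rw [transferSum_add]
      exact Lp.coeFn_add _ _
  filter_upwards [hv, hw, h] with x h1 h2 h3
  rw [integral_lp_add, add_div]
  refine (h1.add h2).congr fun n => ?_
  rw [h3, add_div]

theorem RatioConverges.smul {hf : MeasurePreserving f μ μ} {u v : Lp ℝ 1 μ} (c : ℝ)
    (hv : RatioConverges hf u v) : RatioConverges hf u (c • v) := by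
  have h : ∀ᵐ x ∂μ, ∀ n, transferSum hf n (c • v) x = c * transferSum hf n v x :=
    ae_all_iff.2 fun n => by
      rw [transferSum_smul]
      exact Lp.coeFn_smul _ _
  filter_upwards [hv, h] with x h1 h3
  rw [integral_lp_smul, mul_div_assoc]
  refine (h1.const_mul c).congr fun n => ?_
  rw [h3, mul_div_assoc]

theorem IsReference.transferSum_pos {u : Lp ℝ 1 μ} (hu : IsReference u)
    (hf : MeasurePreserving f μ μ) : ∀ᵐ x ∂μ, ∀ n, 0 < n → 0 < transferSum hf n u x := by
  have h : ∀ᵐ x ∂μ, ∀ n, 0 ≤ realTransfer hf (transferSum hf n u) x := ae_all_iff.2 fun n =>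
    (Lp.coeFn_nonneg _).2 (realTransfer_nonneg hf (transferSum_nonneg hf n hu.nonneg))
  have h2 : ∀ᵐ x ∂μ, ∀ n, transferSum hf (n + 1) u x =
      u x + realTransfer hf (transferSum hf n u) x := ae_all_iff.2 fun n => by
    rw [transferSum_succ']
    exact Lp.coeFn_add _ _
  filter_upwards [hu.pos, h, h2] with x h1 h2 h3 n hn
  obtain ⟨m, rfl⟩ : ∃ m, n = m + 1 := ⟨n - 1, by omega⟩
  rw [h3]
  linarith [h2 m]

theorem exists_isReference (hμ : μ ≠ 0) : ∃ u : Lp ℝ 1 μ, IsReference u := by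
  obtain ⟨g, hg0, hgm, hg1⟩ := exists_pos_lintegral_lt_of_sigmaFinite μ one_ne_zero
  have hint : Integrable (fun x => (g x : ℝ)) μ := by
    refine ⟨hgm.coe_nnreal_real.aestronglyMeasurable, ?_⟩
    rw [hasFiniteIntegral_iff_enorm]
    simpa using hg1.trans ENNReal.one_lt_top
  have hmem := memLp_one_iff_integrable.2 hint
  refine ⟨hmem.toLp _, ?_, ?_⟩
  · filter_upwards [hmem.coeFn_toLp] with x hx
    rw [hx]
    exact_mod_cast hg0 x
  · rw [integral_congr_ae hmem.coeFn_toLp, integral_pos_iff_support_of_nonneg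
      (fun x => NNReal.coe_nonneg _) hint]
    have : Function.support (fun x => (g x : ℝ)) = Set.univ := by
      ext x
      simpa using (hg0 x).ne'
    rw [this]
    simpa [pos_iff_ne_zero] using hμ

theorem isClosed_ratioConverges (hf : MeasurePreserving f μ μ) {u : Lp ℝ 1 μ}
    (hu : IsReference u) : IsClosed {v | RatioConverges hf u v} := by
  refine isClosed_of_closure_subset fun v hv => ?_
  set I := ∫ x, u x ∂μ with hI
  have hI0 : 0 < I := hu.integral_pos
  have hac : μ ≪ μ.withDensity fun x => ENNReal.ofReal (u x) := by
    refine withDensity_absolutelyContinuous'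
      (Lp.stronglyMeasurable u).measurable.ennreal_ofReal.aemeasurable ?_
    filter_upwards [hu.pos] with x hx
    simpa using hx
  have hbad : ∀ j : ℕ, ∀ᵐ x ∂μ, ∀ᶠ n in atTop,
      |transferSum hf n v x / transferSum hf n u x - (∫ x, v x ∂μ) / I| ≤ 3 * (1 / ((j : ℝ) + 1)) := by
    intro j
    set ε : ℝ := 1 / ((j : ℝ) + 1) with hε
    have hε0 : 0 < ε := by positivity
    refine hac.ae_le (mem_ae_iff.2 ?_)
    rw [← nonpos_iff_eq_zero]
    refine ENNReal.le_of_forall_pos_le_add fun δ hδ _ => ?_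
    rw [zero_add]
    obtain ⟨w, hw, hvw⟩ := Metric.mem_closure_iff.1 hv (min (ε * I) (ε * δ))
      (lt_min (by positivity) (mul_pos hε0 hδ))
    rw [dist_eq_norm] at hvw
    have hd1 : ‖v - w‖ ≤ ε * I := hvw.le.trans (min_le_left _ _)
    have hd2 : ‖v - w‖ / ε ≤ δ := by
      rw [div_le_iff₀ hε0, mul_comm]
      exact hvw.le.trans (min_le_right _ _)
    have hweak := weak_type_ratio hf (abs_nonneg (v - w)) hu.nonneg hε0
    rw [norm_abs_eq_norm] at hweak
    have hgood : ∀ᵐ x ∂μ, (¬ ∃ k, ε * transferSum hf k u x < transferSum hf k |v - w| x) →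
        ∀ᶠ n in atTop, |transferSum hf n v x / transferSum hf n u x - (∫ x, v x ∂μ) / I| ≤
          3 * ε := by
      have h1 : ∀ᵐ x ∂μ, ∀ n, |transferSum hf n v x - transferSum hf n w x| ≤
          transferSum hf n |v - w| x := ae_all_iff.2 fun n => by
        filter_upwards [(Lp.coeFn_le _ _).2 (abs_transferSum_le hf n (v - w)),
          Lp.coeFn_abs (transferSum hf n (v - w)),
          Lp.coeFn_sub (transferSum hf n v) (transferSum hf n w)] with x a b c
        rw [b, transferSum_sub, c] at a
        exact a
      have hw' : RatioConverges hf u w := hw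
      filter_upwards [h1, hw', hu.transferSum_pos hf] with x a b c hx
      push Not at hx
      have hb := (Metric.tendsto_nhds.1 b) ε hε0
      filter_upwards [hb, eventually_gt_atTop 0] with n hn hn0
      rw [Real.dist_eq] at hn
      have hpos := c n hn0
      have e1 : |transferSum hf n v x / transferSum hf n u x -
          transferSum hf n w x / transferSum hf n u x| ≤ ε := by
        rw [← sub_div, abs_div, abs_of_pos hpos, div_le_iff₀ hpos]
        exact (a n).trans (hx n)
      have e2 : |(∫ x, w x ∂μ) / I - (∫ x, v x ∂μ) / I| ≤ ε := by
        rw [← sub_div, abs_div, abs_of_pos hI0, div_le_iff₀ hI0, abs_sub_comm, ← integral_lp_sub]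
        exact (abs_integral_lp_le _).trans hd1
      rw [abs_le] at e1 e2 ⊢
      rw [abs_lt] at hn
      constructor <;> linarith [e1.1, e1.2, e2.1, e2.2, hn.1, hn.2]
    have hgood' := (withDensity_absolutelyContinuous μ fun x => ENNReal.ofReal (u x)).ae_le hgood
    refine (measure_mono_ae ?_).trans (hweak.trans ?_)
    · filter_upwards [hgood'] with x hx hx'
      by_contra hne
      exact hx' (hx hne)
    · rw [← ENNReal.ofReal_coe_nnreal]
      exact ENNReal.ofReal_le_ofReal hd2
  change ∀ᵐ x ∂μ, _
  filter_upwards [ae_all_iff.2 hbad] with x hx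
  rw [Metric.tendsto_nhds]
  intro ε hε
  obtain ⟨j, hj⟩ := exists_nat_one_div_lt (show 0 < ε / 3 by positivity)
  filter_upwards [hx j] with n hn
  rw [Real.dist_eq]
  linarith

theorem ratioConverges_self (hf : MeasurePreserving f μ μ) {u : Lp ℝ 1 μ}
    (hu : IsReference u) : RatioConverges hf u u := by
  filter_upwards [hu.transferSum_pos hf] with x hx
  rw [div_self hu.integral_pos.ne']
  refine tendsto_const_nhds.congr' ?_
  filter_upwards [eventually_gt_atTop 0] with n hn
  rw [div_self (hx n hn).ne']

theorem transferSum_sub_realTransfer (hf : MeasurePreserving f μ μ) (n : ℕ) (g : Lp ℝ 1 μ) :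
    transferSum hf n (g - realTransfer hf g) = g - (realTransfer hf ^ n) g := by
  induction n with
  | zero => simp [transferSum_zero]
  | succ n ih =>
    rw [transferSum_succ, ih, map_sub, pow_succ, mul_apply_eq_comp]
    abel

theorem ratioConverges_coboundary_indicator (hf : MeasurePreserving f μ μ)
    (hcons : Conservative f μ) (herg : Ergodic f μ) {u : Lp ℝ 1 μ} (hu : IsReference u)
    {A : Set X} (hA : MeasurableSet A) (hAf : μ A ≠ ∞) :
    RatioConverges hf u (indicatorConstLp 1 hA hAf (1 : ℝ) -
      realTransfer hf (indicatorConstLp 1 hA hAf (1 : ℝ))) := by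
  set g := indicatorConstLp 1 hA hAf (1 : ℝ) with hg
  have hg01 : ∀ᵐ x ∂μ, 0 ≤ g x ∧ g x ≤ 1 := by
    filter_upwards [indicatorConstLp_coeFn (p := 1) (hs := hA) (hμs := hAf) (c := (1 : ℝ))]
      with x hx
    rw [hg, hx]
    by_cases h : x ∈ A <;> simp [h]
  have hg0 : 0 ≤ g := (Lp.coeFn_nonneg _).1 (hg01.mono fun x hx => hx.1)
  have h1 : ∀ᵐ x ∂μ, ∀ n, 0 ≤ (realTransfer hf ^ n) g x ∧ (realTransfer hf ^ n) g x ≤ 1 :=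
    ae_all_iff.2 fun n => ((Lp.coeFn_nonneg _).2 (realTransfer_pow_nonneg hf hg0 n)).and
      (realTransfer_pow_le_const hf (hg01.mono fun x hx => hx.2) n)
  have h2 : ∀ᵐ x ∂μ, ∀ n, transferSum hf n (g - realTransfer hf g) x =
      g x - (realTransfer hf ^ n) g x := ae_all_iff.2 fun n => by
    rw [transferSum_sub_realTransfer]
    exact Lp.coeFn_sub _ _
  filter_upwards [h1, h2, hg01, ae_tendsto_transferSum_atTop hf hcons herg hu.nonneg hu.ne_zero,
    hu.transferSum_pos hf] with x a b c d e
  rw [integral_lp_sub, integral_realTransfer, sub_self, zero_div]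
  refine squeeze_zero_norm' ?_ d.inv_tendsto_atTop
  filter_upwards [eventually_gt_atTop 0] with n hn
  rw [b, norm_div, Real.norm_of_nonneg (e n hn).le, Pi.inv_apply, ← one_div]
  refine div_le_div_of_nonneg_right ?_ (e n hn).le
  rw [Real.norm_eq_abs, abs_le]
  constructor <;> linarith [(a n).1, (a n).2, c.1, c.2]

theorem ratioConverges_coboundary (hf : MeasurePreserving f μ μ)
    (hcons : Conservative f μ) (herg : Ergodic f μ) {u : Lp ℝ 1 μ} (hu : IsReference u)
    (g : Lp ℝ 1 μ) : RatioConverges hf u (g - realTransfer hf g) := by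
  induction g using Lp.induction ENNReal.one_ne_top with
  | indicatorConst c hs hμs =>
    have := (ratioConverges_coboundary_indicator hf hcons herg hu hs hμs.ne).smul c
    rwa [smul_sub, ← map_smul, ← indicatorConstLp_eq_smul_one] at this
  | add hf' hg' _ h1 h2 =>
    have := h1.add h2
    rw [map_add]
    convert this using 1
    abel
  | isClosed =>
    exact (isClosed_ratioConverges hf hu).preimage
      (continuous_id.sub (realTransfer hf).continuous)

/-- Hurewicz's ratio ergodic theorem. -/
theorem ratioConverges (hf : MeasurePreserving f μ μ) (hcons : Conservative f μ)
    (herg : Ergodic f μ) {u : Lp ℝ 1 μ} (hu : IsReference u) (v : Lp ℝ 1 μ) :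
    RatioConverges hf u v := by
  let K : Submodule ℝ (Lp ℝ 1 μ) :=
    { carrier := {v | RatioConverges hf u v}
      add_mem' := fun ha hb => RatioConverges.add ha hb
      zero_mem' := by
        have := (ratioConverges_self hf hu).smul 0
        rwa [zero_smul] at this
      smul_mem' := fun c _ ha => RatioConverges.smul c ha }
  have hKc : IsClosed (K : Set (Lp ℝ 1 μ)) := isClosed_ratioConverges hf hu
  by_contra hne
  have hvK : v ∉ K := hne
  obtain ⟨Λ, t, hΛ, hΛv⟩ := geometric_hahn_banach_closed_point K.convex hKc hvK
  have hΛK : ∀ w ∈ K, Λ w = 0 := by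
    intro w hw
    by_contra h0
    have := hΛ ((t / Λ w) • w) (K.smul_mem _ hw)
    rw [map_smul, smul_eq_mul, div_mul_cancel₀ _ h0] at this
    exact lt_irrefl _ this
  have ht : 0 < t := by simpa using hΛ 0 K.zero_mem
  obtain ⟨w, hwm, hw, hrep⟩ := exists_repr_strongDual Λ
  have hwf : MemLp (w ∘ f) ∞ μ := hw.comp_measurePreserving hf
  have hinv : w ∘ f =ᵐ[μ] w := by
    have hzero : (fun x => w (f x) - w x) =ᵐ[μ] 0 := by
      refine ae_eq_zero_of_forall_setIntegral_eq_of_sigmaFinite (fun A _ hA => ?_)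
        fun A hA hAf => ?_
      · have : Fact (μ A < ∞) := ⟨hA⟩
        exact ((hwf.restrict A).integrable le_top).sub ((hw.restrict A).integrable le_top)
      · have : Fact (μ A < ∞) := ⟨hAf⟩
        set g := indicatorConstLp 1 hA hAf.ne (1 : ℝ) with hg
        have h1 := hΛK _ (ratioConverges_coboundary hf hcons herg hu g)
        rw [map_sub, hrep, hrep, integral_realTransfer_mul hf g hw, sub_eq_zero] at h1
        have e : ∀ z : X → ℝ, ∫ x, g x * z x ∂μ = ∫ x in A, z x ∂μ := by
          intro z
          rw [← integral_indicator hA]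
          refine integral_congr_ae ?_
          filter_upwards [indicatorConstLp_coeFn (p := 1) (hs := hA) (hμs := hAf.ne)
            (c := (1 : ℝ))] with x hx
          rw [hg, hx]
          by_cases h : x ∈ A <;> simp [h]
        rw [e, e (fun x => w (f x))] at h1
        have h2 := integral_sub ((hwf.restrict A).integrable le_top)
          ((hw.restrict A).integrable le_top)
        exact h2.trans (sub_eq_zero.2 h1.symm)
    filter_upwards [hzero] with x hx
    exact sub_eq_zero.1 hx
  have : Nonempty X := by
    by_contra hX
    rw [not_nonempty_iff] at hX
    have := hu.integral_pos
    simp [Measure.eq_zero_of_isEmpty μ] at this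
  obtain ⟨c, hc⟩ := herg.ae_eq_const_of_ae_eq_comp_ae hwm.aestronglyMeasurable hinv
  have hΛc : ∀ z, Λ z = c * ∫ x, z x ∂μ := by
    intro z
    rw [hrep, ← integral_const_mul]
    refine integral_congr_ae ?_
    filter_upwards [hc] with x hx
    rw [hx, mul_comm]
    rfl
  have hc0 : c = 0 := by
    have := hΛK u (ratioConverges_self hf hu)
    rw [hΛc] at this
    exact (mul_eq_zero.1 this).resolve_right hu.integral_pos.ne'
  rw [hΛc, hc0, zero_mul] at hΛv
  exact lt_asymm ht hΛv

/-- The ratios `S_n v / S_n w` converge to `∫ v` for each `w` of integral one. -/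
theorem ae_tendsto_transferSum_div (hf : MeasurePreserving f μ μ) (hcons : Conservative f μ)
    (herg : Ergodic f μ) (v w : Lp ℝ 1 μ) (hw : ∫ x, w x ∂μ = 1) :
    ∀ᵐ x ∂μ, Tendsto (fun n => transferSum hf n v x / transferSum hf n w x) atTop
      (𝓝 (∫ x, v x ∂μ)) := by
  have hμ : μ ≠ 0 := by
    rintro rfl
    simp at hw
  obtain ⟨u, hu⟩ := exists_isReference hμ
  filter_upwards [ratioConverges hf hcons herg hu v, ratioConverges hf hcons herg hu w,
    hu.transferSum_pos hf] with x h1 h2 h3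
  have hI := hu.integral_pos
  have h4 := h1.div h2 (by rw [hw]; positivity)
  rw [hw, div_div_div_cancel_right₀ hI.ne', div_one] at h4
  refine h4.congr' ?_
  filter_upwards [eventually_gt_atTop 0] with n hn
  simp only [Pi.div_apply]
  rw [div_div_div_cancel_right₀ (h3 n hn).ne']

end Hurewicz

open scoped ENNReal NNReal

section Extension

variable {X : Type*} [MeasurableSpace X] {μ : Measure X} {f : X → X}

theorem setLIntegral_preimage_le (hf : MeasurePreserving f μ μ) {D : X → ℝ≥0∞} {C : ℝ≥0}
    (hC : ∀ x, D x ≤ C) {A : Set X} (hA : MeasurableSet A) :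
    ∫⁻ x in f ⁻¹' A, D x ∂μ ≤ C * μ A := by
  rw [← hf.measure_preimage hA.nullMeasurableSet, ← setLIntegral_const]
  exact lintegral_mono fun x => hC x

variable [SigmaFinite μ]

/-- The transfer operator on bounded nonnegative functions. -/
theorem exists_push_of_bounded (hf : MeasurePreserving f μ μ) {G : X → ℝ≥0∞}
    {C : ℝ≥0} (hC : ∀ x, G x ≤ C) :
    ∃ H : X → ℝ≥0∞, Measurable H ∧
      ∀ A, MeasurableSet A → ∫⁻ x in A, H x ∂μ = ∫⁻ x in f ⁻¹' A, G x ∂μ := by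
  set ν := (μ.withDensity G).map f with hν
  have hνA : ∀ A, MeasurableSet A → ν A = ∫⁻ x in f ⁻¹' A, G x ∂μ := by
    intro A hA
    rw [hν, Measure.map_apply hf.measurable hA, withDensity_apply _ (hf.measurable hA)]
  have hle : ν ≤ C • μ := by
    refine Measure.le_iff.2 fun A hA => ?_
    rw [hνA A hA]
    calc ∫⁻ x in f ⁻¹' A, G x ∂μ ≤ ∫⁻ _ in f ⁻¹' A, (C : ℝ≥0∞) ∂μ :=
          lintegral_mono fun x => hC x
      _ = C * μ A := by
        rw [setLIntegral_const, hf.measure_preimage hA.nullMeasurableSet]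
      _ = (C • μ) A := rfl
  have : SigmaFinite ν := Measure.sigmaFinite_of_le (C • μ) hle
  have hac : ν ≪ μ := (Measure.absolutelyContinuous_of_le hle).trans
    (Measure.smul_absolutelyContinuous)
  refine ⟨ν.rnDeriv μ, Measure.measurable_rnDeriv _ _, fun A hA => ?_⟩
  rw [← withDensity_apply _ hA, Measure.withDensity_rnDeriv_eq _ _ hac, hνA A hA]

/-- A bounded subinvariant function vanishing on a set of positive finite measure is zero. -/
theorem ae_eq_zero_of_subinvariant (hf : MeasurePreserving f μ μ) (hcons : Conservative f μ)
    (herg : Ergodic f μ) {D : X → ℝ≥0∞} (hD : Measurable D) {C : ℝ≥0} (hC : ∀ x, D x ≤ C)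
    (hsub : ∀ A, MeasurableSet A → μ A < ∞ → ∫⁻ x in A, D x ∂μ ≤ ∫⁻ x in f ⁻¹' A, D x ∂μ)
    {Y : Set X} (hY : MeasurableSet Y) (hY0 : μ Y ≠ 0) (hYf : μ Y < ∞)
    (hDY : ∀ᵐ x ∂μ.restrict Y, D x = 0) : ∀ᵐ x ∂μ, D x = 0 := by
  obtain ⟨H, hH, hHA⟩ := exists_push_of_bounded hf hC
  have hDH : D ≤ᵐ[μ] H := ae_le_of_forall_setLIntegral_le_of_sigmaFinite hD fun A hA hAf => by
    rw [hHA A hA]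
    exact hsub A hA hAf
  set ε : X → ℝ≥0∞ := fun x => H x - D x with hε
  have hεm : Measurable ε := hH.sub hD
  have hstep : ∀ A, MeasurableSet A →
      ∫⁻ x in A, ε x ∂μ + ∫⁻ x in A, D x ∂μ = ∫⁻ x in f ⁻¹' A, D x ∂μ := by
    intro A hA
    rw [← hHA A hA, ← lintegral_add_left hεm]
    refine lintegral_congr_ae (ae_restrict_of_ae ?_)
    filter_upwards [hDH] with x hx
    exact tsub_add_cancel_of_le hx
  have hm : ∀ n, MeasurableSet (f^[n] ⁻¹' Y) := fun n => (hf.measurable.iterate n) hY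
  have hsum : ∀ n, ∑ k ∈ Finset.range n, ∫⁻ x in f^[k] ⁻¹' Y, ε x ∂μ + ∫⁻ x in Y, D x ∂μ =
      ∫⁻ x in f^[n] ⁻¹' Y, D x ∂μ := by
    intro n
    induction n with
    | zero => simp
    | succ n ih =>
      have h := hstep _ (hm n)
      rw [Finset.sum_range_succ, add_right_comm, ih, add_comm, h, ← Set.preimage_comp,
        ← Function.iterate_succ]
  have hfin : ∑' k, ∫⁻ x in f^[k] ⁻¹' Y, ε x ∂μ ≠ ∞ := by
    refine ne_top_of_le_ne_top (ENNReal.mul_lt_top (ENNReal.coe_lt_top (r := C)) hYf).ne ?_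
    refine ENNReal.tsum_le_of_sum_range_le fun n => ?_
    refine le_self_add.trans ((hsum n).trans_le ?_)
    exact setLIntegral_preimage_le (hf.iterate n) hC hY
  have hε0 : μ.withDensity ε = 0 := by
    by_contra hne
    refine hfin ?_
    rw [← tsum_measure_preimage_iterate_eq_top hcons herg
      (withDensity_absolutelyContinuous μ ε) hne hY hY0]
    congr 1
    ext n
    rw [withDensity_apply _ (hm n)]
  have hDn : ∀ n, ∀ᵐ x ∂μ, x ∈ f^[n] ⁻¹' Y → D x = 0 := by
    intro n
    have h0 : ∫⁻ x in f^[n] ⁻¹' Y, D x ∂μ = 0 := by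
      rw [← hsum n, lintegral_congr_ae hDY, lintegral_zero, add_zero]
      refine Finset.sum_eq_zero fun k _ => ?_
      rw [← withDensity_apply _ (hm k), hε0]
      rfl
    rw [← ae_restrict_iff' (hm n)]
    exact (lintegral_eq_zero_iff hD).1 h0
  filter_upwards [ae_all_iff.2 hDn, ae_frequently_iterate_mem hcons herg hY hY0] with x h1 h2
  obtain ⟨n, hn⟩ := h2.exists
  exact h1 n hn

theorem ofReal_integral_le_lintegral {ν : Measure X} {g : X → ℝ} (hg : Integrable g ν) :
    ENNReal.ofReal (∫ x, g x ∂ν) ≤ ∫⁻ x, ENNReal.ofReal (g x) ∂ν := by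
  have h1 : ∫ x, g x ∂ν ≤ ∫ x, max (g x) 0 ∂ν :=
    integral_mono hg hg.pos_part fun x => le_max_left _ _
  refine (ENNReal.ofReal_le_ofReal h1).trans ?_
  rw [ofReal_integral_eq_lintegral_ofReal hg.pos_part (.of_forall fun x => le_max_right _ _)]
  refine lintegral_mono fun x => le_of_eq ?_
  rcases le_total (g x) 0 with h | h
  · rw [max_eq_right h, ENNReal.ofReal_of_nonpos h, ENNReal.ofReal_zero]
  · rw [max_eq_left h]

theorem ofReal_realTransfer_sub_le (hf : MeasurePreserving f μ μ) (v : Lp ℝ 1 μ) (L : ℝ)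
    {G H : X → ℝ≥0∞}
    (hHA : ∀ A, MeasurableSet A → ∫⁻ x in A, H x ∂μ = ∫⁻ x in f ⁻¹' A, G x ∂μ)
    (hG : ∀ᵐ x ∂μ, ENNReal.ofReal (v x - L) ≤ G x) :
    ∀ᵐ x ∂μ, ENNReal.ofReal (realTransfer hf v x - L) ≤ H x := by
  have hTm : Measurable (realTransfer hf v) := (Lp.stronglyMeasurable _).measurable
  refine ae_le_of_forall_setLIntegral_le_of_sigmaFinite (hTm.sub_const L).ennreal_ofReal
    fun A hA hAf => ?_
  set B : Set X := A ∩ {x | L ≤ realTransfer hf v x} with hB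
  have hBm : MeasurableSet B := hA.inter (measurableSet_le measurable_const hTm)
  have hBf : μ B < ∞ := (measure_mono Set.inter_subset_left).trans_lt hAf
  have hpre := hf.measure_preimage hBm.nullMeasurableSet
  have hintc : ∀ (w : Lp ℝ 1 μ) (E : Set X), μ E < ∞ →
      Integrable (fun x => w x - L) (μ.restrict E) := fun w E hE =>
    (integrable_lp w).restrict.sub (integrableOn_const hE.ne)
  have e1 : ∫⁻ x in A, ENNReal.ofReal (realTransfer hf v x - L) ∂μ =
      ∫⁻ x in B, ENNReal.ofReal (realTransfer hf v x - L) ∂μ := by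
    rw [hB, ← lintegral_inter_add_sdiff _ A (measurableSet_le measurable_const hTm)]
    rw [setLIntegral_congr_fun (f := fun x => ENNReal.ofReal (realTransfer hf v x - L))
      (g := fun _ => 0) (s := A \ {x | L ≤ realTransfer hf v x})]
    · simp
    · exact hA.diff (measurableSet_le measurable_const hTm)
    · intro x hx
      have : realTransfer hf v x < L := not_le.1 hx.2
      exact ENNReal.ofReal_of_nonpos (by linarith)
  have e2 : ∫ x in B, (realTransfer hf v x - L) ∂μ = ∫ x in f ⁻¹' B, (v x - L) ∂μ := by
    have hc : ∀ E : Set X, μ E < ∞ → Integrable (fun _ => L) (μ.restrict E) :=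
      fun E hE => integrableOn_const hE.ne
    rw [integral_sub (integrable_lp _).restrict (hc B hBf),
      integral_sub (integrable_lp _).restrict (hc _ (hpre.trans_lt hBf)),
      setIntegral_realTransfer hf v hBm]
    simp [Measure.real, hpre]
  calc ∫⁻ x in A, ENNReal.ofReal (realTransfer hf v x - L) ∂μ
      = ENNReal.ofReal (∫ x in B, (realTransfer hf v x - L) ∂μ) := by
        rw [e1, ofReal_integral_eq_lintegral_ofReal (hintc _ B hBf)]
        rw [EventuallyLE, ae_restrict_iff' hBm]
        exact .of_forall fun x hx => sub_nonneg.2 hx.2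
    _ ≤ ∫⁻ x in f ⁻¹' B, ENNReal.ofReal (v x - L) ∂μ := by
        rw [e2]
        exact ofReal_integral_le_lintegral (hintc _ _ (hpre.trans_lt hBf))
    _ ≤ ∫⁻ x in f ⁻¹' B, G x ∂μ := lintegral_mono_ae (ae_restrict_of_ae hG)
    _ = ∫⁻ x in B, H x ∂μ := (hHA B hBm).symm
    _ ≤ ∫⁻ x in A, H x ∂μ := lintegral_mono_set Set.inter_subset_left

theorem ofReal_abs_realTransfer_sub_le (hf : MeasurePreserving f μ μ) (v : Lp ℝ 1 μ) (L : ℝ)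
    {G H : X → ℝ≥0∞}
    (hHA : ∀ A, MeasurableSet A → ∫⁻ x in A, H x ∂μ = ∫⁻ x in f ⁻¹' A, G x ∂μ)
    (hG : ∀ᵐ x ∂μ, ENNReal.ofReal |v x - L| ≤ G x) :
    ∀ᵐ x ∂μ, ENNReal.ofReal |realTransfer hf v x - L| ≤ H x := by
  have h1 := ofReal_realTransfer_sub_le hf v L hHA (hG.mono fun x hx =>
    (ENNReal.ofReal_le_ofReal (le_abs_self _)).trans hx)
  have h2 := ofReal_realTransfer_sub_le hf (-v) (-L) hHA (by
    filter_upwards [hG, Lp.coeFn_neg v] with x hx hn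
    refine (ENNReal.ofReal_le_ofReal ?_).trans hx
    rw [hn, Pi.neg_apply, ← neg_sub', ]
    exact neg_le_abs _)
  rw [map_neg] at h2
  filter_upwards [h1, h2, Lp.coeFn_neg (realTransfer hf v)] with x a b c
  rw [c, Pi.neg_apply] at b
  rcases abs_choice (realTransfer hf v x - L) with h | h
  · rwa [h]
  · rw [h]
    convert b using 2
    ring

/-- The sums of a function supported on `Y` are bounded by their bound on `Y`. -/
theorem transferSum_indicator_le_of_restrict (hf : MeasurePreserving f μ μ) {Y : Set X}
    (hY : MeasurableSet Y) (hYf : μ Y ≠ ∞) {N : ℕ} {K : ℝ} (hK : 0 ≤ K)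
    (h : ∀ᵐ x ∂μ.restrict Y, transferSum hf N (indicatorConstLp 1 hY hYf (1 : ℝ)) x ≤ K) :
    ∀ᵐ x ∂μ, transferSum hf N (indicatorConstLp 1 hY hYf (1 : ℝ)) x ≤ K := by
  set e := indicatorConstLp 1 hY hYf (1 : ℝ) with he
  have hecoe := indicatorConstLp_coeFn (p := 1) (hs := hY) (hμs := hYf) (c := (1 : ℝ))
  have he0 : 0 ≤ e := by
    rw [← Lp.coeFn_nonneg]
    filter_upwards [hecoe] with x hx
    rw [he, hx]
    exact Set.indicator_nonneg (fun _ _ => zero_le_one) x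
  rw [ae_restrict_iff' hY] at h
  have hmono : Monotone fun n => transferSum hf n e := monotone_nat_of_le_succ fun n => by
    rw [transferSum_succ]
    exact le_add_of_nonneg_right (realTransfer_pow_nonneg hf he0 n)
  have key : ∀ n ≤ N, ∀ᵐ x ∂μ, transferSum hf n e x ≤ K := by
    intro n
    induction n with
    | zero =>
      intro _
      filter_upwards [Lp.coeFn_zero ℝ 1 μ] with x hx
      rw [transferSum_zero, hx]
      exact hK
    | succ n ih =>
      intro hn
      filter_upwards [h, realTransfer_le_const hf (ih (by omega)), hecoe,
        Lp.coeFn_add e (realTransfer hf (transferSum hf n e)),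
        (Lp.coeFn_le _ _).2 (hmono hn)] with x h1 h2 h3 h4 h5
      by_cases hxY : x ∈ Y
      · exact h5.trans (h1 hxY)
      · rw [transferSum_succ', h4, Pi.add_apply, he, h3, Set.indicator_of_notMem hxY, zero_add]
        exact h2
  exact key N le_rfl

/-- Convergence of the normalized sums of the indicator of `Y` extends from `Y` to the whole
space. -/
theorem ae_tendsto_transferSum_of_restrict (hf : MeasurePreserving f μ μ)
    (hcons : Conservative f μ) (herg : Ergodic f μ) {Y : Set X} (hY : MeasurableSet Y)
    (hY0 : μ Y ≠ 0) (hYf : μ Y ≠ ∞) {c : ℕ → ℝ} (hc0 : ∀ n, 0 ≤ c n)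
    (hcpos : ∀ᶠ n in atTop, 0 < c n) (hc : Tendsto c atTop (𝓝 0))
    (hratio : Tendsto (fun n => c (n + 1) / c n) atTop (𝓝 1)) {K L : ℝ} (hK : 0 ≤ K)
    (hbd : ∀ n, ∀ᵐ x ∂μ.restrict Y,
      c n * transferSum hf n (indicatorConstLp 1 hY hYf (1 : ℝ)) x ≤ K)
    (hlim : ∀ᵐ x ∂μ.restrict Y, Tendsto
      (fun n => c n * transferSum hf n (indicatorConstLp 1 hY hYf (1 : ℝ)) x) atTop (𝓝 L)) :
    ∀ᵐ x ∂μ, Tendsto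
      (fun n => c n * transferSum hf n (indicatorConstLp 1 hY hYf (1 : ℝ)) x) atTop (𝓝 L) := by
  set e := indicatorConstLp 1 hY hYf (1 : ℝ) with he
  have hecoe := indicatorConstLp_coeFn (p := 1) (hs := hY) (hμs := hYf) (c := (1 : ℝ))
  have he01 : ∀ᵐ x ∂μ, 0 ≤ e x ∧ e x ≤ 1 := by
    filter_upwards [hecoe] with x hx
    rw [he, hx]
    by_cases h : x ∈ Y <;> simp [h]
  have he0 : 0 ≤ e := (Lp.coeFn_nonneg _).1 (he01.mono fun x hx => hx.1)
  have hS0 : ∀ᵐ x ∂μ, ∀ n, 0 ≤ transferSum hf n e x := ae_all_iff.2 fun n =>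
    (Lp.coeFn_nonneg _).2 (transferSum_nonneg hf n he0)
  have hSK : ∀ᵐ x ∂μ, ∀ n, c n * transferSum hf n e x ≤ K := by
    refine ae_all_iff.2 fun n => ?_
    rcases (hc0 n).eq_or_lt with h0 | hpos
    · exact .of_forall fun x => by rw [← h0, zero_mul]; exact hK
    · have := transferSum_indicator_le_of_restrict hf hY hYf (N := n) (K := K / c n)
        (by positivity) (by
          filter_upwards [hbd n] with x hx
          rwa [le_div_iff₀ hpos, mul_comm])
      filter_upwards [this] with x hx
      rwa [le_div_iff₀ hpos, mul_comm] at hx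
  set C : ℝ≥0 := (K + |L|).toNNReal with hCdef
  let g : ℕ → X → ℝ≥0∞ := fun n x => min (ENNReal.ofReal |c n * transferSum hf n e x - L|) C
  have hgm : ∀ n, Measurable (g n) := fun n => by
    refine Measurable.min (Measurable.ennreal_ofReal ?_) measurable_const
    exact ((((Lp.stronglyMeasurable (transferSum hf n e)).measurable).const_mul _).sub_const L).abs
  have hgeq : ∀ᵐ x ∂μ, ∀ n, g n x = ENNReal.ofReal |c n * transferSum hf n e x - L| := by
    filter_upwards [hSK, hS0] with x h1 h2 n
    refine min_eq_left (ENNReal.ofReal_le_ofReal ?_)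
    refine (abs_sub _ _).trans ?_
    rw [abs_of_nonneg (mul_nonneg (hc0 n) (h2 n))]
    linarith [h1 n]
  have hgC : ∀ n x, g n x ≤ C := fun n x => min_le_right _ _
  let G : ℕ → X → ℝ≥0∞ := fun N x => ⨆ m, g (m + N) x
  have hGm : ∀ N, Measurable (G N) := fun N => .iSup fun m => hgm _
  have hGC : ∀ N x, G N x ≤ C := fun N x => iSup_le fun m => hgC _ _
  have hGanti : Antitone G := by
    intro a b hab x
    refine iSup_le fun m => ?_
    refine le_iSup_of_le (m + (b - a)) (le_of_eq ?_)
    rw [add_assoc, Nat.sub_add_cancel hab]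
  let D : X → ℝ≥0∞ := fun x => ⨅ N, G N x
  have hDlim : ∀ x, D x = limsup (fun n => g n x) atTop := fun x =>
    (limsup_eq_iInf_iSup_of_nat' (u := fun n => g n x)).symm
  have hDm : Measurable D := .iInf hGm
  have hDC : ∀ x, D x ≤ C := fun x => (iInf_le _ 0).trans (hGC 0 x)
  have hDH : ∀ N (H : X → ℝ≥0∞), (∀ A, MeasurableSet A →
      ∫⁻ x in A, H x ∂μ = ∫⁻ x in f ⁻¹' A, G N x ∂μ) → ∀ᵐ x ∂μ, D x ≤ H x := by
    intro N H hHA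
    have h1 : ∀ᵐ x ∂μ, ∀ m, N ≤ m →
        ENNReal.ofReal |realTransfer hf (c m • transferSum hf m e) x - L| ≤ H x := by
      refine ae_all_iff.2 fun m => ?_
      by_cases hm : N ≤ m
      · have := ofReal_abs_realTransfer_sub_le hf (c m • transferSum hf m e) L hHA (by
          filter_upwards [hgeq, Lp.coeFn_smul (c m) (transferSum hf m e)] with x a b
          rw [b, Pi.smul_apply, smul_eq_mul, ← a m]
          refine le_iSup_of_le (m - N) (le_of_eq ?_)
          rw [Nat.sub_add_cancel hm])
        exact this.mono fun x hx _ => hx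
      · exact .of_forall fun x h => absurd h hm
    have h2 : ∀ᵐ x ∂μ, ∀ m, 0 ≤ realTransfer hf (transferSum hf m e) x ∧
        c m * realTransfer hf (transferSum hf m e) x ≤ K := by
      refine ae_all_iff.2 fun m => ?_
      have a := (Lp.coeFn_nonneg _).2 (realTransfer_nonneg hf (transferSum_nonneg hf m he0))
      have b := realTransfer_le_const hf (v := c m • transferSum hf m e) (K := K) (by
        filter_upwards [hSK, Lp.coeFn_smul (c m) (transferSum hf m e)] with x a b
        rw [b]
        exact a m)
      rw [map_smul] at b
      filter_upwards [a, b, Lp.coeFn_smul (c m) (realTransfer hf (transferSum hf m e))] with x a b d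
      rw [d] at b
      exact ⟨a, b⟩
    have h3 : ∀ᵐ x ∂μ, ∀ m, transferSum hf (m + 1) e x =
        e x + realTransfer hf (transferSum hf m e) x := ae_all_iff.2 fun m => by
      rw [transferSum_succ']
      exact Lp.coeFn_add _ _
    have h4 : ∀ᵐ x ∂μ, ∀ m, realTransfer hf (c m • transferSum hf m e) x =
        c m * realTransfer hf (transferSum hf m e) x := ae_all_iff.2 fun m => by
      rw [map_smul]
      exact Lp.coeFn_smul _ _
    set δ : ℕ → ℝ := fun m => c (m + 1) + |c (m + 1) / c m - 1| * K with hδ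
    have hδlim : Tendsto (fun m => ENNReal.ofReal (δ m)) atTop (𝓝 0) := by
      have h5 : Tendsto δ atTop (𝓝 0) := by
        have a := ((hratio.sub_const 1).abs.mul_const K)
        have b := ((tendsto_add_atTop_iff_nat 1).2 hc).add a
        simpa using b
      simpa using ENNReal.tendsto_ofReal h5
    filter_upwards [h1, h2, h3, h4, he01, hgeq] with x a b d d' e' gx
    have hstep : ∀ᶠ m in atTop, g (m + 1) x ≤ H x + ENNReal.ofReal (δ m) := by
      filter_upwards [hcpos, eventually_ge_atTop N] with m hm hmN
      rw [gx, d]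
      refine le_trans (ENNReal.ofReal_le_ofReal
        (?_ : _ ≤ |realTransfer hf (c m • transferSum hf m e) x - L| + δ m)) ?_
      · rw [d' m]
        set τ := realTransfer hf (transferSum hf m e) x
        have e1 : c (m + 1) * (e x + τ) - L =
            (c m * τ - L) + (c (m + 1) * e x + (c (m + 1) / c m - 1) * (c m * τ)) := by
          field_simp
          ring
        rw [e1]
        refine (abs_add_le _ _).trans (add_le_add_right ((abs_add_le _ _).trans ?_) _)
        refine add_le_add ?_ ?_
        · rw [abs_of_nonneg (mul_nonneg (hc0 _) e'.1)]
          exact mul_le_of_le_one_right (hc0 _) e'.2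
        · rw [abs_mul, abs_of_nonneg (mul_nonneg (hc0 m) (b m).1)]
          exact mul_le_mul_of_nonneg_left (b m).2 (abs_nonneg _)
      · rw [ENNReal.ofReal_add (abs_nonneg _) (add_nonneg (hc0 _) (mul_nonneg (abs_nonneg _) hK))]
        exact add_le_add_left (a m hmN) _
    rw [hDlim, ← limsup_nat_add _ 1]
    have h5 : Tendsto (fun m => H x + ENNReal.ofReal (δ m)) atTop (𝓝 (H x + 0)) :=
      tendsto_const_nhds.add hδlim
    rw [add_zero] at h5
    rw [← h5.limsup_eq]
    exact limsup_le_limsup hstep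
  have hsub : ∀ A, MeasurableSet A → μ A < ∞ →
      ∫⁻ x in A, D x ∂μ ≤ ∫⁻ x in f ⁻¹' A, D x ∂μ := by
    intro A hA hAf
    have e1 : ∫⁻ x in f ⁻¹' A, D x ∂μ = ⨅ N, ∫⁻ x in f ⁻¹' A, G N x ∂μ := by
      refine lintegral_iInf hGm hGanti (ne_top_of_le_ne_top
        (ENNReal.mul_lt_top (ENNReal.coe_lt_top (r := C)) hAf).ne ?_)
      exact setLIntegral_preimage_le hf (hGC 0) hA
    rw [e1]
    refine le_iInf fun N => ?_
    obtain ⟨H, _, hHA⟩ := exists_push_of_bounded hf (hGC N)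
    rw [← hHA A hA]
    exact lintegral_mono_ae (ae_restrict_of_ae (hDH N H hHA))
  have hDY : ∀ᵐ x ∂μ.restrict Y, D x = 0 := by
    filter_upwards [hlim, ae_restrict_of_ae hgeq] with x hx gx
    rw [hDlim]
    simp_rw [gx]
    have h1 : Tendsto (fun n => ENNReal.ofReal |c n * transferSum hf n e x - L|) atTop (𝓝 0) := by
      have := ENNReal.tendsto_ofReal (hx.sub_const L).abs
      simpa using this
    exact h1.limsup_eq
  filter_upwards [ae_eq_zero_of_subinvariant hf hcons herg hDm hDC hsub hY hY0 hYf.lt_top hDY,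
    hgeq] with x hx gx
  rw [hDlim] at hx
  simp_rw [gx] at hx
  have h1 : Tendsto (fun n => ENNReal.ofReal |c n * transferSum hf n e x - L|) atTop (𝓝 0) :=
    tendsto_of_le_liminf_of_limsup_le bot_le hx.le
  have h2 := (ENNReal.tendsto_toReal ENNReal.zero_ne_top).comp h1
  simp only [ENNReal.toReal_zero] at h2
  have h3 : Tendsto (fun n => |c n * transferSum hf n e x - L|) atTop (𝓝 0) :=
    h2.congr fun n => ENNReal.toReal_ofReal (abs_nonneg _)
  have h4 := (tendsto_zero_iff_abs_tendsto_zero _).2 h3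
  simpa using h4.add_const L

end Extension

section SpectralPerturbation

variable {B : Type*} [NormedAddCommGroup B] [NormedSpace ℂ B] [CompleteSpace B]

theorem continuousOn_resolvent_sphere {A : B →L[ℂ] B} {z₀ : ℂ} {r : ℝ} (hr : 0 < r)
    (hspec : spectrum ℂ A ∩ Metric.closedBall z₀ r = {z₀}) :
    ContinuousOn (resolvent A) (Metric.sphere z₀ r) ∧
      ∀ z ∈ Metric.sphere z₀ r, z ∈ resolventSet ℂ A := by
  have hmem : ∀ z ∈ Metric.sphere z₀ r, z ∈ resolventSet ℂ A := by
    intro z hz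
    by_contra hne
    have : z ∈ spectrum ℂ A ∩ Metric.closedBall z₀ r := ⟨hne, Metric.sphere_subset_closedBall hz⟩
    rw [hspec, Set.mem_singleton_iff] at this
    rw [this, Metric.mem_sphere, dist_self] at hz
    exact hr.ne hz
  exact ⟨fun z hz => (spectrum.hasDerivAt_resolvent_const_left (hmem z hz)).continuousAt.continuousWithinAt,
    hmem⟩

theorem clm_circleIntegral {E F : Type*} [NormedAddCommGroup E] [NormedSpace ℂ E] [CompleteSpace E]
    [NormedAddCommGroup F] [NormedSpace ℂ F] [CompleteSpace F] (Φ : E →L[ℂ] F) {g : ℂ → E}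
    {z₀ : ℂ} {r : ℝ} (hg : CircleIntegrable g z₀ r) :
    Φ (∮ z in C(z₀, r), g z) = ∮ z in C(z₀, r), Φ (g z) := by
  unfold circleIntegral
  rw [← ContinuousLinearMap.intervalIntegral_comp_comm Φ hg.out]
  simp only [map_smul]

/-- The reduced resolvent at an isolated point of the spectrum. -/
theorem exists_reduced_resolvent {A : B →L[ℂ] B} {z₀ : ℂ} {r : ℝ} (hr : 0 < r)
    (hspec : spectrum ℂ A ∩ Metric.closedBall z₀ r = {z₀}) :
    ∃ Q : B →L[ℂ] B, (algebraMap ℂ (B →L[ℂ] B) z₀ - A) * Q = 1 - spectralProjection A z₀ r ∧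
      Q * (algebraMap ℂ (B →L[ℂ] B) z₀ - A) = 1 - spectralProjection A z₀ r := by
  obtain ⟨hcont, hmem⟩ := continuousOn_resolvent_sphere hr hspec
  have hne : ∀ z ∈ Metric.sphere z₀ r, z - z₀ ≠ 0 := by
    intro z hz h0
    rw [sub_eq_zero.1 h0, Metric.mem_sphere, dist_self] at hz
    exact hr.ne hz
  have hinv : ContinuousOn (fun z : ℂ => (z - z₀)⁻¹) (Metric.sphere z₀ r) :=
    (continuousOn_id.sub continuousOn_const).inv₀ hne
  have hint1 : CircleIntegrable (resolvent A) z₀ r := hcont.circleIntegrable hr.le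
  have hint2 : CircleIntegrable (fun z => (z - z₀)⁻¹ • resolvent A z) z₀ r :=
    (hinv.smul hcont).circleIntegrable hr.le
  have hint3 : CircleIntegrable (fun z => (z - z₀)⁻¹ • (1 : B →L[ℂ] B)) z₀ r :=
    (hinv.smul continuousOn_const).circleIntegrable hr.le
  have hone : (2 * Real.pi * Complex.I : ℂ)⁻¹ • (∮ z in C(z₀, r), (z - z₀)⁻¹ • (1 : B →L[ℂ] B)) =
      1 := by
    rw [circleIntegral.integral_smul_const, circleIntegral.integral_sub_center_inv _ hr.ne',
      smul_smul, inv_mul_cancel₀ Complex.two_pi_I_ne_zero, one_smul]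
  have key : ∀ z ∈ Metric.sphere z₀ r, algebraMap ℂ (B →L[ℂ] B) z₀ - A =
      (algebraMap ℂ (B →L[ℂ] B) z - A) - (z - z₀) • 1 := by
    intro z _
    rw [sub_smul, Algebra.algebraMap_eq_smul_one, Algebra.algebraMap_eq_smul_one]
    abel
  have hfinal : (2 * Real.pi * Complex.I : ℂ)⁻¹ • (∮ z in C(z₀, r),
      ((z - z₀)⁻¹ • (1 : B →L[ℂ] B) - resolvent A z)) = 1 - spectralProjection A z₀ r := by
    rw [circleIntegral.integral_sub hint3 hint1, smul_sub, hone, spectralProjection]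
  refine ⟨(2 * Real.pi * Complex.I : ℂ)⁻¹ • ∮ z in C(z₀, r), (z - z₀)⁻¹ • resolvent A z, ?_, ?_⟩
  · rw [mul_smul_comm, ← hfinal]
    congr 1
    have h := clm_circleIntegral (ContinuousLinearMap.mul ℂ (B →L[ℂ] B)
      (algebraMap ℂ (B →L[ℂ] B) z₀ - A)) hint2
    rw [ContinuousLinearMap.mul_apply'] at h
    rw [h]
    refine circleIntegral.integral_congr hr.le fun z hz => ?_
    have h1 : (algebraMap ℂ (B →L[ℂ] B) z - A) * resolvent A z = 1 :=
      Ring.mul_inverse_cancel _ (hmem z hz)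
    simp only [ContinuousLinearMap.mul_apply']
    rw [mul_smul_comm, key z hz, sub_mul, h1, smul_mul_assoc, one_mul, smul_sub, smul_smul,
      inv_mul_cancel₀ (hne z hz), one_smul]
  · rw [smul_mul_assoc, ← hfinal]
    congr 1
    have h := clm_circleIntegral ((ContinuousLinearMap.mul ℂ (B →L[ℂ] B)).flip
      (algebraMap ℂ (B →L[ℂ] B) z₀ - A)) hint2
    rw [ContinuousLinearMap.flip_apply, ContinuousLinearMap.mul_apply'] at h
    rw [h]
    refine circleIntegral.integral_congr hr.le fun z hz => ?_
    have h1 : resolvent A z * (algebraMap ℂ (B →L[ℂ] B) z - A) = 1 :=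
      Ring.inverse_mul_cancel _ (hmem z hz)
    simp only [ContinuousLinearMap.flip_apply, ContinuousLinearMap.mul_apply']
    rw [smul_mul_assoc, key z hz, mul_sub, h1, mul_smul_comm, mul_one, smul_sub, smul_smul,
      inv_mul_cancel₀ (hne z hz), one_smul]

/-- If `1` is a simple isolated eigenvalue of `A`, with eigenvector `e` and with a left eigenvector
`m`, then `1 - A + m ⊗ e` is invertible. -/
theorem isUnit_one_sub_add_of_simple {A : B →L[ℂ] B} (hA : IsSimpleIsolatedEigenvalue A 1)
    {e : B} (hAe : A e = e) {m : B →L[ℂ] ℂ} (hmA : ∀ v, m (A v) = m v) (hme : m e = 1) :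
    IsUnit (1 - A + m.smulRight e) := by
  obtain ⟨-, r, hr, hspec, hrank⟩ := hA
  obtain ⟨Q, h1, h2⟩ := exists_reduced_resolvent hr hspec
  rw [map_one] at h1 h2
  have he0 : e ≠ 0 := by
    rintro rfl
    simp at hme
  have hPe : spectralProjection A 1 r e = e := by
    have h := congrArg (fun L : B →L[ℂ] B => L e) h2
    simp only [mul_apply_eq_comp, sub_apply,
      one_apply_eq_self, hAe, sub_self, map_zero] at h
    exact (sub_eq_zero.1 h.symm).symm
  have hP : spectralProjection A 1 r = m.smulRight e := by
    ext v
    have hmem : spectralProjection A 1 r v ∈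
        LinearMap.range (spectralProjection A 1 r : B →ₗ[ℂ] B) := ⟨v, rfl⟩
    have hmem' : e ∈ LinearMap.range (spectralProjection A 1 r : B →ₗ[ℂ] B) := ⟨e, hPe⟩
    obtain ⟨c, hc⟩ := (finrank_eq_one_iff_of_nonzero'
      (⟨e, hmem'⟩ : LinearMap.range (spectralProjection A 1 r : B →ₗ[ℂ] B))
      (fun h => he0 (congrArg Subtype.val h))).1 hrank ⟨_, hmem⟩
    have hc' : c • e = spectralProjection A 1 r v := congrArg Subtype.val hc
    have h := congrArg (fun L : B →L[ℂ] B => m (L v)) h1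
    simp only [mul_apply_eq_comp, sub_apply,
      one_apply_eq_self, map_sub, hmA, sub_self, ← hc', map_smul, hme,
      smul_eq_mul, mul_one] at h
    rw [← hc', ContinuousLinearMap.smulRight_apply, ← sub_eq_zero.1 h.symm]
  rw [hP] at h1 h2
  set P := m.smulRight e with hPdef
  have hPP : P * P = P := by
    ext v
    simp [hPdef, hme]
  have hAP : (1 - A) * P = 0 := by
    ext v
    simp [hPdef, hAe]
  have hPA : P * (1 - A) = 0 := by
    ext v
    simp [hPdef, hmA]
  have hQ : (1 - P) * (1 - P) = 1 - P := by
    rw [mul_sub, sub_mul, sub_mul, hPP]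
    simp
  refine ⟨⟨1 - A + P, (1 - P) * Q * (1 - P) + P, ?_, ?_⟩, rfl⟩
  · have e1 : (1 - A) * ((1 - P) * Q * (1 - P)) = 1 - P := by
      rw [← mul_assoc, ← mul_assoc, mul_sub (1 - A), hAP, mul_one, sub_zero, h1, hQ]
    have e2 : P * ((1 - P) * Q * (1 - P)) = 0 := by
      rw [← mul_assoc, ← mul_assoc, mul_sub P, mul_one, hPP, sub_self, zero_mul, zero_mul]
    rw [add_mul, mul_add, mul_add, e1, e2, hAP, hPP]
    abel
  · have e1 : (1 - P) * Q * (1 - P) * (1 - A) = 1 - P := by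
      have e0 : (1 - P) * (1 - A) = 1 - A := by rw [sub_mul 1 P, hPA, one_mul, sub_zero]
      rw [mul_assoc, e0, mul_assoc, h2, hQ]
    have e2 : (1 - P) * Q * (1 - P) * P = 0 := by
      have e0 : (1 - P) * P = 0 := by rw [sub_mul, one_mul, hPP, sub_self]
      rw [mul_assoc, e0, mul_zero]
    rw [add_mul, mul_add, mul_add, e1, e2, hPA, hPP]
    abel

/-- Approximate eigenvectors of perturbations of an operator with a simple isolated eigenvalue. -/
theorem exists_tendsto_perturbed_eigenvector {A : B →L[ℂ] B}
    (hA : IsSimpleIsolatedEigenvalue A 1) {e : B} (hAe : A e = e) {m : B →L[ℂ] ℂ}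
    (hmA : ∀ v, m (A v) = m v) (hme : m e = 1) {ι : Type*} {l : Filter ι} {A' : ι → B →L[ℂ] B}
    (hA' : Tendsto A' l (𝓝 A)) :
    ∃ w : ι → B, Tendsto w l (𝓝 e) ∧ ∀ᶠ i in l, w i - A' i (w i) = (1 - m (w i)) • e := by
  obtain ⟨U, hU⟩ := isUnit_one_sub_add_of_simple hA hAe hmA hme
  have hN : Tendsto (fun i => 1 - A' i + m.smulRight e) l (𝓝 (U : B →L[ℂ] B)) := by
    rw [hU]
    exact (hA'.const_sub 1).add_const _
  have hinv := (NormedRing.inverse_continuousAt U).tendsto.comp hN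
  have hunit : ∀ᶠ i in l, IsUnit (1 - A' i + m.smulRight e) :=
    hN.eventually (Units.isOpen.mem_nhds U.isUnit)
  refine ⟨fun i => Ring.inverse (1 - A' i + m.smulRight e) e, ?_, ?_⟩
  · have h1 := ((ContinuousLinearMap.apply ℂ B e).continuous.tendsto _).comp hinv
    have h2 : Ring.inverse (U : B →L[ℂ] B) e = e := by
      have h3 : (U : B →L[ℂ] B) e = e := by
        rw [hU]
        simp [hAe, hme]
      conv_lhs => rw [← h3]
      rw [← mul_apply_eq_comp, Ring.inverse_mul_cancel _ U.isUnit]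
      rfl
    simp only [ContinuousLinearMap.apply_apply, h2] at h1
    exact h1
  · filter_upwards [hunit] with i hi
    have h1 := congrArg (fun L : B →L[ℂ] B => L e) (Ring.mul_inverse_cancel _ hi)
    simp only [mul_apply_eq_comp, add_apply,
      sub_apply, one_apply_eq_self,
      ContinuousLinearMap.smulRight_apply] at h1
    rw [sub_smul, one_smul]
    exact eq_sub_of_add_eq h1

end SpectralPerturbation

section Renewal

variable {X : Type*} {f : X → X} {Y : Set X}

/-- The discounted number of visits `∑ xⁿ 1_A(fⁿ y)`. -/
noncomputable def discountedVisits (f : X → X) (A : Set X) (x : ℝ) (y : X) : ℝ :=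
  ∑' n : ℕ, x ^ n * A.indicator (fun _ => (1 : ℝ)) (f^[n] y)

theorem indicator_one_mem_Icc (A : Set X) (y : X) :
    A.indicator (fun _ => (1 : ℝ)) y ∈ Set.Icc (0 : ℝ) 1 := by
  by_cases h : y ∈ A <;> simp [h]

theorem summable_pow_mul_of_mem_Icc {x : ℝ} (hx0 : 0 ≤ x) (hx1 : x < 1) {a : ℕ → ℝ}
    (ha : ∀ n, a n ∈ Set.Icc (0 : ℝ) 1) : Summable fun n => x ^ n * a n :=
  Summable.of_nonneg_of_le (fun n => mul_nonneg (pow_nonneg hx0 n) (ha n).1)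
    (fun n => mul_le_of_le_one_right (pow_nonneg hx0 n) (ha n).2)
    (summable_geometric_of_lt_one hx0 hx1)

theorem summable_discountedVisits (f : X → X) (A : Set X) {x : ℝ} (hx0 : 0 ≤ x) (hx1 : x < 1)
    (y : X) : Summable fun n : ℕ => x ^ n * A.indicator (fun _ => (1 : ℝ)) (f^[n] y) :=
  summable_pow_mul_of_mem_Icc hx0 hx1 fun _ => indicator_one_mem_Icc A _

theorem abs_discountedVisits_le (f : X → X) (A : Set X) {x : ℝ} (hx0 : 0 ≤ x) (hx1 : x < 1)
    (y : X) : |discountedVisits f A x y| ≤ (1 - x)⁻¹ := by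
  rw [discountedVisits, abs_of_nonneg (tsum_nonneg fun n => mul_nonneg (pow_nonneg hx0 n)
    (indicator_one_mem_Icc A _).1), ← tsum_geometric_of_lt_one hx0 hx1]
  exact (summable_discountedVisits f A hx0 hx1 y).tsum_le_tsum
    (fun n => mul_le_of_le_one_right (pow_nonneg hx0 n) (indicator_one_mem_Icc A _).2)
    (summable_geometric_of_lt_one hx0 hx1)

/-- The renewal identity. -/
theorem discountedVisits_eq {A : Set X} (hAY : A ⊆ Y) {x : ℝ} (hx0 : 0 ≤ x) (hx1 : x < 1) {y : X}
    (hy : 1 ≤ firstReturnTime f Y y) :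
    discountedVisits f A x y = A.indicator (fun _ => (1 : ℝ)) y +
      x ^ firstReturnTime f Y y * discountedVisits f A x (firstReturnMap f Y y) := by
  set k := firstReturnTime f Y y with hk
  have hret := ((firstReturnTime_eq_iff f Y y hy).1 rfl).2
  have hs := summable_discountedVisits f A hx0 hx1 y
  rw [discountedVisits, ← hs.sum_add_tsum_nat_add k]
  congr 1
  · rw [Finset.sum_eq_single 0]
    · simp
    · intro n hn hn0
      have : f^[n] y ∉ A := fun h =>
        hret n (Nat.one_le_iff_ne_zero.2 hn0) (Finset.mem_range.1 hn) (hAY h)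
      rw [Set.indicator_of_notMem this, mul_zero]
    · intro h
      simp at h
      omega
  · rw [discountedVisits, ← tsum_mul_left]
    refine tsum_congr fun n => ?_
    rw [firstReturnMap, ← hk, pow_add, Function.iterate_add_apply]
    ring

variable [MeasurableSpace X] {μ : Measure X}

theorem ae_one_le_firstReturnTime (hc : Conservative f μ) (hY : MeasurableSet Y) :
    ∀ᵐ y ∂μ.restrict Y, 1 ≤ firstReturnTime f Y y := by
  rw [ae_restrict_iff' hY]
  filter_upwards [hc.ae_mem_imp_frequently_image_mem hY.nullMeasurableSet] with y hy hyY
  obtain ⟨n, hn, hnY⟩ := (frequently_atTop.1 (hy hyY)) 1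
  have hne : {n : ℕ | 1 ≤ n ∧ f^[n] y ∈ Y}.Nonempty := ⟨n, hn, hnY⟩
  exact (Nat.sInf_mem hne).1

theorem measurable_discountedVisits (hf : Measurable f) {A : Set X} (hA : MeasurableSet A)
    (x : ℝ) : Measurable (discountedVisits f A x) :=
  Measurable.tsum fun n => ((measurable_const.indicator hA).comp (hf.iterate n)).const_mul _

theorem memLp_top_discountedVisits (hf : Measurable f) {A : Set X} (hA : MeasurableSet A) {x : ℝ}
    (hx0 : 0 ≤ x) (hx1 : x < 1) (ν : Measure X) : MemLp (discountedVisits f A x) ∞ ν :=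
  memLp_top_of_bound (measurable_discountedVisits hf hA x).aestronglyMeasurable (1 - x)⁻¹
    (.of_forall fun y => abs_discountedVisits_le f A hx0 hx1 y)

theorem integral_discountedVisits (hf : Measurable f) {A : Set X} (hA : MeasurableSet A) {x : ℝ}
    (hx0 : 0 ≤ x) (hx1 : x < 1) (ν : Measure X) [IsProbabilityMeasure ν] :
    ∫ y, discountedVisits f A x y ∂ν = ∑' n : ℕ, x ^ n * ν.real (f^[n] ⁻¹' A) := by
  have hm : ∀ n, MeasurableSet (f^[n] ⁻¹' A) := fun n => (hf.iterate n) hA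
  have hfun : ∀ n, (fun y => A.indicator (fun _ => (1 : ℝ)) (f^[n] y)) =
      (f^[n] ⁻¹' A).indicator fun _ => (1 : ℝ) := fun n => rfl
  have hint : ∀ n : ℕ, Integrable (fun y => x ^ n * A.indicator (fun _ => (1 : ℝ)) (f^[n] y)) ν :=
    fun n => by
      refine Integrable.const_mul ?_ _
      rw [hfun]
      exact (integrable_const 1).indicator (hm n)
  have hI : ∀ n : ℕ, ∫ y, x ^ n * A.indicator (fun _ => (1 : ℝ)) (f^[n] y) ∂ν =
      x ^ n * ν.real (f^[n] ⁻¹' A) := by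
    intro n
    rw [integral_const_mul, hfun, integral_indicator (hm n)]
    simp
  have hsum : Summable fun n : ℕ => ∫ y, ‖x ^ n * A.indicator (fun _ => (1 : ℝ)) (f^[n] y)‖ ∂ν := by
    have : ∀ n y, ‖x ^ n * A.indicator (fun _ => (1 : ℝ)) (f^[n] y)‖ =
        x ^ n * A.indicator (fun _ => (1 : ℝ)) (f^[n] y) := fun n y =>
      Real.norm_of_nonneg (mul_nonneg (pow_nonneg hx0 n) (indicator_one_mem_Icc A _).1)
    simp_rw [this, hI]
    exact summable_pow_mul_of_mem_Icc hx0 hx1 fun n => ⟨measureReal_nonneg, measureReal_le_one⟩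
  rw [← tsum_congr hI]
  exact (hasSum_integral_of_summable_integral_norm hint hsum).tsum_eq.symm

/-- The expectation of `1 - x^φ` in terms of the tail of `φ`. -/
theorem integral_one_sub_pow_eq (ν : Measure X) [IsProbabilityMeasure ν] {φ : X → ℕ}
    (hφ : Measurable φ) {x : ℝ} (hx0 : 0 ≤ x) (hx1 : x < 1) :
    ∫ y, (1 - x ^ φ y) ∂ν = (1 - x) * ∑' n : ℕ, x ^ n * ν.real {y | n < φ y} := by
  have hm : ∀ n : ℕ, MeasurableSet {y | n < φ y} := fun n => hφ measurableSet_Ioi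
  have hint : ∀ n : ℕ, Integrable (fun y => x ^ n * {y | n < φ y}.indicator (fun _ => (1 : ℝ)) y) ν :=
    fun n => ((integrable_const 1).indicator (hm n)).const_mul _
  have hI : ∀ n : ℕ, ∫ y, x ^ n * {y | n < φ y}.indicator (fun _ => (1 : ℝ)) y ∂ν =
      x ^ n * ν.real {y | n < φ y} := by
    intro n
    rw [integral_const_mul, integral_indicator (hm n)]
    simp
  have hsum : Summable fun n : ℕ =>
      ∫ y, ‖x ^ n * {y | n < φ y}.indicator (fun _ => (1 : ℝ)) y‖ ∂ν := by
    have : ∀ (n : ℕ) y, ‖x ^ n * {y | n < φ y}.indicator (fun _ => (1 : ℝ)) y‖ =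
        x ^ n * {y | n < φ y}.indicator (fun _ => (1 : ℝ)) y := fun n y =>
      Real.norm_of_nonneg (mul_nonneg (pow_nonneg hx0 n) (indicator_one_mem_Icc _ _).1)
    simp_rw [this, hI]
    exact summable_pow_mul_of_mem_Icc hx0 hx1 fun n => ⟨measureReal_nonneg, measureReal_le_one⟩
  rw [← tsum_congr hI, (hasSum_integral_of_summable_integral_norm hint hsum).tsum_eq,
    ← integral_const_mul]
  congr 1
  ext y
  rw [tsum_eq_sum (s := Finset.range (φ y))]
  · rw [← mul_neg_geom_sum]
    congr 1
    refine Finset.sum_congr rfl fun n hn => ?_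
    rw [Set.indicator_of_mem (show y ∈ {y | n < φ y} from Finset.mem_range.1 hn), mul_one]
  · intro n hn
    rw [Set.indicator_of_notMem (show y ∉ {y | n < φ y} from fun h => hn (Finset.mem_range.2 h)),
      mul_zero]

variable [SigmaFinite μ]

theorem ae_realTransfer_pow_indicator_mem_Icc (hf : MeasurePreserving f μ μ)
    (hY : MeasurableSet Y) (hYf : μ Y ≠ ∞) :
    ∀ᵐ y ∂μ, ∀ n, (realTransfer hf ^ n) (indicatorConstLp 1 hY hYf (1 : ℝ)) y ∈
      Set.Icc (0 : ℝ) 1 := by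
  have hecoe := indicatorConstLp_coeFn (p := 1) (hs := hY) (hμs := hYf) (c := (1 : ℝ))
  have he0 : 0 ≤ indicatorConstLp 1 hY hYf (1 : ℝ) := by
    rw [← Lp.coeFn_nonneg]
    filter_upwards [hecoe] with x hx
    rw [hx]
    exact (indicator_one_mem_Icc Y x).1
  refine ae_all_iff.2 fun n => ((Lp.coeFn_nonneg _).2 (realTransfer_pow_nonneg hf he0 n)).and
    (realTransfer_pow_le_const hf ?_ n)
  filter_upwards [hecoe] with x hx
  rw [hx]
  exact (indicator_one_mem_Icc Y x).2

/-- The generating function `∑ xⁿ Tⁿ 1_Y`. -/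
noncomputable def discountedTransfer (hf : MeasurePreserving f μ μ) (hY : MeasurableSet Y)
    (hYf : μ Y ≠ ∞) (x : ℝ) (y : X) : ℝ :=
  ∑' n : ℕ, x ^ n * (realTransfer hf ^ n) (indicatorConstLp 1 hY hYf (1 : ℝ)) y

theorem integrableOn_discountedTransfer (hf : MeasurePreserving f μ μ) (hY : MeasurableSet Y)
    (hYf : μ Y ≠ ∞) {x : ℝ} (hx0 : 0 ≤ x) (hx1 : x < 1) :
    IntegrableOn (discountedTransfer hf hY hYf x) Y μ := by
  have hfin : IsFiniteMeasure (μ.restrict Y) := ⟨by simpa using hYf.lt_top⟩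
  refine Integrable.of_bound (C := (1 - x)⁻¹) ?_ ?_
  · exact (Measurable.tsum fun n =>
      (Lp.stronglyMeasurable _).measurable.const_mul _).aestronglyMeasurable
  · filter_upwards [ae_restrict_of_ae (ae_realTransfer_pow_indicator_mem_Icc hf hY hYf)] with y hy
    rw [Real.norm_eq_abs, discountedTransfer, abs_of_nonneg (tsum_nonneg fun n =>
      mul_nonneg (pow_nonneg hx0 n) (hy n).1), ← tsum_geometric_of_lt_one hx0 hx1]
    exact (summable_pow_mul_of_mem_Icc hx0 hx1 hy).tsum_le_tsum
      (fun n => mul_le_of_le_one_right (pow_nonneg hx0 n) (hy n).2)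
      (summable_geometric_of_lt_one hx0 hx1)

theorem setIntegral_discountedTransfer (hf : MeasurePreserving f μ μ) (hY : MeasurableSet Y)
    (hYf : μ Y ≠ ∞) (hY1 : μ Y = 1) {A : Set X} (hA : MeasurableSet A) {x : ℝ} (hx0 : 0 ≤ x)
    (hx1 : x < 1) :
    ∫ y in A, discountedTransfer hf hY hYf x y ∂μ =
      ∫ y, discountedVisits f A x y ∂(μ.restrict Y) := by
  set e := indicatorConstLp 1 hY hYf (1 : ℝ) with he
  have hprob : IsProbabilityMeasure (μ.restrict Y) := ⟨by simp [hY1]⟩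
  have hint : ∀ n : ℕ, Integrable (fun y => x ^ n * (realTransfer hf ^ n) e y) (μ.restrict A) :=
    fun n => ((integrable_lp _).const_mul _).integrableOn
  have hI : ∀ n : ℕ, ∫ y in A, x ^ n * (realTransfer hf ^ n) e y ∂μ =
      x ^ n * (μ.restrict Y).real (f^[n] ⁻¹' A) := by
    intro n
    have hm := (hf.measurable.iterate n) hA
    rw [integral_const_mul, setIntegral_realTransfer_pow hf e n hA, he,
      integral_congr_ae (ae_restrict_of_ae indicatorConstLp_coeFn), integral_indicator hY,
      Measure.restrict_restrict hY, measureReal_restrict_apply hm, Set.inter_comm]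
    simp
  have hsum : Summable fun n : ℕ => ∫ y in A, ‖x ^ n * (realTransfer hf ^ n) e y‖ ∂μ := by
    have : ∀ n : ℕ, ∫ y in A, ‖x ^ n * (realTransfer hf ^ n) e y‖ ∂μ =
        x ^ n * (μ.restrict Y).real (f^[n] ⁻¹' A) := by
      intro n
      rw [← hI n]
      refine integral_congr_ae (ae_restrict_of_ae ?_)
      filter_upwards [ae_realTransfer_pow_indicator_mem_Icc hf hY hYf] with y hy
      exact Real.norm_of_nonneg (mul_nonneg (pow_nonneg hx0 n) (hy n).1)
    simp_rw [this]
    exact summable_pow_mul_of_mem_Icc hx0 hx1 fun n => ⟨measureReal_nonneg, measureReal_le_one⟩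
  rw [integral_discountedVisits hf.measurable hA hx0 hx1, ← tsum_congr hI]
  exact (hasSum_integral_of_summable_integral_norm hint hsum).tsum_eq.symm

end Renewal

section FunctionSpace

variable {X : Type*} [MeasurableSpace X] {ν : Measure X}
  {B : Type*} [NormedAddCommGroup B] [NormedSpace ℂ B]

/-- Integration against a bounded function, as a functional on `L¹`. -/
noncomputable def pairingCLM {w : X → ℂ} (hw : MemLp w ∞ ν) : Lp ℂ 1 ν →L[ℂ] ℂ :=
  ((ContinuousLinearMap.mul ℂ ℂ).lpPairing ν 1 ∞).flip (hw.toLp w)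

theorem pairingCLM_apply {w : X → ℂ} (hw : MemLp w ∞ ν) (v : Lp ℂ 1 ν) :
    pairingCLM hw v = ∫ y, v y * w y ∂ν := by
  rw [pairingCLM, ContinuousLinearMap.flip_apply, ContinuousLinearMap.lpPairing_eq_integral]
  refine integral_congr_ae ?_
  filter_upwards [hw.coeFn_toLp] with y hy
  rw [hy, ContinuousLinearMap.mul_apply']

theorem IsFunctionSpace.ae_norm_le {ι : B →ₗ[ℂ] Lp ℂ 1 ν} (hι : IsFunctionSpace ν ι) (v : B) :
    ∀ᵐ y ∂ν, ‖ι v y‖ ≤ ‖v‖ := by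
  have h := hι.eLpNorm_top_le v
  rw [eLpNorm_exponent_top] at h
  filter_upwards [ae_le_eLpNormEssSup (f := ι v) (μ := ν)] with y hy
  have := hy.trans h
  rwa [← ofReal_norm, ENNReal.ofReal_le_ofReal_iff (norm_nonneg v)] at this

/-- The inclusion of a function space in `L¹`, as a continuous linear map. -/
noncomputable def IsFunctionSpace.toCLM [IsProbabilityMeasure ν] {ι : B →ₗ[ℂ] Lp ℂ 1 ν}
    (hι : IsFunctionSpace ν ι) : B →L[ℂ] Lp ℂ 1 ν :=
  ι.mkContinuous 1 fun v => by
    rw [one_mul, Lp.norm_def]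
    refine ENNReal.toReal_le_of_le_ofReal (norm_nonneg v) (le_trans ?_ (hι.eLpNorm_top_le v))
    exact eLpNorm_le_eLpNorm_of_exponent_le le_top (Lp.aestronglyMeasurable _)

theorem IsFunctionSpace.toCLM_apply [IsProbabilityMeasure ν] {ι : B →ₗ[ℂ] Lp ℂ 1 ν}
    (hι : IsFunctionSpace ν ι) (v : B) : hι.toCLM v = ι v := rfl

end FunctionSpace

section ReturnOperators

variable {X : Type*} [MeasurableSpace X] {μ : Measure X} {f : X → X} {Y : Set X}

theorem integral_returnTransfer_mul (hf : MeasurePreserving f μ μ) (hc : Conservative f μ)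
    (hY : MeasurableSet Y) (hY1 : μ Y = 1) (v : Lp ℂ 1 (μ.restrict Y)) {w : X → ℂ}
    (hw : MemLp w ∞ (μ.restrict Y)) :
    ∫ y, returnTransfer hf hc hY hY1 v y * w y ∂(μ.restrict Y) =
      ∫ y, v y * w (firstReturnMap f Y y) ∂(μ.restrict Y) := by
  have : IsFiniteMeasure (μ.restrict Y) := ⟨by simp [hY1]⟩
  exact integral_transferOperator_mul
    (measurePreserving_firstReturnMap hf hc hY (by simp [hY1])) v w hw

theorem eq_returnTransfer (hf : MeasurePreserving f μ μ) (hc : Conservative f μ)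
    (hY : MeasurableSet Y) (hY1 : μ Y = 1) (v u : Lp ℂ 1 (μ.restrict Y))
    (hu : ∀ w : X → ℂ, MemLp w ∞ (μ.restrict Y) → ∫ y, u y * w y ∂(μ.restrict Y) =
      ∫ y, v y * w (firstReturnMap f Y y) ∂(μ.restrict Y)) :
    u = returnTransfer hf hc hY hY1 v := by
  have : IsFiniteMeasure (μ.restrict Y) := ⟨by simp [hY1]⟩
  exact eq_transferOperator (measurePreserving_firstReturnMap hf hc hY (by simp [hY1])) v u hu

theorem integral_returnTransferAt_mul (hf : MeasurePreserving f μ μ) (hc : Conservative f μ)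
    (hY : MeasurableSet Y) (hY1 : μ Y = 1) (n : ℕ) (v : Lp ℂ 1 (μ.restrict Y)) {w : X → ℂ}
    (hw : MemLp w ∞ (μ.restrict Y)) :
    ∫ y, returnTransferAt hf hc hY hY1 n v y * w y ∂(μ.restrict Y) =
      ∫ y in firstReturnTime f Y ⁻¹' {n}, v y * w (firstReturnMap f Y y) ∂(μ.restrict Y) := by
  have hm := measurable_firstReturnTime hf.measurable hY (measurableSet_singleton n)
  rw [returnTransferAt, integral_returnTransfer_mul hf hc hY hY1 _ hw, ← integral_indicator hm]
  refine integral_congr_ae ?_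
  filter_upwards [((Lp.memLp v).indicator hm).coeFn_toLp] with y hy
  rw [hy]
  by_cases h : y ∈ firstReturnTime f Y ⁻¹' {n} <;> simp [h]

variable {B : Type*} [NormedAddCommGroup B] [NormedSpace ℂ B] {ι : B →ₗ[ℂ] Lp ℂ 1 (μ.restrict Y)}

theorem summable_measureReal_firstReturnTime_eq (hf : Measurable f) (hY : MeasurableSet Y)
    (ν : Measure X) [IsFiniteMeasure ν] :
    Summable fun n : ℕ => ν.real {y | firstReturnTime f Y y = n + 1} := by
  have hd : Pairwise (Function.onFun Disjoint fun n : ℕ => {y | firstReturnTime f Y y = n + 1}) := by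
    intro i j hij
    refine Set.disjoint_left.2 fun y hi hj => hij ?_
    simp only [Set.mem_ofPred_eq] at hi hj
    omega
  have h := measure_iUnion (μ := ν) hd fun n =>
    measurable_firstReturnTime hf hY (measurableSet_singleton (n + 1))
  exact ENNReal.summable_toReal (h ▸ measure_ne_top ν _)

theorem summable_pow_smul [CompleteSpace B] {A : ℕ → B →L[ℂ] B} {a : ℕ → ℝ} (ha : Summable a)
    (hA : ∀ n, ‖A n‖ ≤ a n) {x : ℝ} (hx0 : 0 ≤ x) (hx1 : x ≤ 1) :
    Summable fun n => (x : ℂ) ^ (n + 1) • A n := by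
  refine Summable.of_norm_bounded ha fun n => ?_
  rw [norm_smul, norm_pow, Complex.norm_of_nonneg hx0]
  exact (mul_le_of_le_one_left (norm_nonneg _) (pow_le_one₀ hx0 hx1)).trans (hA n)

theorem integrable_pow_mul {ν : Measure X} {φ : X → ℕ} (hφ : Measurable φ) {x : ℝ} (hx0 : 0 ≤ x)
    (hx1 : x ≤ 1) {g : X → ℂ} (hg : Integrable g ν) :
    Integrable (fun y => (x : ℂ) ^ φ y * g y) ν := by
  have hpm : Measurable fun y => (x : ℂ) ^ φ y :=
    (measurable_of_countable fun n : ℕ => (x : ℂ) ^ n).comp hφ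
  refine hg.bdd_mul (c := 1) hpm.aestronglyMeasurable (.of_forall fun y => ?_)
  rw [norm_pow, Complex.norm_of_nonneg hx0]
  exact pow_le_one₀ hx0 hx1

/-- Duality for the operator `∑ xⁿ R_n`. -/
theorem integral_tsum_pow_smul_mul [CompleteSpace B] (hf : MeasurePreserving f μ μ)
    (hc : Conservative f μ) (hY : MeasurableSet Y) (hY1 : μ Y = 1)
    (hι : IsFunctionSpace (μ.restrict Y) ι) {A : ℕ → B →L[ℂ] B}
    (hA : ∀ n v, ι (A n v) = returnTransferAt hf hc hY hY1 (n + 1) (ι v)) {x : ℝ} (hx0 : 0 ≤ x)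
    (hx1 : x ≤ 1) (hs : Summable fun n => (x : ℂ) ^ (n + 1) • A n) (v : B) {w : X → ℂ}
    (hw : MemLp w ∞ (μ.restrict Y)) :
    ∫ y, ι ((∑' n, (x : ℂ) ^ (n + 1) • A n) v) y * w y ∂(μ.restrict Y) =
      ∫ y, (x : ℂ) ^ firstReturnTime f Y y * (ι v y * w (firstReturnMap f Y y))
        ∂(μ.restrict Y) := by
  have : IsProbabilityMeasure (μ.restrict Y) := ⟨by simp [hY1]⟩
  have hF := measurePreserving_firstReturnMap hf hc hY (by simp [hY1])
  have hφ := measurable_firstReturnTime hf.measurable hY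
  have hint : Integrable (fun y => ι v y * w (firstReturnMap f Y y)) (μ.restrict Y) :=
    (L1.integrable_coeFn (ι v)).mul_of_top_left (hw.comp_measurePreserving hF)
  have hint' := integrable_pow_mul hφ hx0 hx1 hint
  have h1 : HasSum (fun n => (x : ℂ) ^ (n + 1) * ∫ y, ι (A n v) y * w y ∂(μ.restrict Y))
      (∫ y, ι ((∑' n, (x : ℂ) ^ (n + 1) • A n) v) y * w y ∂(μ.restrict Y)) := by
    have h := hs.hasSum.mapL
      ((pairingCLM hw).comp (hι.toCLM.comp (ContinuousLinearMap.apply ℂ B v)))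
    simpa only [ContinuousLinearMap.comp_apply, ContinuousLinearMap.apply_apply,
      smul_apply, map_smul, pairingCLM_apply, hι.toCLM_apply, smul_eq_mul]
      using h
  have hm : ∀ n : ℕ, MeasurableSet (firstReturnTime f Y ⁻¹' {n + 1}) := fun n =>
    hφ (measurableSet_singleton _)
  have h2 := hasSum_integral_iUnion hm (fun i j hij => Set.disjoint_left.2 fun y hi hj => hij (by
    simp only [Set.mem_preimage, Set.mem_singleton_iff] at hi hj
    omega)) hint'.integrableOn
  rw [Measure.restrict_eq_self_of_ae_mem (s := ⋃ n : ℕ, firstReturnTime f Y ⁻¹' {n + 1})] at h2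
  · refine h1.unique (h2.congr_fun fun n => ?_)
    rw [hA, integral_returnTransferAt_mul hf hc hY hY1 _ _ hw, ← integral_const_mul]
    refine setIntegral_congr_fun (hm n) fun y hy => ?_
    simp only [Set.mem_preimage, Set.mem_singleton_iff] at hy
    simp only [hy]
  · filter_upwards [ae_one_le_firstReturnTime hc hY] with y hy
    exact Set.mem_iUnion.2 ⟨firstReturnTime f Y y - 1, by
      simp only [Set.mem_preimage, Set.mem_singleton_iff]
      omega⟩

theorem tendsto_tsum_pow_smul [CompleteSpace B] {A : ℕ → B →L[ℂ] B} {a : ℕ → ℝ} (ha : Summable a)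
    (hA : ∀ n, ‖A n‖ ≤ a n) :
    Tendsto (fun x : ℝ => ∑' n, (x : ℂ) ^ (n + 1) • A n) (𝓝[<] 1) (𝓝 (∑' n, A n)) := by
  refine tendsto_tsum_of_dominated_convergence ha (fun n => ?_) ?_
  · have : ContinuousAt (fun x : ℝ => (x : ℂ) ^ (n + 1) • A n) 1 := by fun_prop
    simpa using this.tendsto.mono_left nhdsWithin_le_nhds
  · filter_upwards [Ioo_mem_nhdsLT zero_lt_one] with x hx n
    rw [norm_smul, norm_pow, Complex.norm_of_nonneg hx.1.le]
    exact (mul_le_of_le_one_left (norm_nonneg _) (pow_le_one₀ hx.1.le hx.2.le)).trans (hA n)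

/-- The generating function `∑ xⁿ Tⁿ 1_Y` is uniformly equivalent on `Y` to the inverse of the
expectation of `1 - x^φ`, as `x` increases to `1`. -/
theorem exists_abs_mul_discountedTransfer_sub_one_le [SigmaFinite μ] [CompleteSpace B]
    (hf : MeasurePreserving f μ μ) (hc : Conservative f μ) (hY : MeasurableSet Y) (hY1 : μ Y = 1)
    (hYf : μ Y ≠ ∞) (hι : IsFunctionSpace (μ.restrict Y) ι) (hH1 : HypothesisH1 hf hc hY hY1 ι)
    (hH2i : HypothesisH2i hf hc hY hY1 ι) :
    ∃ η : ℝ → ℝ, Tendsto η (𝓝[<] 1) (𝓝 0) ∧ ∀ᶠ x in 𝓝[<] (1 : ℝ), ∀ᵐ y ∂(μ.restrict Y),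
      |(∫ z, (1 - x ^ firstReturnTime f Y z) ∂(μ.restrict Y)) *
        discountedTransfer hf hY hYf x y - 1| ≤ η x := by
  have : IsProbabilityMeasure (μ.restrict Y) := ⟨by simp [hY1]⟩
  have hF : MeasurePreserving (firstReturnMap f Y) (μ.restrict Y) (μ.restrict Y) :=
    measurePreserving_firstReturnMap hf hc hY hYf
  have hφ := measurable_firstReturnTime hf.measurable hY
  obtain ⟨C, -, hA⟩ := hH1
  choose A hAι hAn using fun n : ℕ => hA (n + 1) (Nat.le_add_left 1 n)
  obtain ⟨R, hR, hRs⟩ := hH2i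
  have ha := (summable_measureReal_firstReturnTime_eq hf.measurable hY (μ.restrict Y)).mul_left C
  obtain ⟨e, he⟩ := hι.const_mem 1
  have h1 : MemLp (fun _ : X => (1 : ℂ)) ∞ (μ.restrict Y) := memLp_top_const 1
  set m : B →L[ℂ] ℂ := (pairingCLM h1).comp hι.toCLM with hm
  have hmv : ∀ v, m v = ∫ y, ι v y ∂(μ.restrict Y) := fun v => by
    rw [hm, ContinuousLinearMap.comp_apply, pairingCLM_apply, hι.toCLM_apply]
    simp
  have hmR : ∀ v, m (R v) = m v := fun v => by
    have h := integral_returnTransfer_mul hf hc hY hY1 (ι v) h1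
    simpa [hmv, hR] using h
  have hme : m e = 1 := by
    rw [hmv, integral_congr_ae he]
    simp
  have hRe : R e = e := by
    refine hι.injective ?_
    rw [hR]
    refine (eq_returnTransfer hf hc hY hY1 (ι e) (ι e) fun w hw => ?_).symm
    have e1 : ∫ y, ι e y * w y ∂(μ.restrict Y) = ∫ y, w y ∂(μ.restrict Y) :=
      integral_congr_ae (he.mono fun y hy => by simp only [hy, one_mul])
    have e2 : ∫ y, ι e y * w (firstReturnMap f Y y) ∂(μ.restrict Y) = ∫ y, w (firstReturnMap f Y y) ∂(μ.restrict Y) :=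
      integral_congr_ae (he.mono fun y hy => by simp only [hy, one_mul])
    have e3 := integral_map hF.measurable.aemeasurable (f := w)
      (by rw [hF.map_eq]; exact hw.aestronglyMeasurable)
    rw [hF.map_eq] at e3
    rw [e1, e2, e3]
  have hsA := fun {x : ℝ} (hx0 : 0 ≤ x) (hx1 : x ≤ 1) => summable_pow_smul ha hAn hx0 hx1
  have hAR : ∑' n, A n = R := by
    ext v
    refine hι.injective ?_
    rw [hR]
    refine eq_returnTransfer hf hc hY hY1 (ι v) _ fun w hw => ?_
    have h := integral_tsum_pow_smul_mul hf hc hY hY1 hι hAι zero_le_one le_rfl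
      (hsA zero_le_one le_rfl) v hw
    simpa using h
  have hlim := tendsto_tsum_pow_smul ha hAn
  rw [hAR] at hlim
  obtain ⟨w, hwe, hwA⟩ := exists_tendsto_perturbed_eigenvector hRs hRe hmR hme hlim
  have hδ : Tendsto (fun x => ‖w x - e‖) (𝓝[<] 1) (𝓝 0) :=
    tendsto_iff_norm_sub_tendsto_zero.1 hwe
  refine ⟨fun x => 4 * ‖w x - e‖, by simpa using hδ.const_mul 4, ?_⟩
  filter_upwards [hwA, Ioo_mem_nhdsLT zero_lt_one, hδ.eventually_le_const (half_pos one_pos)]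
    with x hx ⟨hx0, hx1⟩ hδx
  set κ := 1 - m (w x) with hκ
  set σ := ∫ z, (1 - x ^ firstReturnTime f Y z) ∂(μ.restrict Y) with hσ
  have hduality : ∀ g : X → ℂ, MemLp g ∞ (μ.restrict Y) →
      ∫ y, ι (w x) y * (g y - (x : ℂ) ^ firstReturnTime f Y y * g (firstReturnMap f Y y)) ∂(μ.restrict Y) =
        κ * ∫ y, g y ∂(μ.restrict Y) := by
    intro g hg
    have h := congrArg (fun u => pairingCLM hg (hι.toCLM u)) hx
    simp only [map_sub, map_smul, pairingCLM_apply, hι.toCLM_apply, smul_eq_mul] at h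
    have hi : Integrable (fun y => ι (w x) y * g y) (μ.restrict Y) :=
      (L1.integrable_coeFn _).mul_of_top_left hg
    have hi' : Integrable (fun y => ι (w x) y * g (firstReturnMap f Y y)) (μ.restrict Y) :=
      (L1.integrable_coeFn _).mul_of_top_left (hg.comp_measurePreserving hF)
    rw [integral_tsum_pow_smul_mul hf hc hY hY1 hι hAι hx0.le hx1.le (hsA hx0.le hx1.le) _ hg,
      ← integral_sub hi (integrable_pow_mul hφ hx0.le hx1.le hi')] at h
    have e1 : ∫ y, ι e y * g y ∂(μ.restrict Y) = ∫ y, g y ∂(μ.restrict Y) :=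
      integral_congr_ae (he.mono fun y hy => by simp only [hy, one_mul])
    rw [← e1, ← h]
    congr 1
    ext y
    ring
  have hwe' : ∀ᵐ y ∂(μ.restrict Y), ‖ι (w x) y - 1‖ ≤ ‖w x - e‖ := by
    filter_upwards [hι.ae_norm_le (w x - e), he, Lp.coeFn_sub (ι (w x)) (ι e)] with y h2 h3 h4
    rwa [map_sub, h4, Pi.sub_apply, h3] at h2
  have hpow : Integrable (fun z => 1 - x ^ firstReturnTime f Y z) (μ.restrict Y) := by
    refine (integrable_const 1).sub (Integrable.of_bound (C := 1) ?_ (.of_forall fun y => ?_))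
    · exact ((measurable_of_countable fun n : ℕ => x ^ n).comp hφ).aestronglyMeasurable
    · rw [Real.norm_of_nonneg (by positivity)]
      exact pow_le_one₀ hx0.le hx1.le
  have hκσ : ‖κ - σ‖ ≤ σ * ‖w x - e‖ := by
    have e1 := hduality _ h1
    rw [integral_const, probReal_univ, one_smul, mul_one] at e1
    have e2 : (σ : ℂ) = ∫ y, ((1 - x ^ firstReturnTime f Y y : ℝ) : ℂ) ∂(μ.restrict Y) :=
      integral_complex_ofReal.symm
    have hpow' : Integrable (fun y => ((1 - x ^ firstReturnTime f Y y : ℝ) : ℂ))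
        (μ.restrict Y) := hpow.ofReal
    have hi : Integrable (fun y => ι (w x) y * (1 - (x : ℂ) ^ firstReturnTime f Y y * 1))
        (μ.restrict Y) := by
      have := (L1.integrable_coeFn (ι (w x))).sub
        (integrable_pow_mul hφ hx0.le hx1.le (L1.integrable_coeFn (ι (w x))))
      refine this.congr (.of_forall fun y => ?_)
      simp only [Pi.sub_apply]
      ring
    rw [← e1, e2, ← integral_sub hi hpow', hσ, ← integral_mul_const]
    refine norm_integral_le_of_norm_le (hpow.mul_const _) ?_
    filter_upwards [hwe'] with y hy
    have hp : 0 ≤ 1 - x ^ firstReturnTime f Y y := sub_nonneg.2 (pow_le_one₀ hx0.le hx1.le)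
    have : ι (w x) y * (1 - (x : ℂ) ^ firstReturnTime f Y y * 1) -
        ((1 - x ^ firstReturnTime f Y y : ℝ) : ℂ) =
          ((1 - x ^ firstReturnTime f Y y : ℝ) : ℂ) * (ι (w x) y - 1) := by
      push_cast
      ring
    rw [this, norm_mul, Complex.norm_of_nonneg hp]
    exact mul_le_mul_of_nonneg_left hy hp
  have hσ0 : 0 < σ := by
    have h2 : ∫ _, (1 - x) ∂(μ.restrict Y) ≤ σ := by
      refine integral_mono_ae (integrable_const _) hpow ?_
      filter_upwards [ae_one_le_firstReturnTime hc hY] with y hy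
      exact sub_le_sub_left (pow_le_of_le_one hx0.le hx1.le (Nat.one_le_iff_ne_zero.1 hy)) 1
    rw [integral_const, probReal_univ, one_smul] at h2
    linarith
  have hrenewal : ι (w x) =ᵐ[μ.restrict Y] fun y => κ * (discountedTransfer hf hY hYf x y : ℂ) := by
    have hDi : Integrable (discountedTransfer hf hY hYf x) (μ.restrict Y) :=
      integrableOn_discountedTransfer hf hY hYf hx0.le hx1
    refine Integrable.ae_eq_of_forall_setIntegral_eq _ _ (L1.integrable_coeFn _)
      (hDi.ofReal.const_mul κ) fun s hs _ => ?_
    have hA := hs.inter hY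
    have h2 := hduality (fun y => (discountedVisits f (s ∩ Y) x y : ℂ))
      (memLp_top_discountedVisits hf.measurable hA hx0.le hx1 _).ofReal
    have e1 : ∫ y, (discountedVisits f (s ∩ Y) x y : ℂ) ∂(μ.restrict Y) =
        ∫ y in s, (discountedTransfer hf hY hYf x y : ℂ) ∂(μ.restrict Y) := by
      rw [integral_complex_ofReal, integral_complex_ofReal, Measure.restrict_restrict hs,
        setIntegral_discountedTransfer hf hY hYf hY1 hA hx0.le hx1]
    rw [integral_const_mul, ← e1, ← h2, ← integral_indicator hs]
    refine integral_congr_ae ?_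
    filter_upwards [ae_one_le_firstReturnTime hc hY, ae_restrict_mem hY] with y hy hyY
    have h3 := discountedVisits_eq (f := f) (Set.inter_subset_right (s := s)) hx0.le hx1 hy
    have h4 : (discountedVisits f (s ∩ Y) x y : ℂ) - (x : ℂ) ^ firstReturnTime f Y y *
        (discountedVisits f (s ∩ Y) x (firstReturnMap f Y y) : ℂ) =
          (((s ∩ Y).indicator (fun _ => (1 : ℝ)) y : ℝ) : ℂ) := by
      rw [h3]
      push_cast
      ring
    rw [h4]
    by_cases h : y ∈ s <;> simp [h, hyY]
  filter_upwards [hrenewal, hwe'] with y hy hle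
  set D := discountedTransfer hf hY hYf x y
  have e1 : κ * ((σ * D - 1 : ℝ) : ℂ) = σ * (ι (w x) y - 1) - (κ - σ) := by
    rw [hy]
    push_cast
    ring
  have e2 : ‖κ‖ * |σ * D - 1| ≤ 2 * (σ * ‖w x - e‖) := by
    rw [← Real.norm_eq_abs, ← Complex.norm_real, ← norm_mul, e1, two_mul]
    refine (norm_sub_le _ _).trans (add_le_add ?_ hκσ)
    rw [norm_mul, Complex.norm_of_nonneg hσ0.le]
    exact mul_le_mul_of_nonneg_left hle hσ0.le
  have e3 : σ / 2 ≤ ‖κ‖ := by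
    have h2 := norm_sub_norm_le (σ : ℂ) κ
    rw [norm_sub_rev (σ : ℂ) κ, Complex.norm_of_nonneg hσ0.le] at h2
    nlinarith
  have e4 := (mul_le_mul_of_nonneg_right e3 (abs_nonneg (σ * D - 1))).trans e2
  exact le_of_mul_le_mul_left (by linarith) (half_pos hσ0)

end ReturnOperators

section TailAsymptotics

variable {q : ℕ → ℝ} {β : ℝ}

theorem SlowlyVarying.pos {ℓ : ℝ → ℝ} (hℓ : SlowlyVarying ℓ) {x : ℝ} (hx : 0 < x) : 0 < ℓ x := by
  obtain ⟨c, _, hc, h⟩ := hℓ.bounds {x} isCompact_singleton (Set.singleton_subset_iff.2 hx)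
  exact hc.trans_le (h x rfl).1

theorem SlowlyVarying.tendsto_tail_ratio {ℓ : ℝ → ℝ} (hℓ : SlowlyVarying ℓ)
    (hq : ∀ n : ℕ, 1 ≤ n → q n = ℓ n * (n : ℝ) ^ (-β)) {k : ℕ} (hk : 1 ≤ k) :
    Tendsto (fun n => q (k * n) / q n) atTop (𝓝 ((k : ℝ) ^ (-β))) := by
  have h := ((hℓ.tendsto k (by positivity)).comp tendsto_natCast_atTop_atTop).mul_const
    ((k : ℝ) ^ (-β))
  rw [one_mul] at h
  refine h.congr' ?_
  filter_upwards [eventually_ge_atTop 1] with n hn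
  have hn0 : (0 : ℝ) < n := by positivity
  have hnβ : (n : ℝ) ^ (-β) ≠ 0 := (Real.rpow_pos_of_pos hn0 _).ne'
  rw [hq n hn, hq (k * n) (Nat.mul_pos hk hn), Nat.cast_mul,
    Real.mul_rpow (by positivity) hn0.le, Function.comp_apply]
  have := (hℓ.pos hn0).ne'
  field_simp

theorem tendsto_zero_of_regularVariation (hq : Antitone q) (hpos : ∀ n, 0 < q n)
    (hrv : ∀ k : ℕ, 1 ≤ k → Tendsto (fun n => q (k * n) / q n) atTop (𝓝 ((k : ℝ) ^ (-β))))
    (hβ0 : 0 < β) : Tendsto q atTop (𝓝 0) := by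
  have hL := tendsto_atTop_ciInf hq ⟨0, by rintro _ ⟨n, rfl⟩; exact (hpos n).le⟩
  by_cases h0 : ⨅ n, q n = 0
  · rwa [h0] at hL
  · have h2 : Tendsto (fun n : ℕ => 2 * n) atTop atTop :=
      tendsto_id.const_mul_atTop' two_pos
    have h := (hL.comp h2).div hL h0
    rw [div_self h0] at h
    have h1 := tendsto_nhds_unique h (hrv 2 one_le_two)
    have h3 : (2 : ℝ) ^ (-β) < 1 := Real.rpow_lt_one_of_one_lt_of_neg one_lt_two (by linarith)
    norm_num at h1
    linarith

theorem tendsto_mul_one_sub_exp (k : ℕ) :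
    Tendsto (fun N : ℕ => (N : ℝ) * (1 - Real.exp (-((k : ℝ) / N)))) atTop (𝓝 k) := by
  have hd : HasDerivAt (fun t : ℝ => 1 - Real.exp (-(k * t))) k 0 := by
    have h := (((hasDerivAt_id (0 : ℝ)).const_mul (k : ℝ)).neg.exp).const_sub 1
    simpa using h
  have h := hd.tendsto_slope_zero_right.comp
    (tendsto_inv_atTop_nhdsGT_zero.comp (tendsto_natCast_atTop_atTop (R := ℝ)))
  refine h.congr fun N => ?_
  simp [div_eq_mul_inv]

/-- The mean of the tail, normalized so as to be asymptotic to the expectation of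
`1 - exp(-φ/N)`. -/
noncomputable def tailMean (q : ℕ → ℝ) (β : ℝ) (N : ℕ) : ℝ :=
  Real.Gamma (2 - β) * (∑ n ∈ Finset.range N, q n) / N

variable (hq : Antitone q) (hpos : ∀ n, 0 < q n)
  (hrv : ∀ k : ℕ, 1 ≤ k → Tendsto (fun n => q (k * n) / q n) atTop (𝓝 ((k : ℝ) ^ (-β))))
  (hβ0 : 0 < β) (hβ : β ≤ 1)
include hpos hβ

theorem tailMean_nonneg (N : ℕ) : 0 ≤ tailMean q β N :=
  div_nonneg (mul_nonneg (Real.Gamma_pos_of_pos (by linarith)).le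
    (Finset.sum_nonneg fun n _ => (hpos n).le)) (Nat.cast_nonneg N)

theorem tailMean_pos {N : ℕ} (hN : 1 ≤ N) : 0 < tailMean q β N :=
  div_pos (mul_pos (Real.Gamma_pos_of_pos (by linarith)) (sum_range_pos_of_pos hpos hN))
    (by positivity)

include hq

theorem tendsto_tailMean_succ_ratio :
    Tendsto (fun N => tailMean q β (N + 1) / tailMean q β N) atTop (𝓝 1) := by
  have hΓ := (Real.Gamma_pos_of_pos (show 0 < 2 - β by linarith)).ne'
  have h1 := (tendsto_sum_range_succ_ratio hq hpos).mul (tendsto_natCast_div_add_atTop (1 : ℝ))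
  rw [mul_one] at h1
  refine h1.congr' ?_
  filter_upwards [eventually_ge_atTop 1] with N hN
  have hQ := (sum_range_pos_of_pos hpos hN).ne'
  have hN0 : (N : ℝ) ≠ 0 := by positivity
  have hN1 : (N : ℝ) + 1 ≠ 0 := by positivity
  rw [tailMean, tailMean]
  push_cast
  field_simp

include hrv hβ0

omit hβ in
theorem tendsto_tailMean_zero : Tendsto (tailMean q β) atTop (𝓝 0) := by
  have h := ((tendsto_zero_of_regularVariation hq hpos hrv hβ0).cesaro).const_mul
    (Real.Gamma (2 - β))
  rw [mul_zero] at h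
  refine h.congr fun N => ?_
  rw [tailMean]
  ring

theorem tendsto_tailMean_div {k : ℕ} (hk : 1 ≤ k) :
    Tendsto (fun N : ℕ => tailMean q β N / ((1 - Real.exp (-((k : ℝ) / N))) *
      ∑' n, q n * Real.exp (-((k : ℝ) / N * n)))) atTop (𝓝 ((k : ℝ) ^ (-β))) := by
  have hk0 : (0 : ℝ) < k := by positivity
  have hΓ := Real.Gamma_pos_of_pos (show 0 < 2 - β by linarith)
  have h1 := (tendsto_mul_one_sub_exp k).mul
    (tendsto_tsum_mul_exp_neg_div_sum hq hpos hrv hβ0 hβ hk)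
  have h2 := (tendsto_const_nhds (x := Real.Gamma (2 - β))).div h1
    (mul_pos hk0 (mul_pos (Real.rpow_pos_of_pos hk0 _) hΓ)).ne'
  have e : Real.Gamma (2 - β) / (k * ((k : ℝ) ^ (β - 1) * Real.Gamma (2 - β))) =
      (k : ℝ) ^ (-β) := by
    rw [Real.rpow_sub_one hk0.ne', Real.rpow_neg hk0.le]
    have := (Real.rpow_pos_of_pos hk0 β).ne'
    field_simp
  rw [e] at h2
  refine h2.congr' ?_
  filter_upwards [eventually_ge_atTop 1] with N hN
  have hQ := (sum_range_pos_of_pos hpos hN).ne'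
  have hN0 : (N : ℝ) ≠ 0 := by positivity
  simp only [Pi.div_apply]
  rw [tailMean]
  generalize (1 - Real.exp (-((k : ℝ) / N))) = a
  generalize (∑' n : ℕ, q n * Real.exp (-((k : ℝ) / N * n))) = b
  by_cases ha : a = 0
  · simp [ha]
  by_cases hb : b = 0
  · simp [hb]
  field_simp

theorem tendsto_normalizer_div_tailMean {ℓ : ℝ → ℝ}
    (hqℓ : ∀ n : ℕ, 1 ≤ n → q n = ℓ n * (n : ℝ) ^ (-β))
    (hdiv : β = 1 → Tendsto (fun n : ℕ => ∑ j ∈ Finset.Icc 1 n, ℓ j / j) atTop atTop) :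
    Tendsto (fun n : ℕ => normalizer ℓ β n * (n : ℝ) ^ (-β) / tailMean q β n) atTop
      (𝓝 (β⁻¹ * dConst β * Real.Gamma (1 + β))) := by
  by_cases h1 : β = 1
  · subst h1
    have hS : ∀ n : ℕ, ∑ j ∈ Finset.Icc 1 n, ℓ j / j =
        ∑ j ∈ Finset.range (n + 1), q j - q 0 := by
      intro n
      rw [Finset.sum_range_succ', add_sub_cancel_right, Finset.range_eq_Ico,
        Finset.sum_Ico_add' (fun j => q j) 0 n 1]
      refine Finset.sum_congr (by ext; simp) fun j hj => ?_
      rw [hqℓ j (Finset.mem_Icc.1 hj).1, Real.rpow_neg_one, div_eq_mul_inv]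
    have hQ : Tendsto (fun n => ∑ j ∈ Finset.range n, q j) atTop atTop := by
      rw [← tendsto_add_atTop_iff_nat 1]
      refine (tendsto_atTop_add_const_right _ (q 0) (hdiv rfl)).congr fun n => ?_
      rw [hS, sub_add_cancel]
    have hlim := (tendsto_sum_range_succ_ratio hq hpos).sub
      ((tendsto_const_nhds (x := q 0)).div_atTop hQ)
    have e : (1 : ℝ)⁻¹ * dConst 1 * Real.Gamma (1 + 1) = 1 - 0 := by
      simp [dConst, one_add_one_eq_two]
    rw [e]
    refine hlim.congr' ?_
    filter_upwards [eventually_ge_atTop 1] with n hn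
    have hQn := (sum_range_pos_of_pos hpos hn).ne'
    have hn0 : (n : ℝ) ≠ 0 := by positivity
    have hΓ : Real.Gamma (2 - 1) = 1 := by norm_num
    rw [normalizer, if_pos rfl, hS, tailMean, Real.rpow_neg_one, hΓ]
    field_simp
  · have hβ1 : β < 1 := lt_of_le_of_ne hβ h1
    have hlim := (tendsto_mul_div_sum hq hpos hrv hβ0 hβ).div_const (Real.Gamma (2 - β))
    have e : (1 - β) / Real.Gamma (2 - β) = β⁻¹ * dConst β * Real.Gamma (1 + β) := by
      have g1 : Real.Gamma (2 - β) = (1 - β) * Real.Gamma (1 - β) := by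
        rw [← Real.Gamma_add_one (by linarith)]
        ring_nf
      have g2 : Real.Gamma (1 + β) = β * Real.Gamma β := by
        rw [add_comm, Real.Gamma_add_one hβ0.ne']
      have g3 := Real.Gamma_mul_Gamma_one_sub β
      have hs : 0 < Real.sin (Real.pi * β) :=
        Real.sin_pos_of_pos_of_lt_pi (by positivity) (by nlinarith [Real.pi_pos])
      have hΓ := Real.Gamma_pos_of_pos (show 0 < 1 - β by linarith)
      have hb : 1 - β ≠ 0 := by linarith
      rw [eq_div_iff hs.ne'] at g3
      rw [mul_comm Real.pi β] at g3
      rw [g1, g2, dConst, if_neg h1]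
      have hπ := Real.pi_ne_zero
      field_simp
      linarith
    rw [← e]
    refine hlim.congr' ?_
    filter_upwards [eventually_ge_atTop 1] with n hn
    have hQn := (sum_range_pos_of_pos hpos hn).ne'
    have hn0 : (n : ℝ) ≠ 0 := by positivity
    have hΓ := (Real.Gamma_pos_of_pos (show 0 < 2 - β by linarith)).ne'
    rw [normalizer, if_neg h1, tailMean, ← hqℓ n hn]
    field_simp

end TailAsymptotics

section Induced

variable {X : Type*} [MeasurableSpace X] {μ : Measure X} {f : X → X} {Y : Set X} [SigmaFinite μ]
  {q : ℕ → ℝ} {β : ℝ}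

/-- Partial sums of the `Tⁿ 1_Y` are controlled by the generating function. -/
theorem ae_transferSum_le_discountedTransfer (hf : MeasurePreserving f μ μ) (hY : MeasurableSet Y)
    (hYf : μ Y ≠ ∞) {N : ℕ} (hN : 1 ≤ N) :
    ∀ᵐ y ∂μ, transferSum hf N (indicatorConstLp 1 hY hYf (1 : ℝ)) y ≤
      Real.exp 1 * discountedTransfer hf hY hYf (Real.exp (-(1 / N))) y := by
  have hN0 : (0 : ℝ) < N := by positivity
  have hx1 : Real.exp (-(1 / (N : ℝ))) < 1 := Real.exp_lt_one_iff.2 (neg_lt_zero.2 (by positivity))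
  filter_upwards [coeFn_transferSum hf (indicatorConstLp 1 hY hYf (1 : ℝ)),
    ae_realTransfer_pow_indicator_mem_Icc hf hY hYf] with y hy h01
  have hs := summable_pow_mul_of_mem_Icc (Real.exp_pos _).le hx1 h01
  have hle := hs.sum_le_tsum (Finset.range N) fun n _ =>
    mul_nonneg (pow_nonneg (Real.exp_pos _).le n) (h01 n).1
  rw [hy N, discountedTransfer]
  refine le_trans ?_ (mul_le_mul_of_nonneg_left hle (Real.exp_pos 1).le)
  rw [Finset.mul_sum]
  refine Finset.sum_le_sum fun n hn => ?_
  rw [← mul_assoc]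
  refine le_mul_of_one_le_left (h01 n).1 ?_
  rw [← Real.exp_nat_mul, ← Real.exp_add]
  refine Real.one_le_exp ?_
  have hn' : (n : ℝ) ≤ N := by exact_mod_cast (Finset.mem_range.1 hn).le
  have : (n : ℝ) * (1 / N) ≤ 1 := by
    rw [mul_one_div]
    exact div_le_one_of_le₀ hn' hN0.le
  linarith

theorem ae_transferSum_indicator_le (hf : MeasurePreserving f μ μ) (hY : MeasurableSet Y)
    (hYf : μ Y ≠ ∞) (N : ℕ) :
    ∀ᵐ y ∂μ, transferSum hf N (indicatorConstLp 1 hY hYf (1 : ℝ)) y ≤ N := by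
  filter_upwards [coeFn_transferSum hf (indicatorConstLp 1 hY hYf (1 : ℝ)),
    ae_realTransfer_pow_indicator_mem_Icc hf hY hYf] with y hy h01
  rw [hy N]
  refine (Finset.sum_le_sum fun n _ => (h01 n).2).trans ?_
  simp

theorem tendsto_exp_neg_div_nhdsLT_one {k : ℕ} (hk : 1 ≤ k) :
    Tendsto (fun N : ℕ => Real.exp (-((k : ℝ) / N))) atTop (𝓝[<] 1) := by
  refine tendsto_nhdsWithin_iff.2 ⟨?_, ?_⟩
  · have h := (tendsto_const_div_atTop_nhds_zero_nat (k : ℝ)).neg.rexp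
    simpa using h
  · filter_upwards [eventually_ge_atTop 1] with N hN
    refine Real.exp_lt_one_iff.2 (neg_lt_zero.2 ?_)
    positivity

/-- Asymptotics of the partial sums of the `Tⁿ 1_Y`. -/
theorem ae_tendsto_tailMean_mul_transferSum (hf : MeasurePreserving f μ μ)
    (hc : Conservative f μ) (herg : Ergodic f μ) (hY : MeasurableSet Y) (hY1 : μ Y = 1)
    (hYf : μ Y ≠ ∞) {B : Type*} [NormedAddCommGroup B] [NormedSpace ℂ B] [CompleteSpace B]
    {ι : B →ₗ[ℂ] Lp ℂ 1 (μ.restrict Y)} (hι : IsFunctionSpace (μ.restrict Y) ι)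
    (hH1 : HypothesisH1 hf hc hY hY1 ι) (hH2i : HypothesisH2i hf hc hY hY1 ι)
    (hqφ : ∀ n, q n = (μ.restrict Y).real {y | n < firstReturnTime f Y y}) (hpos : ∀ n, 0 < q n)
    (hrv : ∀ k : ℕ, 1 ≤ k → Tendsto (fun n => q (k * n) / q n) atTop (𝓝 ((k : ℝ) ^ (-β))))
    (hβ0 : 0 < β) (hβ : β ≤ 1) :
    ∀ᵐ x ∂μ, Tendsto (fun n => tailMean q β n *
      transferSum hf n (indicatorConstLp 1 hY hYf (1 : ℝ)) x) atTop
        (𝓝 (Real.Gamma (1 + β))⁻¹) := by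
  have hprob : IsProbabilityMeasure (μ.restrict Y) := ⟨by simp [hY1]⟩
  have hφ := measurable_firstReturnTime hf.measurable hY
  have hq : Antitone q := fun i j hij => by
    rw [hqφ, hqφ]
    exact measureReal_mono fun y hy => lt_of_le_of_lt hij hy
  obtain ⟨η, hη, hD⟩ := exists_abs_mul_discountedTransfer_sub_one_le hf hc hY hY1 hYf hι hH1 hH2i
  set σ : ℕ → ℕ → ℝ := fun k N => (1 - Real.exp (-((k : ℝ) / N))) *
    ∑' n, q n * Real.exp (-((k : ℝ) / N * n)) with hσ
  set D : ℕ → ℕ → X → ℝ := fun k N =>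
    discountedTransfer hf hY hYf (Real.exp (-((k : ℝ) / N))) with hDdef
  have hDσ : ∀ k : ℕ, 1 ≤ k → ∀ᶠ N : ℕ in atTop, ∀ᵐ y ∂(μ.restrict Y),
      |σ k N * D k N y - 1| ≤ η (Real.exp (-((k : ℝ) / N))) := by
    intro k hk
    filter_upwards [(tendsto_exp_neg_div_nhdsLT_one hk).eventually hD, eventually_ge_atTop 1]
      with N hN hN1
    have hx1 : Real.exp (-((k : ℝ) / N)) < 1 :=
      Real.exp_lt_one_iff.2 (neg_lt_zero.2 (by positivity))
    rw [integral_one_sub_pow_eq _ hφ (Real.exp_pos _).le hx1] at hN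
    have e : ∀ n : ℕ, Real.exp (-((k : ℝ) / N)) ^ n *
        (μ.restrict Y).real {y | n < firstReturnTime f Y y} =
          q n * Real.exp (-((k : ℝ) / N * n)) := by
      intro n
      rw [← hqφ, ← Real.exp_nat_mul, mul_comm]
      congr 2
      ring
    simp_rw [e] at hN
    exact hN
  have hcσ := fun {k : ℕ} (hk : 1 ≤ k) => tendsto_tailMean_div hq hpos hrv hβ0 hβ hk
  have hσ0 : ∀ k N : ℕ, 1 ≤ k → 1 ≤ N → 0 < σ k N := by
    intro k N hk hN
    have hs : (0 : ℝ) < (k : ℝ) / N := by positivity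
    refine mul_pos (sub_pos.2 (Real.exp_lt_one_iff.2 (neg_lt_zero.2 hs))) ?_
    exact (summable_mul_exp_neg hq hpos hs).tsum_pos
      (fun n => mul_nonneg (hpos n).le (Real.exp_pos _).le) 0 (mul_pos (hpos 0) (Real.exp_pos _))
  have hlimY : ∀ᵐ y ∂(μ.restrict Y), Tendsto (fun n => tailMean q β n *
      transferSum hf n (indicatorConstLp 1 hY hYf (1 : ℝ)) y) atTop
        (𝓝 (Real.Gamma (1 + β))⁻¹) := by
    have hall : ∀ᵐ y ∂(μ.restrict Y), ∀ k : ℕ, 1 ≤ k → ∀ᶠ N : ℕ in atTop,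
        |σ k N * D k N y - 1| ≤ η (Real.exp (-((k : ℝ) / N))) := by
      refine ae_all_iff.2 fun k => ?_
      by_cases hk : 1 ≤ k
      · obtain ⟨N₀, hN₀⟩ := eventually_atTop.1 (hDσ k hk)
        have : ∀ᵐ y ∂(μ.restrict Y), ∀ N, N₀ ≤ N →
            |σ k N * D k N y - 1| ≤ η (Real.exp (-((k : ℝ) / N))) := by
          refine ae_all_iff.2 fun N => ?_
          by_cases hN : N₀ ≤ N
          · filter_upwards [hN₀ N hN] with y hy _ using hy
          · exact .of_forall fun y h => absurd h hN
        filter_upwards [this] with y hy _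
        exact eventually_atTop.2 ⟨N₀, hy⟩
      · exact .of_forall fun y h => absurd h hk
    filter_upwards [hall, ae_restrict_of_ae (ae_realTransfer_pow_indicator_mem_Icc hf hY hYf),
      ae_restrict_of_ae (coeFn_transferSum hf (indicatorConstLp 1 hY hYf (1 : ℝ)))]
      with y hy h01 hS
    have e : ∀ (s : ℝ) (n : ℕ), (realTransfer hf ^ n) (indicatorConstLp 1 hY hYf (1 : ℝ)) y *
        Real.exp (-(s * n)) =
          Real.exp (-s) ^ n * (realTransfer hf ^ n) (indicatorConstLp 1 hY hYf (1 : ℝ)) y := by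
      intro s n
      rw [← Real.exp_nat_mul, mul_comm]
      congr 2
      ring
    have hK := tendsto_karamata (c := tailMean q β) (β := β)
      (u := fun n => (realTransfer hf ^ n) (indicatorConstLp 1 hY hYf (1 : ℝ)) y)
      (fun n => (h01 n).1) (fun s hs => ?_) (tailMean_nonneg hpos hβ) hβ0 fun k hk => ?_
    · simpa only [hS] using hK
    · simp_rw [e]
      exact summable_pow_mul_of_mem_Icc (Real.exp_pos _).le
        (Real.exp_lt_one_iff.2 (neg_lt_zero.2 hs)) h01
    · simp_rw [e]
      have h1 : Tendsto (fun N => σ k N * D k N y) atTop (𝓝 1) := by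
        rw [tendsto_iff_norm_sub_tendsto_zero]
        exact squeeze_zero' (.of_forall fun N => norm_nonneg _) (hy k hk)
          (hη.comp (tendsto_exp_neg_div_nhdsLT_one hk))
      have h2 := (hcσ hk).mul h1
      rw [mul_one] at h2
      refine h2.congr' ?_
      filter_upwards [eventually_ge_atTop 1] with N hN
      rw [← mul_assoc, div_mul_cancel₀ _ (hσ0 k N hk hN).ne']
      rfl
  have hev : ∀ᶠ N : ℕ in atTop, ∀ᵐ y ∂(μ.restrict Y), tailMean q β N *
      transferSum hf N (indicatorConstLp 1 hY hYf (1 : ℝ)) y ≤ Real.exp 1 * 4 := by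
    have h1 := (hcσ le_rfl).eventually_le_const (show ((1 : ℕ) : ℝ) ^ (-β) < 2 by norm_num)
    have h2 := (hη.comp (tendsto_exp_neg_div_nhdsLT_one le_rfl)).eventually_le_const
      (zero_lt_one' ℝ)
    filter_upwards [h1, h2, hDσ 1 le_rfl, eventually_ge_atTop 1] with N h1 h2 h3 hN
    filter_upwards [h3, ae_restrict_of_ae (ae_transferSum_le_discountedTransfer hf hY hYf hN)]
      with y h3 h4
    have h5 : σ 1 N * D 1 N y ≤ 2 := by
      have := (abs_le.1 (h3.trans h2)).2
      linarith
    have h6 : tailMean q β N * D 1 N y ≤ 4 := by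
      have h7 := (div_le_iff₀ (hσ0 1 N le_rfl hN)).1 h1
      have hD0 : 0 ≤ D 1 N y ∨ D 1 N y < 0 := le_or_gt 0 _
      rcases hD0 with hD0 | hD0
      · have := mul_le_mul_of_nonneg_right h7 hD0
        nlinarith
      · have := mul_nonneg (tailMean_nonneg hpos hβ N) (neg_pos.2 hD0).le
        linarith
    have h8 := mul_le_mul_of_nonneg_left h4 (tailMean_nonneg hpos hβ N)
    refine h8.trans ?_
    rw [mul_left_comm]
    refine mul_le_mul_of_nonneg_left ?_ (Real.exp_pos 1).le
    simpa [hDdef] using h6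
  obtain ⟨N₀, hN₀⟩ := eventually_atTop.1 hev
  have hsum0 : ∀ n, 0 ≤ tailMean q β n * n := fun n =>
    mul_nonneg (tailMean_nonneg hpos hβ n) (Nat.cast_nonneg n)
  refine ae_tendsto_transferSum_of_restrict hf hc herg hY (by simp [hY1]) hYf
    (tailMean_nonneg hpos hβ) ?_ (tendsto_tailMean_zero hq hpos hrv hβ0)
    (tendsto_tailMean_succ_ratio hq hpos hβ)
    (K := Real.exp 1 * 4 + ∑ n ∈ Finset.range N₀, tailMean q β n * n) ?_ (fun n => ?_) hlimY
  · filter_upwards [eventually_ge_atTop 1] with N hN using tailMean_pos hpos hβ hN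
  · exact add_nonneg (by positivity) (Finset.sum_nonneg fun n _ => hsum0 n)
  · rcases le_or_gt N₀ n with h | h
    · filter_upwards [hN₀ n h] with y hy
      exact hy.trans (le_add_of_nonneg_right (Finset.sum_nonneg fun n _ => hsum0 n))
    · filter_upwards [ae_restrict_of_ae (ae_transferSum_indicator_le hf hY hYf n)] with y hy
      refine (mul_le_mul_of_nonneg_left hy (tailMean_nonneg hpos hβ n)).trans ?_
      refine le_trans ?_ (le_add_of_nonneg_left (by positivity))
      exact Finset.single_le_sum (f := fun n : ℕ => tailMean q β n * n)
        (fun n _ => hsum0 n) (Finset.mem_range.2 h)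

end Induced

section PointwiseDualErgodicity

variable {X : Type*} [MeasurableSpace X] {μ : Measure X} {f : X → X} [SigmaFinite μ]

theorem coeFn_transferSum_realTransfer (hf : MeasurePreserving f μ μ) (u : Lp ℝ 1 μ) :
    ∀ᵐ x ∂μ, ∀ n, transferSum hf n (realTransfer hf u) x =
      ∑ j ∈ Finset.Icc 1 n, (realTransfer hf ^ j) u x := by
  filter_upwards [coeFn_transferSum hf (realTransfer hf u)] with x hx n
  rw [hx n, Finset.range_eq_Ico]
  have h := Finset.sum_Ico_add' (fun j => (realTransfer hf ^ j) u x) 0 n 1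
  rw [zero_add, Finset.Ico_add_one_right_eq_Icc] at h
  rw [← h]
  refine Finset.sum_congr rfl fun j _ => ?_
  rw [pow_succ, mul_apply_eq_comp]

/-- Convergence for real functions, given the asymptotics for one function of integral one. -/
theorem ae_tendsto_mul_sum_realTransfer (hf : MeasurePreserving f μ μ) (hc : Conservative f μ)
    (herg : Ergodic f μ) {w : Lp ℝ 1 μ} (hw : ∫ x, w x ∂μ = 1) {a c : ℕ → ℝ} {L M : ℝ}
    (hM : M ≠ 0) (hac : Tendsto (fun n => a n / c n) atTop (𝓝 L))
    (hcw : ∀ᵐ x ∂μ, Tendsto (fun n => c n * transferSum hf n w x) atTop (𝓝 M)) (u : Lp ℝ 1 μ) :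
    ∀ᵐ x ∂μ, Tendsto (fun n => a n * ∑ j ∈ Finset.Icc 1 n, (realTransfer hf ^ j) u x) atTop
      (𝓝 (L * M * ∫ x, u x ∂μ)) := by
  filter_upwards [hcw, ae_tendsto_transferSum_div hf hc herg (realTransfer hf u) w hw,
    coeFn_transferSum_realTransfer hf u] with x h1 h2 h3
  rw [integral_realTransfer] at h2
  refine ((hac.mul h1).mul h2).congr' ?_
  filter_upwards [h1.eventually_ne hM] with n hn
  have hc0 := left_ne_zero_of_mul hn
  have hw0 := right_ne_zero_of_mul hn
  rw [h3 n]
  field_simp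

end PointwiseDualErgodicity

theorem pointwise_dual_ergodicity
    {X : Type*} [MeasurableSpace X] (μX : Measure X) [SigmaFinite μX]
    (f : X → X) (hf : MeasurePreserving f μX μX) (hcons : Conservative f μX)
    (herg : Ergodic f μX)
    (Y : Set X) (hY : MeasurableSet Y) (hY1 : μX Y = 1)
    (ℓ : ℝ → ℝ) (hℓ : SlowlyVarying ℓ) (β : ℝ) (hβ0 : 0 < β) (hβ1 : β ≤ 1)
    (htail : ∀ n : ℕ, 1 ≤ n →
      (μX.restrict Y).real {y | n < firstReturnTime f Y y} = ℓ n * (n : ℝ) ^ (-β))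
    (hdiv : β = 1 → Tendsto (fun n : ℕ => ∑ j ∈ Finset.Icc 1 n, ℓ j / j) atTop atTop)
    {B : Type*} [NormedAddCommGroup B] [NormedSpace ℂ B] [CompleteSpace B]
    (ι : B →ₗ[ℂ] Lp ℂ 1 (μX.restrict Y)) (hι : IsFunctionSpace (μX.restrict Y) ι)
    (hH1 : HypothesisH1 hf hcons hY hY1 ι)
    (hH2i : HypothesisH2i hf hcons hY hY1 ι)
    (v : Lp ℂ 1 μX) :
    ∀ᵐ x ∂μX, Tendsto
      (fun n : ℕ => ((normalizer ℓ β n * (n : ℝ) ^ (-β) : ℝ) : ℂ) *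
        ∑ j ∈ Finset.Icc 1 n, ((transferOperator hf ^ j) v : Lp ℂ 1 μX) x)
      atTop (𝓝 (((β⁻¹ * dConst β : ℝ) : ℂ) * ∫ x, v x ∂μX)) := by
  have hYf : μX Y ≠ ∞ := by simp [hY1]
  have hprob : IsProbabilityMeasure (μX.restrict Y) := ⟨by simp [hY1]⟩
  set q : ℕ → ℝ := fun n => (μX.restrict Y).real {y | n < firstReturnTime f Y y} 
  have hq : Antitone q := fun i j hij => measureReal_mono fun y hy => lt_of_le_of_lt hij hy
  have hpos : ∀ n, 0 < q n := by
    have h1 : ∀ n, 1 ≤ n → 0 < q n := fun n hn => by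
      have hn0 : (0 : ℝ) < n := by positivity
      exact (mul_pos (hℓ.pos hn0) (Real.rpow_pos_of_pos hn0 _)).trans_eq (htail n hn).symm
    exact fun n => (h1 (n + 1) (Nat.le_add_left 1 n)).trans_le (hq (Nat.le_succ n))
  have hrv := fun (k : ℕ) (hk : 1 ≤ k) => hℓ.tendsto_tail_ratio (q := q) htail hk
  have hnorm := tendsto_normalizer_div_tailMean hq hpos hrv hβ0 hβ1 htail hdiv
  have hY' := ae_tendsto_tailMean_mul_transferSum hf hcons herg hY hY1 hYf hι hH1 hH2i
    (fun n => rfl) hpos hrv hβ0 hβ1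
  have hΓ := (Real.Gamma_pos_of_pos (show 0 < 1 + β by linarith)).ne'
  have hint1 : ∫ x, indicatorConstLp 1 hY hYf (1 : ℝ) x ∂μX = 1 := by
    rw [integral_congr_ae indicatorConstLp_coeFn, integral_indicator hY]
    simp [measureReal_def]
  have hreal := ae_tendsto_mul_sum_realTransfer hf hcons herg hint1 (inv_ne_zero hΓ) hnorm hY'
  simp only [mul_inv_cancel_right₀ hΓ] at hreal
  set vr := Complex.reCLM.compLpL 1 μX v
  set vi := Complex.imCLM.compLpL 1 μX v
  have hcoe : ∀ᵐ x ∂μX, ∀ j : ℕ, ((transferOperator hf ^ j) v : Lp ℂ 1 μX) x =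
      ((realTransfer hf ^ j) vr x : ℂ) + Complex.I * ((realTransfer hf ^ j) vi x : ℂ) := by
    refine ae_all_iff.2 fun j => ?_
    rw [transferOperator_pow]
    filter_upwards [Lp.coeFn_add (ofRealLp μX ((realTransfer hf ^ j) vr))
        (Complex.I • ofRealLp μX ((realTransfer hf ^ j) vi)),
      Lp.coeFn_smul Complex.I (ofRealLp μX ((realTransfer hf ^ j) vi)),
      coeFn_ofRealLp ((realTransfer hf ^ j) vr), coeFn_ofRealLp ((realTransfer hf ^ j) vi)]
      with x h1 h2 h3 h4
    rw [h1, Pi.add_apply, h2, Pi.smul_apply, h3, h4, smul_eq_mul]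
  have hv : ∫ x, v x ∂μX = ((∫ x, vr x ∂μX : ℝ) : ℂ) + Complex.I * ((∫ x, vi x ∂μX : ℝ) : ℂ) := by
    have hvint : Integrable v μX := L1.integrable_coeFn v
    have e1 : ∫ x, vr x ∂μX = ∫ x, (v x).re ∂μX :=
      integral_congr_ae (ContinuousLinearMap.coeFn_compLpL _ _)
    have e2 : ∫ x, vi x ∂μX = ∫ x, (v x).im ∂μX :=
      integral_congr_ae (ContinuousLinearMap.coeFn_compLpL _ _)
    rw [e1, e2, mul_comm]
    exact (integral_re_add_im hvint).symm
  filter_upwards [hcoe, hreal vr, hreal vi] with x h1 h2 h3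
  have h := ((Complex.continuous_ofReal.tendsto _).comp h2).add
    (((Complex.continuous_ofReal.tendsto _).comp h3).const_mul Complex.I)
  convert h using 2 with n
  · simp only [h1, Function.comp_apply, Finset.sum_add_distrib, ← Finset.mul_sum]
    push_cast
    ring
  · rw [hv]
    push_cast
    ring
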